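/- Any dimaze whose linkability system is not a matroid contains an alternating comb. -/

import Mathlib

open Set

universe u

variable {V : Type*}

/-- A directed path in the digraph `D`: a nonempty duplicate-free list of vertices
with an edge between consecutive vertices. -/
structure DiPath {V : Type*} (D : V → V → Prop) where
  verts : List V
  ne : verts ≠ []
  nodup : verts.Nodup
  chain : verts.Chain' D

namespace DiPath

variable {D : V → V → Prop}

/-- The initial vertex of a directed path. -/
def first (p : DiPath D) : V := p.verts.head p.ne

/-- The terminal vertex of a directed path. -/
def last (p : DiPath D) : V := p.verts.getLast p.ne

/-- The set of vertices of a directed path. -/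
def vertSet (p : DiPath D) : Set V := {v | v ∈ p.verts}

/-- The set of (directed) edges of a directed path. -/
def edgeSet (p : DiPath D) : Set (V × V) := {e | e ∈ p.verts.zip p.verts.tail}

end DiPath

/-- The set of initial vertices of a collection of paths. -/
def Ini {D : V → V → Prop} (P : Set (DiPath D)) : Set V := {v | ∃ p ∈ P, p.first = v}

/-- The set of terminal vertices of a collection of paths. -/
def Ter {D : V → V → Prop} (P : Set (DiPath D)) : Set V := {v | ∃ p ∈ P, p.last = v}

/-- All vertices used by a collection of paths. -/
def LinkVerts {D : V → V → Prop} (P : Set (DiPath D)) : Set V := ⋃ p ∈ P, p.vertSet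

/-- All edges used by a collection of paths. -/
def LinkEdges {D : V → V → Prop} (P : Set (DiPath D)) : Set (V × V) := ⋃ p ∈ P, p.edgeSet

/-- A linkage in the dimaze `(D, B0)`: a set of pairwise vertex-disjoint directed
paths, each ending in `B0`. -/
def IsLinkage (D : V → V → Prop) (B0 : Set V) (P : Set (DiPath D)) : Prop :=
  (∀ p ∈ P, p.last ∈ B0) ∧
  (∀ p ∈ P, ∀ q ∈ P, p ≠ q → Disjoint p.vertSet q.vertSet)

/-- `(D, B0)` is a dimaze: every vertex of `B0` has out-degree `0`. -/
def IsDimaze (D : V → V → Prop) (B0 : Set V) : Prop := ∀ b ∈ B0, ∀ v, ¬ D b v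

/-- A set of vertices is linkable if it is the set of initial vertices of a linkage. -/
def Linkable (D : V → V → Prop) (B0 : Set V) (I : Set V) : Prop :=
  ∃ P, IsLinkage D B0 P ∧ Ini P = I

/-- A set of vertices is linkable onto `B0` if it is the set of initial vertices of
a linkage whose terminal vertices are all of `B0`. -/
def LinkableOnto (D : V → V → Prop) (B0 : Set V) (I : Set V) : Prop :=
  ∃ P, IsLinkage D B0 P ∧ Ini P = I ∧ Ter P = B0

/-- `I` is a maximal element (w.r.t. inclusion) of the set system `Ind`. -/
def MaximalIn {α : Type*} (Ind : Set α → Prop) (I : Set α) : Prop :=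
  Ind I ∧ ∀ J, Ind J → I ⊆ J → J = I

/-- The maximality axiom (IM). -/
def SatisfiesIM {α : Type*} (Ind : Set α → Prop) : Prop :=
  ∀ I X : Set α, Ind I → I ⊆ X →
    ∃ J, Ind J ∧ I ⊆ J ∧ J ⊆ X ∧ ∀ K, Ind K → K ⊆ X → J ⊆ K → K = J

/-- `Ind` is the collection of independent sets of a matroid:
axioms (I1), (I2), (I3) and (IM). -/
def IsMatroidIndep {α : Type*} (Ind : Set α → Prop) : Prop :=
  Ind ∅ ∧
  (∀ I J : Set α, I ⊆ J → Ind J → Ind I) ∧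
  (∀ I B : Set α, Ind I → ¬ MaximalIn Ind I → MaximalIn Ind B →
    ∃ x ∈ B \ I, Ind (insert x I)) ∧
  SatisfiesIM Ind

/-- The dimaze `(D, B0)` contains an alternating comb: there is an alternating ray
(given by the injective vertex sequence `f` and edge orientations `o`, with
infinitely many vertices of in-degree 2) together with a linkage of all its
in-degree-2 vertices and its first vertex onto a set of exits contained in `B0`,
by disjoint paths meeting the ray exactly at their initial vertices. -/
def ContainsAltComb (D : V → V → Prop) (B0 : Set V) : Prop :=
  ∃ (f : ℕ → V) (o : ℕ → Bool) (P : Set (DiPath D)),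
    Function.Injective f ∧
    (∀ n, if o n then D (f n) (f (n+1)) else D (f (n+1)) (f n)) ∧
    (∀ N, ∃ k ≥ N, o k = true ∧ o (k+1) = false) ∧
    IsLinkage D B0 P ∧
    Ini P = insert (f 0) {v | ∃ k, o k = true ∧ o (k+1) = false ∧ v = f (k+1)} ∧
    (∀ p ∈ P, ∀ v ∈ p.vertSet, v ∈ Set.range f → v = p.first)

open Relation

def rs (E : V → V → Prop) (C : Set V) (x y : V) : Prop := E x y ∧ x ∈ C ∧ y ∈ C

theorem rs_mono {E : V → V → Prop} {C C' : Set V} (h : C ⊆ C') {x y : V}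
    (hr : ReflTransGen (rs E C) x y) : ReflTransGen (rs E C') x y := by
  induction hr with
  | refl => exact .refl
  | tail _ h1 ih => exact ih.tail ⟨h1.1, h h1.2.1, h h1.2.2⟩

theorem rs_mono_rel {E E' : V → V → Prop} {C : Set V} (h : ∀ x y, E x y → E' x y) {x y : V}
    (hr : ReflTransGen (rs E C) x y) : ReflTransGen (rs E' C) x y := by
  induction hr with
  | refl => exact .refl
  | tail _ h1 ih => exact ih.tail ⟨h _ _ h1.1, h1.2.1, h1.2.2⟩

theorem rs_flip {E : V → V → Prop} {C : Set V} {x y : V}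
    (hr : ReflTransGen (rs E C) x y) : ReflTransGen (rs (flip E) C) y x := by
  induction hr with
  | refl => exact .refl
  | tail _ h ih => exact ReflTransGen.head ⟨h.1, h.2.2, h.2.1⟩ ih

theorem rs_mem {E : V → V → Prop} {C : Set V} {x y : V}
    (hr : ReflTransGen (rs E C) x y) (hx : x ∈ C) : y ∈ C := by
  cases hr with
  | refl => exact hx
  | tail _ h => exact h.2.2

def Seg (E : V → V → Prop) (S : Set V) (a b : V) : Prop :=
  a ∈ S ∧ b ∈ S ∧ S.Finite ∧ ∀ x ∈ S, ReflTransGen (rs E S) a x ∧ ReflTransGen (rs E S) x b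

theorem Seg.flip {E : V → V → Prop} {S : Set V} {a b : V} (h : Seg E S a b) :
    Seg (flip E) S b a :=
  ⟨h.2.1, h.1, h.2.2.1, fun x hx => ⟨rs_flip (h.2.2.2 x hx).2, rs_flip (h.2.2.2 x hx).1⟩⟩

theorem Seg.mono_rel {E E' : V → V → Prop} (hE : ∀ x y, E x y → E' x y)
    {S : Set V} {a b : V} (h : Seg E S a b) : Seg E' S a b :=
  ⟨h.1, h.2.1, h.2.2.1, fun x hx => ⟨rs_mono_rel hE (h.2.2.2 x hx).1,
    rs_mono_rel hE (h.2.2.2 x hx).2⟩⟩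

theorem Seg.trans {E : V → V → Prop} {S S' : Set V} {a b c : V} (h : Seg E S a b)
    (h' : Seg E S' b c) : Seg E (S ∪ S') a c := by
  have l : S ⊆ S ∪ S' := subset_union_left
  have r : S' ⊆ S ∪ S' := subset_union_right
  refine ⟨l h.1, r h'.2.1, h.2.2.1.union h'.2.2.1, ?_⟩
  have hab := rs_mono l (h.2.2.2 b h.2.1).1
  have hbc := rs_mono r (h'.2.2.2 b h'.1).2
  rintro x (hx | hx)
  · exact ⟨rs_mono l (h.2.2.2 x hx).1, (rs_mono l (h.2.2.2 x hx).2).trans hbc⟩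
  · exact ⟨hab.trans (rs_mono r (h'.2.2.2 x hx).1), rs_mono r (h'.2.2.2 x hx).2⟩

theorem Seg.single {E : V → V → Prop} (a : V) : Seg E {a} a a :=
  ⟨rfl, rfl, finite_singleton a, by rintro x rfl; exact ⟨.refl, .refl⟩⟩

/-- A segment from a path function. -/
theorem Seg.ofPath {E : V → V → Prop} (p : ℕ → V) (i n : ℕ) (hin : i ≤ n)
    (hp : ∀ j, i ≤ j → j < n → E (p j) (p (j+1))) : Seg E (p '' Icc i n) (p i) (p n) := by
  refine ⟨⟨i, ⟨le_rfl, hin⟩, rfl⟩, ⟨n, ⟨hin, le_rfl⟩, rfl⟩, (finite_Icc i n).image p, ?_⟩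
  have key : ∀ k, ∀ j, i ≤ j → j + k ≤ n →
      ReflTransGen (rs E (p '' Icc i n)) (p j) (p (j+k)) := by
    intro k
    induction k with
    | zero => intro j _ _; exact .refl
    | succ k ih =>
      intro j h1 h2
      refine (ih j h1 (by omega)).tail ⟨hp (j+k) (by omega) (by omega), ?_, ?_⟩
      · exact ⟨j+k, ⟨by omega, by omega⟩, rfl⟩
      · exact ⟨j+(k+1), ⟨by omega, by omega⟩, rfl⟩
  rintro _ ⟨j, ⟨h1, h2⟩, rfl⟩
  constructor
  · have := key (j - i) i le_rfl (by omega)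
    rwa [show i + (j - i) = j by omega] at this
  · have := key (n - j) j h1 (by omega)
    rwa [show j + (n - j) = n by omega] at this

/-- Shortest path extraction. -/
theorem exists_path {E : V → V → Prop} {S : Set V} {a b : V} (ha : a ∈ S)
    (h : ReflTransGen (rs E S) a b) : ∃ (n : ℕ) (p : ℕ → V), p 0 = a ∧ p n = b ∧
      (∀ i < n, E (p i) (p (i+1))) ∧ (∀ i ≤ n, p i ∈ S) ∧
      (∀ i ≤ n, ∀ j ≤ n, p i = p j → i = j) := by
  classical
  have hex : ∃ (n : ℕ), ∃ (p : ℕ → V), p 0 = a ∧ p n = b ∧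
      (∀ i < n, E (p i) (p (i+1))) ∧ (∀ i ≤ n, p i ∈ S) := by
    induction h with
    | refl => exact ⟨0, fun _ => a, rfl, rfl, by simp, by simpa using ha⟩
    | @tail y z _ hyz ih =>
      obtain ⟨n, p, h0, hn, he, hS⟩ := ih
      refine ⟨n+1, fun i => if i ≤ n then p i else z, by simp [h0], by simp, ?_, ?_⟩
      · intro i hi
        rcases Nat.lt_succ_iff_lt_or_eq.mp hi with h | rfl
        · have h1 : i ≤ n := h.le
          have h2 : i + 1 ≤ n := h
          simp only [h1, h2, if_true]; exact he i h
        · simp [hn, hyz.1]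
      · intro i hi
        by_cases h1 : i ≤ n
        · simp only [h1, if_true]; exact hS i h1
        · simp only [h1, if_false]; exact hyz.2.2
  obtain ⟨p, h0, hn, he, hS⟩ := Nat.find_spec hex
  refine ⟨Nat.find hex, p, h0, hn, he, hS, ?_⟩
  have key : ∀ i j, i < j → j ≤ Nat.find hex → p i ≠ p j := by
    intro i j hij hj hp
    refine Nat.find_min hex (m := Nat.find hex - (j - i)) (by omega) ?_
    refine ⟨fun k => if k ≤ i then p k else p (k + (j - i)), by simp [h0], ?_, ?_, ?_⟩
    · by_cases h1 : Nat.find hex - (j-i) ≤ i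
      · have : Nat.find hex = j := by omega
        beta_reduce
        rw [if_pos h1, show Nat.find hex - (j-i) = i by omega, hp, ← this, hn]
      · beta_reduce
        rw [if_neg h1, show Nat.find hex - (j-i) + (j-i) = Nat.find hex by omega, hn]
    · intro k hk
      by_cases h1 : k ≤ i
      · by_cases h2 : k + 1 ≤ i
        · simp only [h1, h2, if_true]; exact he k (by omega)
        · have : k = i := by omega
          subst this
          simp only [h1, h2, if_true, if_false]
          rw [hp, show k + 1 + (j - k) = j + 1 by omega]
          exact he j (by omega)
      · have h2 : ¬ (k+1 ≤ i) := by omega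
        simp only [h1, h2, if_false]
        have := he (k + (j-i)) (by omega)
        rwa [show k + (j - i) + 1 = k + 1 + (j-i) by omega] at this
    · intro k hk
      by_cases h1 : k ≤ i
      · simp only [h1, if_true]; exact hS k (by omega)
      · simp only [h1, if_false]; exact hS _ (by omega)
  intro i hi j hj hp
  rcases lt_trichotomy i j with h | h | h
  · exact absurd hp (key i j h hj)
  · exact h
  · exact absurd hp.symm (key j i h hi)

def LkS (E : V → V → Prop) (C A B : Set V) (S : V → Set V) (e : V → V) : Prop :=
  (∀ a ∈ A, S a ⊆ C ∧ Seg E (S a) a (e a) ∧ e a ∈ B) ∧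
  (∀ a ∈ A, ∀ a' ∈ A, ∀ x, x ∈ S a → x ∈ S a' → a = a') ∧
  (∀ b ∈ B, ∃ a ∈ A, e a = b)

def Lk (E : V → V → Prop) (C A B : Set V) : Prop := ∃ S e, LkS E C A B S e

/-- Path-function linkage. -/
def LkP (E : V → V → Prop) (C A B : Set V) (n : V → ℕ) (p : V → ℕ → V) : Prop :=
  (∀ a ∈ A, p a 0 = a ∧ p a (n a) ∈ B ∧ (∀ i < n a, E (p a i) (p a (i+1))) ∧
    (∀ i ≤ n a, p a i ∈ C)) ∧
  (∀ a ∈ A, ∀ a' ∈ A, ∀ i ≤ n a, ∀ j ≤ n a', p a i = p a' j → a = a' ∧ i = j) ∧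
  (∀ b ∈ B, ∃ a ∈ A, p a (n a) = b)

theorem LkS.toP {E : V → V → Prop} {C A B : Set V} {S : V → Set V} {e : V → V}
    (h : LkS E C A B S e) : ∃ n p, LkP E C A B n p ∧
      ∀ a ∈ A, p a (n a) = e a ∧ ∀ i ≤ n a, p a i ∈ S a := by
  classical
  obtain ⟨h1, h2, h3⟩ := h
  have : ∀ a, ∃ (n : ℕ) (p : ℕ → V), a ∈ A → (p 0 = a ∧ p n = e a ∧
      (∀ i < n, E (p i) (p (i+1))) ∧ (∀ i ≤ n, p i ∈ S a) ∧
      (∀ i ≤ n, ∀ j ≤ n, p i = p j → i = j)) := by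
    intro a
    by_cases ha : a ∈ A
    · obtain ⟨_, hs, _⟩ := h1 a ha
      obtain ⟨n, p, hp⟩ := exists_path hs.1 (hs.2.2.2 (e a) hs.2.1).1
      exact ⟨n, p, fun _ => hp⟩
    · exact ⟨0, fun _ => a, fun h => absurd h ha⟩
  choose n p hp using this
  refine ⟨n, p, ⟨?_, ?_, ?_⟩, ?_⟩
  · intro a ha
    obtain ⟨q1, q2, q3, q4, q5⟩ := hp a ha
    exact ⟨q1, by rw [q2]; exact (h1 a ha).2.2, q3, fun i hi => (h1 a ha).1 (q4 i hi)⟩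
  · intro a ha a' ha' i hi j hj hij
    have : a = a' := h2 a ha a' ha' (p a i) ((hp a ha).2.2.2.1 i hi)
      (by rw [hij]; exact (hp a' ha').2.2.2.1 j hj)
    subst this
    exact ⟨rfl, (hp a ha).2.2.2.2 i hi j hj hij⟩
  · intro b hb
    obtain ⟨a, ha, rfl⟩ := h3 b hb
    exact ⟨a, ha, (hp a ha).2.1⟩
  · intro a ha
    exact ⟨(hp a ha).2.1, (hp a ha).2.2.2.1⟩

theorem LkP.toS {E : V → V → Prop} {C A B : Set V} {n : V → ℕ} {p : V → ℕ → V}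
    (h : LkP E C A B n p) :
    LkS E C A B (fun a => p a '' Icc 0 (n a)) (fun a => p a (n a)) := by
  obtain ⟨h1, h2, h3⟩ := h
  refine ⟨?_, ?_, h3⟩
  · intro a ha
    obtain ⟨q1, q2, q3, q4⟩ := h1 a ha
    refine ⟨?_, ?_, q2⟩
    · rintro _ ⟨i, hi, rfl⟩; exact q4 i hi.2
    · have := Seg.ofPath (E := E) (p a) 0 (n a) (Nat.zero_le _) (fun j _ hj => q3 j hj)
      rwa [q1] at this
  · rintro a ha a' ha' x ⟨i, hi, rfl⟩ ⟨j, hj, hij⟩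
    exact (h2 a ha a' ha' i hi.2 j hj.2 hij.symm).1

theorem Lk.toP {E : V → V → Prop} {C A B : Set V} (h : Lk E C A B) : ∃ n p, LkP E C A B n p := by
  obtain ⟨S, e, h⟩ := h
  obtain ⟨n, p, hp, _⟩ := h.toP
  exact ⟨n, p, hp⟩

theorem LkS.inj {E : V → V → Prop} {C A B : Set V} {S : V → Set V} {e : V → V}
    (h : LkS E C A B S e) {a a' : V} (ha : a ∈ A) (ha' : a' ∈ A) (he : e a = e a') : a = a' :=
  h.2.1 a ha a' ha' (e a) (h.1 a ha).2.1.2.1 (by rw [he]; exact (h.1 a' ha').2.1.2.1)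

theorem Lk.flip {E : V → V → Prop} {C A B : Set V} (h : Lk E C A B) : Lk (flip E) C B A := by
  classical
  obtain ⟨S, e, h⟩ := h
  have h' := h
  obtain ⟨h1, h2, h3⟩ := h
  choose! g hg using h3
  refine ⟨fun b => S (g b), g, ?_, ?_, ?_⟩
  · intro b hb
    obtain ⟨q1, q2, q3⟩ := h1 (g b) (hg b hb).1
    refine ⟨q1, ?_, (hg b hb).1⟩
    have := q2.flip
    rwa [(hg b hb).2] at this
  · intro b hb b' hb' x hx hx'
    have := h2 _ (hg b hb).1 _ (hg b' hb').1 x hx hx'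
    rw [← (hg b hb).2, ← (hg b' hb').2, this]
  · intro a ha
    have hb := (h1 a ha).2.2
    exact ⟨e a, hb, h'.inj (hg _ hb).1 ha (hg _ hb).2⟩

/-- Build a linkage with arbitrary (image) target. -/
theorem Lk.mk' {E : V → V → Prop} {C A : Set V} (S : V → Set V) (e : V → V)
    (h1 : ∀ a ∈ A, S a ⊆ C ∧ Seg E (S a) a (e a))
    (h2 : ∀ a ∈ A, ∀ a' ∈ A, ∀ x, x ∈ S a → x ∈ S a' → a = a') :
    LkS E C A (e '' A) S e :=
  ⟨fun a ha => ⟨(h1 a ha).1, (h1 a ha).2, ⟨a, ha, rfl⟩⟩, h2, fun b hb => by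
    obtain ⟨a, ha, rfl⟩ := hb; exact ⟨a, ha, rfl⟩⟩

theorem LkS.restrict {E : V → V → Prop} {C A B : Set V} {S : V → Set V} {e : V → V}
    (h : LkS E C A B S e) {A' : Set V} (hA : A' ⊆ A) : LkS E C A' (e '' A') S e :=
  Lk.mk' S e (fun a ha => ⟨(h.1 a (hA ha)).1, (h.1 a (hA ha)).2.1⟩)
    (fun a ha a' ha' => h.2.1 a (hA ha) a' (hA ha'))

theorem Lk.mono {E E' : V → V → Prop} {C C' A B : Set V} (hE : ∀ x y, E x y → E' x y)
    (hC : C ⊆ C') (h : Lk E C A B) : Lk E' C' A B := by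
  obtain ⟨S, e, h1, h2, h3⟩ := h
  exact ⟨S, e, fun a ha => ⟨(h1 a ha).1.trans hC, (h1 a ha).2.1.mono_rel hE, (h1 a ha).2.2⟩,
    h2, h3⟩

theorem Lk.subset {E : V → V → Prop} {C A B : Set V} (h : Lk E C A B) : A ⊆ C := by
  obtain ⟨S, e, h1, h2, h3⟩ := h
  exact fun a ha => (h1 a ha).1 (h1 a ha).2.1.1

/-- linkable into `T` -/
def LkI (E : V → V → Prop) (C T A : Set V) : Prop := ∃ B ⊆ T, Lk E C A B

theorem LkI.iff {E : V → V → Prop} {C T A : Set V} : LkI E C T A ↔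
    ∃ (S : V → Set V) (e : V → V),
    (∀ a ∈ A, S a ⊆ C ∧ Seg E (S a) a (e a) ∧ e a ∈ T) ∧
    (∀ a ∈ A, ∀ a' ∈ A, ∀ x, x ∈ S a → x ∈ S a' → a = a') := by
  constructor
  · rintro ⟨B, hB, S, e, h1, h2, h3⟩
    exact ⟨S, e, fun a ha => ⟨(h1 a ha).1, (h1 a ha).2.1, hB (h1 a ha).2.2⟩, h2⟩
  · rintro ⟨S, e, h1, h2⟩
    refine ⟨e '' A, ?_, S, e, Lk.mk' S e (fun a ha => ⟨(h1 a ha).1, (h1 a ha).2.1⟩) h2⟩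
    rintro _ ⟨a, ha, rfl⟩; exact (h1 a ha).2.2

theorem LkI.subset {E : V → V → Prop} {C T A : Set V} (h : LkI E C T A) : A ⊆ C := by
  obtain ⟨B, _, h⟩ := h; exact h.subset

theorem LkI.mono {E : V → V → Prop} {C C' T T' A A' : Set V} (h : LkI E C T A)
    (hC : C ⊆ C') (hT : T ⊆ T') (hA : A' ⊆ A) : LkI E C' T' A' := by
  rw [LkI.iff] at h ⊢
  obtain ⟨S, e, h1, h2⟩ := h
  exact ⟨S, e, fun a ha => ⟨(h1 a (hA ha)).1.trans hC, (h1 a (hA ha)).2.1, hT (h1 a (hA ha)).2.2⟩,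
    fun a ha a' ha' => h2 a (hA ha) a' (hA ha')⟩

/-- No hotel. -/
def NH (E : V → V → Prop) (C S T : Set V) : Prop :=
  ¬ ∃ (a b : ℕ → V) (Q R : ℕ → Set V),
    (∀ i, a i ∈ S ∧ b i ∈ T ∧ Q i ⊆ C ∧ R i ⊆ C ∧ Seg E (Q i) (a i) (b i) ∧
      Seg E (R i) (a (i+1)) (b i)) ∧
    (∀ i j x, x ∈ Q i → x ∈ Q j → i = j) ∧ (∀ i j x, x ∈ R i → x ∈ R j → i = j)

theorem NH.flip {E : V → V → Prop} {C S T : Set V} (h : NH E C S T) : NH (flip E) C T S := by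
  rintro ⟨a, b, Q, R, h1, h2, h3⟩
  refine h ⟨b, fun i => a (i+1), R, fun i => Q (i+1), ?_, h3, ?_⟩
  · intro i
    exact ⟨(h1 i).2.1, (h1 (i+1)).1, (h1 i).2.2.2.1, (h1 (i+1)).2.2.1, (h1 i).2.2.2.2.2.flip,
      (h1 (i+1)).2.2.2.2.1.flip⟩
  · intro i j x hx hx'
    have := h2 _ _ x hx hx'
    omega

theorem NH.mono {E E' : V → V → Prop} {C C' S S' T T' : Set V} (h : NH E C S T)
    (hE : ∀ x y, E' x y → E x y) (hC : C' ⊆ C) (hS : S' ⊆ S) (hT : T' ⊆ T) : NH E' C' S' T' := by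
  rintro ⟨a, b, Q, R, h1, h2, h3⟩
  exact h ⟨a, b, Q, R, fun i => ⟨hS (h1 i).1, hT (h1 i).2.1, (h1 i).2.2.1.trans hC,
    (h1 i).2.2.2.1.trans hC, (h1 i).2.2.2.2.1.mono_rel hE, (h1 i).2.2.2.2.2.mono_rel hE⟩, h2, h3⟩

theorem NH.union_finite {E : V → V → Prop} {C S T F F' : Set V} (h : NH E C S T)
    (hF : F.Finite) (hF' : F'.Finite) : NH E C (S ∪ F) (T ∪ F') := by
  rintro ⟨a, b, Q, R, h1, h2, h3⟩
  have ainj : Function.Injective a := fun i j hij =>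
    h2 i j (a i) (h1 i).2.2.2.2.1.1 (by rw [hij]; exact (h1 j).2.2.2.2.1.1)
  have binj : Function.Injective b := fun i j hij =>
    h2 i j (b i) (h1 i).2.2.2.2.1.2.1 (by rw [hij]; exact (h1 j).2.2.2.2.1.2.1)
  have f1 : (a ⁻¹' F).Finite := hF.preimage ainj.injOn
  have f2 : (b ⁻¹' F').Finite := hF'.preimage binj.injOn
  obtain ⟨N, hN⟩ := (f1.union f2).bddAbove
  refine h ⟨fun i => a (i + (N+1)), fun i => b (i+(N+1)), fun i => Q (i+(N+1)),
    fun i => R (i+(N+1)), ?_, ?_, ?_⟩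
  · intro i
    obtain ⟨q1, q2, q3, q4, q5, q6⟩ := h1 (i+(N+1))
    refine ⟨?_, ?_, q3, q4, q5, ?_⟩
    · rcases q1 with q | q
      · exact q
      · have := hN (Or.inl q); omega
    · rcases q2 with q | q
      · exact q
      · have := hN (Or.inr q); omega
    · beta_reduce
      rwa [show i + 1 + (N+1) = i + (N+1) + 1 by omega]
  · intro i j x hx hx'
    have := h2 _ _ x hx hx'; omega
  · intro i j x hx hx'
    have := h3 _ _ x hx hx'; omega

theorem pym_core {E : V → V → Prop} {C A B A' B' : Set V} {n m : V → ℕ} {q p : V → ℕ → V}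
    (hq : LkP E C A B n q) (hp : LkP E C A' B' m p) :
    ∃ A'' B'' S e, LkS E C A'' B'' S e ∧ A ⊆ A'' ∧ A'' ⊆ A ∪ A' ∧ B' ⊆ B'' ∧ B'' ⊆ B ∪ B' ∧
      ∀ a ∈ A'', ∀ b ∈ A', m b = 0 → e a = b → a = b ∨
        (a ∈ A ∧ ∃ s ≤ n a, q a s = b ∧ S a = q a '' Icc 0 s) := by
  classical
  obtain ⟨hq1, hq2, hq3⟩ := hq
  obtain ⟨hp1, hp2, hp3⟩ := hp
  set VP : Set V := {x | ∃ a ∈ A', ∃ i ≤ m a, p a i = x} with hVP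
  let Pr : Set V → Set V := fun R => {x | ∃ a ∈ A, ∃ i ≤ n a, q a i = x ∧ x ∈ VP ∧
    ∀ j < i, q a j ∈ VP → q a j ∈ R}
  let F : Set V → Set V := fun R => {x | ∃ a ∈ A', ∃ i j, i < j ∧ j ≤ m a ∧ p a i = x ∧
    p a j ∈ Pr R}
  have Fmono : Monotone F := by
    rintro R R' h x ⟨a, ha, i, j, hij, hj, hx, a2, ha2, i2, hi2, h4, h5, h6⟩
    exact ⟨a, ha, i, j, hij, hj, hx, a2, ha2, i2, hi2, h4, h5, fun k hk hv => h (h6 k hk hv)⟩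
  obtain ⟨R, hR⟩ : ∃ R, F R = R := ⟨OrderHom.lfp ⟨F, Fmono⟩, OrderHom.map_lfp ⟨F, Fmono⟩⟩
  -- acceptance
  have hacc : ∀ a ∈ A', ∀ i ≤ m a, ∀ j ≤ m a, p a i ∉ R → p a j ∈ Pr R → j ≤ i := by
    intro a ha i hi j hj h1 h2
    by_contra hlt
    exact h1 (hR ▸ (⟨a, ha, i, j, by omega, hj, rfl, h2⟩ : p a i ∈ F R))
  have hrej : ∀ a ∈ A', ∀ i ≤ m a, (∀ j ≤ m a, p a j ∈ Pr R → j ≤ i) → p a i ∉ R := by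
    intro a ha i hi h1 h2
    rw [← hR] at h2
    obtain ⟨a2, ha2, i2, j2, hij, hj, hx, h3⟩ := h2
    obtain ⟨rfl, rfl⟩ := hp2 a2 ha2 a ha i2 (by omega) i hi hx
    have := h1 j2 hj h3
    omega
  -- data for each a ∈ A
  let c1 : V → Prop := fun a => ∀ j ≤ n a, q a j ∈ VP → q a j ∈ R
  have hA : ∀ a, ∃ (s : ℕ) (a' : V) (t : ℕ), a ∈ A → ¬ c1 a → s ≤ n a ∧ a' ∈ A' ∧ t ≤ m a' ∧
      p a' t = q a s ∧ q a s ∉ R ∧ ∀ j < s, q a j ∈ VP → q a j ∈ R := by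
    intro a
    by_cases h : a ∈ A ∧ ¬ c1 a
    · obtain ⟨ha, hc⟩ := h
      have hc' : ∃ j, j ≤ n a ∧ q a j ∈ VP ∧ q a j ∉ R := by
        simp only [c1] at hc; push Not at hc; exact hc
      obtain ⟨h1, ⟨a', ha', t, ht, h2⟩, h3⟩ := Nat.find_spec hc'
      refine ⟨Nat.find hc', a', t, fun _ _ => ⟨h1, ha', ht, h2, h3, ?_⟩⟩
      intro j hj hv
      by_contra hn
      exact Nat.find_min hc' hj ⟨by omega, hv, hn⟩
    · exact ⟨0, a, 0, fun h1 h2 => absurd ⟨h1, h2⟩ h⟩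
  choose s f t hs using hA
  let N : Set V := {a | a ∈ A' ∧ ∀ i ≤ m a, p a i ∉ Pr R}
  let S : V → Set V := fun a => if a ∈ A then
    (if c1 a then q a '' Icc 0 (n a) else q a '' Icc 0 (s a) ∪ p (f a) '' Icc (t a) (m (f a)))
    else p a '' Icc 0 (m a)
  let e : V → V := fun a => if a ∈ A then (if c1 a then q a (n a) else p (f a) (m (f a)))
    else p a (m a)
  have SA1 : ∀ a ∈ A, c1 a → S a = q a '' Icc 0 (n a) := by
    intro a ha hc; simp only [S, if_pos ha, if_pos hc]
  have SA2 : ∀ a ∈ A, ¬ c1 a → S a = q a '' Icc 0 (s a) ∪ p (f a) '' Icc (t a) (m (f a)) := by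
    intro a ha hc; simp only [S, if_pos ha, if_neg hc]
  have SN : ∀ a, a ∉ A → S a = p a '' Icc 0 (m a) := by
    intro a ha; simp only [S, if_neg ha]
  have eA1 : ∀ a ∈ A, c1 a → e a = q a (n a) := by
    intro a ha hc; simp only [e, if_pos ha, if_pos hc]
  have eA2 : ∀ a ∈ A, ¬ c1 a → e a = p (f a) (m (f a)) := by
    intro a ha hc; simp only [e, if_pos ha, if_neg hc]
  have eN : ∀ a, a ∉ A → e a = p a (m a) := by
    intro a ha; simp only [e, if_neg ha]
  have NA : ∀ a ∈ N, a ∉ A := by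
    intro a ha haA
    refine ha.2 0 (Nat.zero_le _) ⟨a, haA, 0, Nat.zero_le _, ?_, ?_, by simp⟩
    · rw [(hq1 a haA).1, (hp1 a ha.1).1]
    · exact ⟨a, ha.1, 0, Nat.zero_le _, rfl⟩
  -- description of the members of S a
  have mem : ∀ a ∈ A ∪ N, ∀ x ∈ S a,
      (a ∈ A ∧ ∃ i ≤ n a, q a i = x ∧ (x ∈ VP → x ∈ Pr R)) ∨
      (∃ a' ∈ A', ∃ j ≤ m a', p a' j = x ∧ ((a ∈ A ∧ ¬ c1 a ∧ a' = f a ∧ t a ≤ j) ∨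
        (a ∈ N ∧ a' = a))) := by
    intro a ha x hx
    by_cases haA : a ∈ A
    · by_cases hc : c1 a
      · rw [SA1 a haA hc] at hx
        obtain ⟨i, hi, rfl⟩ := hx
        exact Or.inl ⟨haA, i, hi.2, rfl, fun hv => ⟨a, haA, i, hi.2, rfl, hv,
          fun j hj hv' => hc j (by have := hi.2; omega) hv'⟩⟩
      · rw [SA2 a haA hc] at hx
        obtain ⟨k1, k2, k3, k4, k5, k6⟩ := hs a haA hc
        rcases hx with ⟨i, hi, rfl⟩ | ⟨j, hj, rfl⟩
        · have := hi.2
          exact Or.inl ⟨haA, i, by omega, rfl, fun hv => ⟨a, haA, i, by omega, rfl, hv,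
            fun j hj hv' => k6 j (by omega) hv'⟩⟩
        · exact Or.inr ⟨f a, k2, j, hj.2, rfl, Or.inl ⟨haA, hc, rfl, hj.1⟩⟩
    · have hN : a ∈ N := ha.resolve_left haA
      rw [SN a haA] at hx
      obtain ⟨i, hi, rfl⟩ := hx
      exact Or.inr ⟨a, hN.1, i, hi.2, rfl, Or.inr ⟨hN, rfl⟩⟩
  -- the accepted vertex
  have accPr : ∀ a ∈ A, ¬ c1 a → p (f a) (t a) ∈ Pr R := by
    intro a ha hc
    obtain ⟨k1, k2, k3, k4, k5, k6⟩ := hs a ha hc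
    exact ⟨a, ha, s a, k1, k4.symm, ⟨f a, k2, t a, k3, rfl⟩, k6⟩
  have uniq : ∀ a ∈ A, ∀ a' ∈ A, ¬ c1 a → ¬ c1 a' → f a = f a' → a = a' := by
    intro a ha a' ha' hc hc' hf
    obtain ⟨k1, k2, k3, k4, k5, k6⟩ := hs a ha hc
    obtain ⟨k1', k2', k3', k4', k5', k6'⟩ := hs a' ha' hc'
    have h1 := accPr a ha hc
    have h2 := accPr a' ha' hc'
    have h3 := hacc (f a) k2 (t a) k3 (t a') (hf ▸ k3') (k4 ▸ k5) (hf ▸ h2)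
    have h4 := hacc (f a') k2' (t a') k3' (t a) (hf ▸ k3) (k4' ▸ k5') (hf ▸ h1)
    have h5 : t a = t a' := le_antisymm h4 h3
    have : q a (s a) = q a' (s a') := by rw [← k4, ← k4', hf, h5]
    exact (hq2 a ha a' ha' _ k1 _ k1' this).1
  -- mixed
  have mixed : ∀ a ∈ A, ∀ a' ∈ A ∪ N, ∀ x, (∃ i ≤ n a, q a i = x ∧ (x ∈ VP → x ∈ Pr R)) →
      (∃ b ∈ A', ∃ j ≤ m b, p b j = x ∧ ((a' ∈ A ∧ ¬ c1 a' ∧ b = f a' ∧ t a' ≤ j) ∨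
        (a' ∈ N ∧ b = a'))) → a = a' := by
    rintro a ha a' ha' x ⟨i, hi, hix, hPr⟩ ⟨b, hb, j, hj, hjx, h⟩
    have hxPr := hPr ⟨b, hb, j, hj, hjx⟩
    rcases h with ⟨haA, hc, rfl, htj⟩ | ⟨hN, rfl⟩
    · obtain ⟨k1, k2, k3, k4, k5, k6⟩ := hs a' haA hc
      have h3 := hacc (f a') k2 (t a') k3 j hj (k4 ▸ k5) (hjx ▸ hxPr)
      have : t a' = j := le_antisymm htj h3
      exact (hq2 a ha a' haA i hi (s a') k1 (by rw [hix, ← k4, this, hjx])).1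
    · exact absurd (hjx ▸ hxPr) (hN.2 j hj)
  refine ⟨A ∪ N, e '' (A ∪ N), S, e, Lk.mk' S e ?_ ?_, subset_union_left, ?_, ?_, ?_, ?_⟩
  · intro a ha
    by_cases haA : a ∈ A
    · obtain ⟨g1, g2, g3, g4⟩ := hq1 a haA
      by_cases hc : c1 a
      · rw [SA1 a haA hc, eA1 a haA hc]
        refine ⟨?_, ?_⟩
        · rintro _ ⟨i, hi, rfl⟩; exact g4 i hi.2
        · have := Seg.ofPath (E := E) (q a) 0 (n a) (Nat.zero_le _) (fun j _ hj => g3 j hj)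
          rwa [g1] at this
      · rw [SA2 a haA hc, eA2 a haA hc]
        obtain ⟨k1, k2, k3, k4, k5, k6⟩ := hs a haA hc
        obtain ⟨g1', g2', g3', g4'⟩ := hp1 (f a) k2
        refine ⟨?_, ?_⟩
        · rintro _ (⟨i, hi, rfl⟩ | ⟨i, hi, rfl⟩)
          · exact g4 i (hi.2.trans k1)
          · exact g4' i hi.2
        · have h1 := Seg.ofPath (E := E) (q a) 0 (s a) (Nat.zero_le _)
            (fun j _ hj => g3 j (by omega))
          have h2 := Seg.ofPath (E := E) (p (f a)) (t a) (m (f a)) k3 (fun j _ hj => g3' j hj)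
          rw [g1, ← k4] at h1
          exact h1.trans h2
    · have hN : a ∈ N := ha.resolve_left haA
      obtain ⟨g1, g2, g3, g4⟩ := hp1 a hN.1
      rw [SN a haA, eN a haA]
      refine ⟨?_, ?_⟩
      · rintro _ ⟨i, hi, rfl⟩; exact g4 i hi.2
      · have := Seg.ofPath (E := E) (p a) 0 (m a) (Nat.zero_le _) (fun j _ hj => g3 j hj)
        rwa [g1] at this
  · intro a ha a' ha' x hx hx'
    rcases mem a ha x hx with ⟨haA, h⟩ | h
    · rcases mem a' ha' x hx' with ⟨haA', h'⟩ | h'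
      · obtain ⟨i, hi, hix, _⟩ := h
        obtain ⟨j, hj, hjx, _⟩ := h'
        exact (hq2 a haA a' haA' i hi j hj (hix.trans hjx.symm)).1
      · exact mixed a haA a' ha' x h h'
    · rcases mem a' ha' x hx' with ⟨haA', h'⟩ | h'
      · exact (mixed a' haA' a ha x h' h).symm
      · obtain ⟨b, hb, j, hj, hjx, h⟩ := h
        obtain ⟨b', hb', j', hj', hjx', h'⟩ := h'
        have hbb : b = b' := (hp2 b hb b' hb' j hj j' hj' (hjx.trans hjx'.symm)).1
        rcases h with ⟨haA, hc, hbf, htj⟩ | ⟨hN, hba⟩ <;>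
          rcases h' with ⟨haA', hc', hbf', htj'⟩ | ⟨hN', hba'⟩
        · exact uniq a haA a' haA' hc hc' (by rw [← hbf, ← hbf', hbb])
        · have k3 := (hs a haA hc).2.2.1
          have := accPr a haA hc
          rw [← hbf, hbb, hba'] at this
          exact absurd this (hN'.2 _ (by rw [← hba', ← hbb, hbf]; exact k3))
        · have k3 := (hs a' haA' hc').2.2.1
          have := accPr a' haA' hc'
          rw [← hbf', ← hbb, hba] at this
          exact absurd this (hN.2 _ (by rw [← hba, hbb, hbf']; exact k3))
        · rw [← hba, ← hba', hbb]
  · rintro a (ha | ha)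
    · exact Or.inl ha
    · exact Or.inr ha.1
  · intro b hb
    obtain ⟨a', ha', rfl⟩ := hp3 b hb
    by_cases hN : a' ∈ N
    · exact ⟨a', Or.inr hN, eN a' (NA a' hN)⟩
    · have hex : ∃ i ≤ m a', p a' i ∈ Pr R := by
        by_contra hcon; push Not at hcon; exact hN ⟨ha', hcon⟩
      -- last proposal
      let T : Finset ℕ := (Finset.range (m a' + 1)).filter (fun i => p a' i ∈ Pr R)
      have hT : T.Nonempty := by
        obtain ⟨i, hi, h⟩ := hex
        exact ⟨i, by simp only [T, Finset.mem_filter, Finset.mem_range]; exact ⟨by omega, h⟩⟩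
      have hM := Finset.max'_mem T hT
      set M := T.max' hT with hMd
      simp only [T, Finset.mem_filter, Finset.mem_range] at hM
      have hnR : p a' M ∉ R := hrej a' ha' M (by omega) (fun j hj hPr =>
        Finset.le_max' T j (by simp only [T, Finset.mem_filter, Finset.mem_range]
                               exact ⟨by omega, hPr⟩))
      obtain ⟨a, ha, i, hi, hix, hv, hj⟩ := hM.2
      have hc : ¬ c1 a := fun hc => hnR (hix ▸ hc i hi (hix ▸ hv))
      obtain ⟨k1, k2, k3, k4, k5, k6⟩ := hs a ha hc
      have hsi : s a = i := by
        rcases lt_trichotomy (s a) i with h | h | h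
        · exact absurd (hj (s a) h ⟨f a, k2, t a, k3, k4⟩) k5
        · exact h
        · exact absurd (hix ▸ k6 i h (hix ▸ hv)) hnR
      have hf : f a = a' := (hp2 (f a) k2 a' ha' (t a) k3 M (by omega)
        (by rw [k4, hsi, hix])).1
      exact ⟨a, Or.inl ha, by rw [eA2 a ha hc, hf]⟩
  · rintro _ ⟨a, ha, rfl⟩
    by_cases haA : a ∈ A
    · by_cases hc : c1 a
      · rw [eA1 a haA hc]; exact Or.inl (hq1 a haA).2.1
      · rw [eA2 a haA hc]; exact Or.inr (hp1 _ (hs a haA hc).2.1).2.1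
    · rw [eN a haA]; exact Or.inr (hp1 a (ha.resolve_left haA).1).2.1
  · intro a ha b hb hmb heb
    have hb0 := (hp1 b hb).1
    by_cases haA : a ∈ A
    · by_cases hc : c1 a
      · exact Or.inr ⟨haA, n a, le_rfl, by rw [← heb, eA1 a haA hc], SA1 a haA hc⟩
      · obtain ⟨k1, k2, k3, k4, k5, k6⟩ := hs a haA hc
        rw [eA2 a haA hc] at heb
        obtain ⟨hfb, hm0⟩ := hp2 (f a) k2 b hb (m (f a)) le_rfl 0 (Nat.zero_le _)
          (by rw [heb, hb0])
        have ht0 : t a = 0 := by omega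
        have hq0 : q a (s a) = b := by rw [← k4, hfb, ht0, hb0]
        refine Or.inr ⟨haA, s a, k1, hq0, ?_⟩
        rw [SA2 a haA hc, union_eq_left]
        rintro _ ⟨j, hj, rfl⟩
        have hj2 := hj.2
        have : j = 0 := by omega
        exact ⟨s a, ⟨Nat.zero_le _, le_rfl⟩, by rw [this, hfb, hb0, hq0]⟩
    · left
      rw [eN a haA] at heb
      exact (hp2 a (ha.resolve_left haA).1 b hb (m a) le_rfl 0 (Nat.zero_le _)
        (by rw [heb, hb0])).1

theorem pym {E : V → V → Prop} {C A B A' B' : Set V} (hq : Lk E C A B) (hp : Lk E C A' B') :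
    ∃ A'' B'', Lk E C A'' B'' ∧ A ⊆ A'' ∧ A'' ⊆ A ∪ A' ∧ B' ⊆ B'' ∧ B'' ⊆ B ∪ B' := by
  obtain ⟨n, q, hq⟩ := hq.toP
  obtain ⟨m, p, hp⟩ := hp.toP
  obtain ⟨A'', B'', S, e, h, h1, h2, h3, h4, _⟩ := pym_core hq hp
  exact ⟨A'', B'', ⟨S, e, h⟩, h1, h2, h3, h4⟩

theorem pointer {E : V → V → Prop} {C A B A' B' : Set V} (h : Lk E C A B) (h' : Lk E C A' B')
    (hB : B ⊆ B') (hN : NH E C A B) : (A \ A').encard ≤ (A' \ A).encard := by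
  classical
  obtain ⟨S, e, h⟩ := h
  obtain ⟨S', e', h'⟩ := h'
  have hg0 := h'.2.2
  choose! g hg using hg0
  let σ : V → V := fun a => g (e a)
  have hσ : ∀ a ∈ A, σ a ∈ A' ∧ e' (σ a) = e a := fun a ha => hg _ (hB (h.1 a ha).2.2)
  have σinj : ∀ a ∈ A, ∀ a' ∈ A, σ a = σ a' → a = a' := by
    intro a ha a' ha' hs
    refine h.inj ha ha' ?_
    rw [← (hσ a ha).2, ← (hσ a' ha').2, hs]
  have peel : ∀ i d a a2, (∀ k < i, σ^[k] a ∈ A) → (∀ k < i + d, σ^[k] a2 ∈ A) →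
      σ^[i] a = σ^[i+d] a2 → a = σ^[d] a2 := by
    intro i
    induction i with
    | zero => intro d a a2 _ _ h; simpa using h
    | succ i ih =>
      intro d a a2 h1 h2 h3
      refine ih d a a2 (fun k hk => h1 k (by omega)) (fun k hk => h2 k (by omega)) ?_
      rw [show i + 1 + d = (i + d) + 1 by omega, Function.iterate_succ_apply',
        Function.iterate_succ_apply'] at h3
      exact σinj _ (h1 i (by omega)) _ (h2 (i+d) (by omega)) h3
  have inA' : ∀ d a, (∀ k < d + 1, σ^[k] a ∈ A) → σ^[d+1] a ∈ A' := by
    intro d a h1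
    rw [Function.iterate_succ_apply']
    exact (hσ _ (h1 d (by omega))).1
  have hex : ∀ a ∈ A \ A', ∃ n, σ^[n] a ∉ A := by
    intro a ha
    by_contra hcon
    push Not at hcon
    have inj : ∀ i j, σ^[i] a = σ^[j] a → i = j := by
      have key : ∀ i j, i < j → σ^[i] a ≠ σ^[j] a := by
        intro i j hij he
        obtain ⟨d, rfl⟩ := Nat.exists_eq_add_of_lt hij
        have := peel i (d+1) a a (fun k _ => hcon k) (fun k _ => hcon k) he
        exact ha.2 (this ▸ inA' d a (fun k _ => hcon k))
      intro i j he
      rcases lt_trichotomy i j with h | h | h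
      · exact absurd he (key i j h)
      · exact h
      · exact absurd he.symm (key j i h)
    refine hN ⟨fun i => σ^[i] a, fun i => e (σ^[i] a), fun i => S (σ^[i] a),
      fun i => S' (σ^[i+1] a), ?_, ?_, ?_⟩
    · intro i
      have h1 := h.1 _ (hcon i)
      have h2 := hσ _ (hcon i)
      rw [← Function.iterate_succ_apply' σ i a] at h2
      have h3 := h'.1 _ h2.1
      refine ⟨hcon i, h1.2.2, h1.1, h3.1, h1.2.1, ?_⟩
      have h4 := h3.2.1
      rw [h2.2] at h4
      exact h4
    · intro i j x hx hx'
      exact inj _ _ (h.2.1 _ (hcon i) _ (hcon j) x hx hx')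
    · intro i j x hx hx'
      have := inj _ _ (h'.2.1 _ (inA' i a (fun k _ => hcon k)) _ (inA' j a (fun k _ => hcon k))
        x hx hx')
      omega
  have hN' : ∀ a, ∃ n, a ∈ A \ A' → σ^[n+1] a ∉ A ∧ ∀ k < n + 1, σ^[k] a ∈ A := by
    intro a
    by_cases ha : a ∈ A \ A'
    · have hne : Nat.find (hex a ha) ≠ 0 := by
        intro h0
        have := Nat.find_spec (hex a ha)
        rw [h0] at this
        exact this ha.1
      obtain ⟨n, hn⟩ := Nat.exists_eq_succ_of_ne_zero hne
      refine ⟨n, fun _ => ⟨?_, fun k hk => ?_⟩⟩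
      · have := Nat.find_spec (hex a ha)
        rwa [hn] at this
      · by_contra hk'
        exact Nat.find_min (hex a ha) (m := k) (by omega) hk'
    · exact ⟨0, fun h => absurd h ha⟩
  choose N hN1 using hN'
  refine encard_le_encard_of_injOn (f := fun a => σ^[N a + 1] a) ?_ ?_
  · intro a ha
    exact ⟨inA' _ _ (hN1 a ha).2, (hN1 a ha).1⟩
  · have key : ∀ a ∈ A \ A', ∀ a2 ∈ A \ A', N a ≤ N a2 → σ^[N a + 1] a = σ^[N a2 + 1] a2 →
        a = a2 := by
      intro a ha a2 ha2 hle he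
      obtain ⟨d, hd⟩ := Nat.exists_eq_add_of_le hle
      have h1 := peel (N a + 1) d a a2 (hN1 a ha).2 (fun k hk => (hN1 a2 ha2).2 k (by omega))
        (by rw [he, hd, show N a + d + 1 = N a + 1 + d by omega])
      cases d with
      | zero => simpa using h1
      | succ d =>
        exfalso
        exact ha.2 (h1 ▸ inA' d a2 (fun k hk => (hN1 a2 ha2).2 k (by omega)))
    intro a ha a2 ha2 he
    rcases le_total (N a) (N a2) with h | h
    · exact key a ha a2 ha2 h he
    · exact (key a2 ha2 a ha h he.symm).symm

/-- maximal linkable subset of `X` -/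
def MaxS (E : V → V → Prop) (C X T A : Set V) : Prop :=
  A ⊆ X ∧ LkI E C T A ∧ ∀ A', A ⊆ A' → A' ⊆ X → LkI E C T A' → A' = A

def HasBase (E : V → V → Prop) (C X T : Set V) : Prop := ∃ A, MaxS E C X T A

theorem MaxS.dual {E : V → V → Prop} {C X T A B : Set V} (hN : NH E C X T)
    (h : MaxS E C X T A) (hB : B ⊆ T) (hL : Lk E C A B) : MaxS (flip E) C T X B := by
  refine ⟨hB, ⟨A, h.1, hL.flip⟩, ?_⟩
  rintro B' hBB' hB'T ⟨A', hA', hL'⟩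
  have hL' : Lk E C A' B' := hL'.flip
  obtain ⟨A'', B'', hL'', h1, h2, h3, h4⟩ := pym hL hL'
  have hA'' : A'' = A := h.2.2 A'' h1 (h2.trans (union_subset h.1 hA'))
    ⟨B'', h4.trans (union_subset hB hB'T), hL''⟩
  subst hA''
  have hp := pointer hL''.flip hL.flip subset_rfl
    (hN.flip.mono (fun _ _ => id) subset_rfl (h4.trans (union_subset hB hB'T)) h.1)
  rw [sdiff_eq_empty.mpr (hBB'.trans h3), encard_empty] at hp
  have : B'' \ B = ∅ := by simpa using hp
  exact subset_antisymm (h3.trans (sdiff_eq_empty.mp this)) hBB'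

theorem HasBase.dual {E : V → V → Prop} {C X T : Set V} (hN : NH E C X T)
    (h : HasBase E C X T) : HasBase (flip E) C T X := by
  obtain ⟨A, hA⟩ := h
  obtain ⟨B, hB, hL⟩ := hA.2.1
  exact ⟨B, hA.dual hN hB hL⟩

theorem HasBase.ext {E : V → V → Prop} {C X T I : Set V} (hN : NH E C X T)
    (h : HasBase E C X T) (hI : I ⊆ X) (hIL : LkI E C T I) : ∃ A, I ⊆ A ∧ MaxS E C X T A := by
  obtain ⟨J, hJ⟩ := h
  obtain ⟨B, hB, hL⟩ := hJ.2.1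
  have hd := hJ.dual hN hB hL
  obtain ⟨B', hB', hL'⟩ := hIL
  obtain ⟨A'', B'', hL'', h1, h2, h3, h4⟩ := pym hL' hL
  have hA''X : A'' ⊆ X := h2.trans (union_subset hI hJ.1)
  have : B'' = B := hd.2.2 B'' h3 (h4.trans (union_subset hB' hB)) ⟨A'', hA''X, hL''.flip⟩
  subst this
  exact ⟨A'', h1, MaxS.dual (E := flip E) hN.flip hd hA''X hL''.flip⟩

theorem MaxS.exchange {E : V → V → Prop} {C X T J K : Set V} (hN : NH E C X T)
    (hJ : MaxS E C X T J) (hK : K ⊆ X) (hKL : LkI E C T K) :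
    (K \ J).encard ≤ (J \ K).encard := by
  obtain ⟨B, hB, hL⟩ := hJ.2.1
  have hd := hJ.dual hN hB hL
  obtain ⟨B', hB', hL'⟩ := hKL
  obtain ⟨A'', B'', hL'', h1, h2, h3, h4⟩ := pym hL' hL
  have hA''X : A'' ⊆ X := h2.trans (union_subset hK hJ.1)
  have : B'' = B := hd.2.2 B'' h3 (h4.trans (union_subset hB' hB)) ⟨A'', hA''X, hL''.flip⟩
  subst this
  have := pointer hL'' hL subset_rfl (hN.mono (fun _ _ => id) subset_rfl hA''X hB)
  calc (K \ J).encard ≤ (A'' \ J).encard := encard_le_encard (sdiff_subset_sdiff_left h1)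
    _ ≤ (J \ A'').encard := this
    _ ≤ (J \ K).encard := encard_le_encard (sdiff_subset_sdiff_right h1)

/-- (I3)-type statement: if `I` is maximal in `I ∪ B` and `B` is maximal in everything. -/
theorem i3_aux {E : V → V → Prop} {C T I B : Set V} (hN : NH E C univ T) (hTC : T ⊆ C)
    (hI : MaxS E C (I ∪ B) T I) (hB : MaxS E C univ T B) : MaxS E C univ T I := by
  obtain ⟨Y, hY, hL⟩ := hI.2.1
  have hN' := hN.mono (fun _ _ => id) subset_rfl (subset_univ (I ∪ B)) subset_rfl
  have hd := hI.dual hN' hY hL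
  obtain ⟨Y', hY', hL'⟩ := hB.2.1
  obtain ⟨A'', B'', hL'', h1, h2, h3, h4⟩ := pym hL' hL
  have hA : A'' = B := hB.2.2 A'' h1 (subset_univ _) ⟨B'', h4.trans (union_subset hY' hY), hL''⟩
  subst hA
  have hBY : B'' = Y := hd.2.2 B'' h3 (h4.trans (union_subset hY' hY))
    ⟨A'', subset_union_right, hL''.flip⟩
  subst hBY
  have hdB := hB.dual hN hY hL''
  have hT : Lk E C T T := ⟨fun a => {a}, id,
    fun a ha => ⟨singleton_subset_iff.mpr (hTC ha), Seg.single a, ha⟩,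
    fun a _ a' _ x hx hx' => by rw [← mem_singleton_iff.mp hx, ← mem_singleton_iff.mp hx'],
    fun b hb => ⟨b, hb, rfl⟩⟩
  have hTY : T = B'' := hdB.2.2 T hY subset_rfl ⟨T, subset_univ _, hT.flip⟩
  subst hTY
  refine MaxS.dual (E := flip E) hN.flip (X := T) (T := univ) (A := T) ?_ (subset_univ _) hL.flip
  exact hdB

theorem Seg.stay {E : V → V → Prop} {K R S : Set V} {a b : V}
    (hout : ∀ v ∈ K, ∀ w ∈ K, v ∉ R → E v w → w ∉ R) (h : Seg E S a b) (hS : S ⊆ K)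
    {x y : V} (hx : x ∉ R) (hr : ReflTransGen (rs E S) x y) : y ∉ R := by
  induction hr with
  | refl => exact hx
  | tail _ h1 ih => exact hout _ (hS h1.2.1) _ (hS h1.2.2) ih h1.1

theorem path_stay {E : V → V → Prop} {K R : Set V} {p : ℕ → V} {n : ℕ}
    (hout : ∀ v ∈ K, ∀ w ∈ K, v ∉ R → E v w → w ∉ R) (hp : ∀ i ≤ n, p i ∈ K)
    (he : ∀ i < n, E (p i) (p (i+1))) (i j : ℕ) (hij : i ≤ j) (hj : j ≤ n) (hi : p i ∉ R) :
    p j ∉ R := by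
  induction j, hij using Nat.le_induction with
  | base => exact hi
  | succ j hij ih =>
    exact hout _ (hp j (by omega)) _ (hp (j+1) hj) (ih (by omega)) (he j (by omega))

theorem Seg.restrict_rel {E : V → V → Prop} {S W : Set V} {a b : V} (h : Seg E S a b)
    (hS : S ⊆ W) : Seg (fun v w => E v w ∧ v ∈ W) S a b := by
  have key : ∀ x y, ReflTransGen (rs E S) x y →
      ReflTransGen (rs (fun v w => E v w ∧ v ∈ W) S) x y := by
    intro x y hr
    induction hr with
    | refl => exact .refl
    | tail _ h1 ih => exact ih.tail ⟨⟨h1.1, hS h1.2.1⟩, h1.2⟩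
  exact ⟨h.1, h.2.1, h.2.2.1, fun x hx => ⟨key _ _ (h.2.2.2 x hx).1, key _ _ (h.2.2.2 x hx).2⟩⟩

/-- vertices without out-edges occur only as last vertices. -/
theorem Seg.eq_last {E : V → V → Prop} {S : Set V} {a b x : V} (h : Seg E S a b) (hx : x ∈ S)
    (hno : ∀ y, ¬ E x y) : x = b := by
  rcases ReflTransGen.cases_head (h.2.2.2 x hx).2 with h1 | ⟨c, h1, _⟩
  · exact h1
  · exact absurd h1.1 (hno c)

theorem limit_step {E : V → V → Prop} {K X T U : Set V} {W : ℕ → Set V} (hanti : Antitone W)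
    (hWK : W 0 ⊆ K)
    (hout : ∀ m, ∀ v ∈ K, ∀ w ∈ K, v ∉ W m → E v w → w ∉ W m) (hU : U.Finite)
    (hcross : ∀ S a b, S ⊆ K → Seg E S a b → a ∈ W 0 → b ∈ T → b ∉ W 0 → (S ∩ U).Nonempty)
    (hN : NH E K X T) (hatt : ∀ m, LkI E (K \ W m) T (X \ W m)) :
    ∃ (A : Set V) (S : V → Set V) (e : V → V), X \ W 0 ⊆ A ∧ A ⊆ X ∧
      (∀ a ∈ A, S a ⊆ K ∧ Seg E (S a) a (e a) ∧ e a ∈ T) ∧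
      (∀ a ∈ A, ∀ a' ∈ A, ∀ x, x ∈ S a → x ∈ S a' → a = a') ∧
      (∀ a ∈ A, ∀ x ∈ S a, x ∈ X → x ∈ A) ∧
      ∀ m, LkI E ((W 0 \ W m) \ {x | ∃ a ∈ A, x ∈ S a}) T
        (((X ∩ W 0) \ W m) \ {x | ∃ a ∈ A, x ∈ S a}) := by
  classical
  let Q : ℕ → ℕ → Prop := fun m c => ∃ (S : V → Set V) (e : V → V),
    (∀ a ∈ X \ W m, S a ⊆ K \ W m ∧ Seg E (S a) a (e a) ∧ e a ∈ T) ∧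
    (∀ a ∈ X \ W m, ∀ a' ∈ X \ W m, ∀ x, x ∈ S a → x ∈ S a' → a = a') ∧
    {a | a ∈ X \ W m ∧ a ∈ W 0 ∧ e a ∉ W 0}.encard ≤ c
  have hQex : ∃ c, ∀ m, Q m c := by
    refine ⟨hU.toFinset.card, fun m => ?_⟩
    obtain ⟨S, e, h1, h2⟩ := LkI.iff.mp (hatt m)
    refine ⟨S, e, h1, h2, ?_⟩
    have : ∀ a, ∃ u, (a ∈ X \ W m ∧ a ∈ W 0 ∧ e a ∉ W 0) → u ∈ S a ∩ U := by
      intro a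
      by_cases h : a ∈ X \ W m ∧ a ∈ W 0 ∧ e a ∉ W 0
      · obtain ⟨u, hu⟩ := hcross (S a) a (e a) ((h1 a h.1).1.trans sdiff_subset) (h1 a h.1).2.1
          h.2.1 (h1 a h.1).2.2 h.2.2
        exact ⟨u, fun _ => hu⟩
      · exact ⟨a, fun h' => absurd h' h⟩
    choose u hu using this
    rw [← hU.encard_eq_coe_toFinset_card]
    refine encard_le_encard_of_injOn (f := u) (fun a ha => (hu a ha).2) ?_
    intro a ha a' ha' hE
    exact h2 a ha.1 a' ha'.1 (u a) (hu a ha).1 (by rw [hE]; exact (hu a' ha').1)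
  set c := Nat.find hQex with hc
  have hQc : ∀ m, Q m c := Nat.find_spec hQex
  obtain ⟨m1, hm1⟩ : ∃ m1, ∀ c' < c, ¬ Q m1 c' := by
    by_cases h0 : c = 0
    · exact ⟨0, fun c' h => by omega⟩
    · have := Nat.find_min hQex (m := c - 1) (by omega)
      push Not at this
      obtain ⟨m1, h⟩ := this
      refine ⟨m1, fun c' hc' hQ => h ?_⟩
      obtain ⟨S, e, h1, h2, h3⟩ := hQ
      exact ⟨S, e, h1, h2, h3.trans (by exact_mod_cast (by omega : c' ≤ c - 1))⟩
  -- the linkage for m1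
  obtain ⟨S1, e1, hL1a, hL1b, hL1c⟩ := hQc m1
  obtain ⟨n1, p1, hP, hPe⟩ := (Lk.mk' S1 e1 (fun a ha => ⟨(hL1a a ha).1, (hL1a a ha).2.1⟩)
    hL1b).toP
  obtain ⟨hP1, hP2, hP3⟩ := hP
  have hPT : ∀ a ∈ X \ W m1, p1 a (n1 a) ∈ T := by
    intro a ha; rw [(hPe a ha).1]; exact (hL1a a ha).2.2
  have hPK : ∀ a ∈ X \ W m1, ∀ i ≤ n1 a, p1 a i ∈ K := fun a ha i hi => ((hP1 a ha).2.2.2 i hi).1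
  have hPE : ∀ a ∈ X \ W m1, ∀ i < n1 a, E (p1 a i) (p1 a (i+1)) := fun a ha => (hP1 a ha).2.2.1
  have hP0 : ∀ a ∈ X \ W m1, p1 a 0 = a := fun a ha => (hP1 a ha).1
  set Z1 : Set V := {a | a ∈ X \ W m1 ∧ a ∈ W 0 ∧ p1 a (n1 a) ∉ W 0} with hZ1
  have hZ1c : Z1.encard ≤ c := by
    refine le_trans (encard_le_encard ?_) hL1c
    rintro a ⟨h1, h2, h3⟩
    exact ⟨h1, h2, by rw [← (hPe a h1).1]; exact h3⟩
  have hZ1c' : (c : ℕ∞) ≤ Z1.encard := by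
    by_contra hlt
    push Not at hlt
    obtain ⟨k, hk⟩ := ENat.ne_top_iff_exists.mp (ne_top_of_lt hlt)
    rw [← hk] at hlt
    refine hm1 k (by exact_mod_cast hlt) ⟨S1, e1, hL1a, hL1b, ?_⟩
    rw [hk]
    refine encard_le_encard ?_
    rintro a ⟨h1, h2, h3⟩
    exact ⟨h1, h2, by rw [(hPe a h1).1]; exact h3⟩
  have hsex : ∀ a, ∃ s, a ∈ Z1 → s ≤ n1 a ∧ p1 a s ∉ W 0 ∧ ∀ i < s, p1 a i ∈ W 0 := by
    intro a
    by_cases ha : a ∈ Z1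
    · have hex : ∃ i, i ≤ n1 a ∧ p1 a i ∉ W 0 := ⟨n1 a, le_rfl, ha.2.2⟩
      refine ⟨Nat.find hex, fun _ => ⟨(Nat.find_spec hex).1, (Nat.find_spec hex).2, ?_⟩⟩
      intro i hi
      by_contra h
      have := (Nat.find_spec hex).1
      exact Nat.find_min hex hi ⟨by omega, h⟩
    · exact ⟨0, fun h => absurd h ha⟩
  choose s hs using hsex
  have hnc : ∀ a ∈ X \ W m1, a ∈ W 0 → a ∉ Z1 → ∀ i ≤ n1 a, p1 a i ∈ W 0 := by
    intro a ha haW haZ i hi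
    by_contra hni
    exact haZ ⟨ha, haW, path_stay (hout 0) (hPK a ha) (hPE a ha) i (n1 a) hi le_rfl hni⟩
  have hoo : ∀ a ∈ X \ W m1, a ∉ W 0 → ∀ i ≤ n1 a, p1 a i ∉ W 0 := by
    intro a ha haW i hi
    exact path_stay (hout 0) (hPK a ha) (hPE a ha) 0 i (Nat.zero_le _) hi (by rwa [hP0 a ha])
  have hX0 : X \ W 0 ⊆ X \ W m1 := fun x hx => ⟨hx.1, fun h => hx.2 (hanti (Nat.zero_le m1) h)⟩
  let A : Set V := (X \ W 0) ∪ Z1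
  have hAX1 : A ⊆ X \ W m1 := union_subset hX0 (fun a ha => ha.1)
  let S : V → Set V := fun a => p1 a '' Icc 0 (n1 a)
  set Y : Set V := {x | ∃ a ∈ A, x ∈ S a} with hY
  have hZY : Z1 ⊆ Y := fun a ha => ⟨a, Or.inr ha, 0, ⟨le_rfl, Nat.zero_le _⟩, hP0 a ha.1⟩
  refine ⟨A, S, fun a => p1 a (n1 a), subset_union_left, fun a ha => (hAX1 ha).1, ?_, ?_, ?_, ?_⟩
  · intro a ha
    have ha1 := hAX1 ha
    refine ⟨?_, ?_, hPT a ha1⟩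
    · rintro _ ⟨i, hi, rfl⟩; exact hPK a ha1 i hi.2
    · have := Seg.ofPath (E := E) (p1 a) 0 (n1 a) (Nat.zero_le _) (fun j _ hj => hPE a ha1 j hj)
      rwa [hP0 a ha1] at this
  · rintro a ha a' ha' x ⟨i, hi, rfl⟩ ⟨j, hj, hij⟩
    exact (hP2 a (hAX1 ha) a' (hAX1 ha') i hi.2 j hj.2 hij.symm).1
  · rintro a ha x ⟨i, hi, rfl⟩ hxX
    have hx1 : p1 a i ∈ X \ W m1 := ⟨hxX, ((hP1 a (hAX1 ha)).2.2.2 i hi.2).2⟩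
    have := (hP2 a (hAX1 ha) _ hx1 i hi.2 0 (Nat.zero_le _) (hP0 _ hx1).symm).1
    rw [← this]; exact ha
  intro m
  rcases le_total m m1 with hm | hm
  · -- easy case
    refine LkI.iff.mpr ⟨S, fun a => p1 a (n1 a), ?_, ?_⟩
    · rintro a ⟨⟨⟨haX, haW⟩, ham⟩, haY⟩
      have ha1 : a ∈ X \ W m1 := ⟨haX, fun h => ham (hanti hm h)⟩
      have haZ : a ∉ Z1 := fun h => haY (hZY h)
      refine ⟨?_, ?_, hPT a ha1⟩
      · rintro _ ⟨i, hi, rfl⟩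
        refine ⟨⟨hnc a ha1 haW haZ i hi.2, ?_⟩, ?_⟩
        · exact path_stay (hout m) (hPK a ha1) (hPE a ha1) 0 i (Nat.zero_le _) hi.2
            (by rwa [hP0 a ha1])
        · rintro ⟨a', ha', j, hj, hij⟩
          have := (hP2 a' (hAX1 ha') a ha1 j hj.2 i hi.2 hij).1
          subst this
          exact haY ⟨a', ha', 0, ⟨le_rfl, Nat.zero_le _⟩, hP0 a' ha1⟩
      · have := Seg.ofPath (E := E) (p1 a) 0 (n1 a) (Nat.zero_le _) (fun j _ hj => hPE a ha1 j hj)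
        rwa [hP0 a ha1] at this
    · rintro a ha a' ha' x ⟨i, hi, rfl⟩ ⟨j, hj, hij⟩
      have ha1 : a ∈ X \ W m1 := ⟨ha.1.1.1, fun h => ha.1.2 (hanti hm h)⟩
      have ha1' : a' ∈ X \ W m1 := ⟨ha'.1.1.1, fun h => ha'.1.2 (hanti hm h)⟩
      exact (hP2 a ha1 a' ha1' i hi.2 j hj.2 hij.symm).1
  -- main case
  have hWm : W m ⊆ W m1 := hanti hm
  let E'' : V → V → Prop := fun v w => E v w ∧ v ∈ W 0
  let x' : V → V := fun a => p1 a (s a)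
  let EE : Set V := x' '' Z1
  have hx'inj : ∀ z ∈ Z1, ∀ z' ∈ Z1, x' z = x' z' → z = z' := fun z hz z' hz' h =>
    (hP2 z hz.1 z' hz'.1 _ (hs z hz).1 _ (hs z' hz').1 h).1
  have hEEenc : EE.encard = Z1.encard := InjOn.encard_image (fun z hz z' hz' h =>
    hx'inj z hz z' hz' h)
  have hEEc : EE.encard = c := by rw [hEEenc]; exact le_antisymm hZ1c hZ1c'
  have hEEfin : EE.Finite := by
    rw [← encard_lt_top_iff, hEEc]; exact ENat.natCast_lt_top c
  have hEEW : ∀ x ∈ EE, x ∉ W 0 := by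
    rintro _ ⟨z, hz, rfl⟩; exact (hs z hz).2.1
  have hEEK : EE ⊆ K := by
    rintro _ ⟨z, hz, rfl⟩; exact hPK z hz.1 _ (hs z hz).1
  have hEEno : ∀ x ∈ EE, ∀ y, ¬ E'' x y := fun x hx y h => hEEW x hx h.2
  let G : Set V := (W 0 \ W m) ∪ EE
  have hGK : G ⊆ K := union_subset (sdiff_subset.trans hWK) hEEK
  let A1 : Set V := (X ∩ W 0) \ W m1
  have hA1 : ∀ a ∈ A1, a ∈ X \ W m1 := fun a ha => ⟨ha.1.1, ha.2⟩
  let n' : V → ℕ := fun a => if a ∈ Z1 then s a else n1 a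
  have hn'Z : ∀ a ∈ Z1, n' a = s a := fun a ha => if_pos ha
  have hn'N : ∀ a, a ∉ Z1 → n' a = n1 a := fun a ha => if_neg ha
  have hn'le : ∀ a, n' a ≤ n1 a := by
    intro a
    by_cases ha : a ∈ Z1
    · rw [hn'Z a ha]; exact (hs a ha).1
    · rw [hn'N a ha]
  have hn'W : ∀ a ∈ A1, ∀ i < n' a, p1 a i ∈ W 0 := by
    intro a ha i hi
    by_cases hz : a ∈ Z1
    · rw [hn'Z a hz] at hi; exact (hs a hz).2.2 i hi
    · rw [hn'N a hz] at hi; exact hnc a (hA1 a ha) ha.1.2 hz i hi.le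
  let B1 : Set V := (fun a => p1 a (n' a)) '' A1
  have hB1 : B1 ⊆ (T ∩ W 0) ∪ EE := by
    rintro _ ⟨a, ha, rfl⟩
    by_cases hz : a ∈ Z1
    · right; exact ⟨a, hz, by simp only [x', hn'Z a hz]⟩
    · left
      simp only [hn'N a hz]
      exact ⟨hPT a (hA1 a ha), hnc a (hA1 a ha) ha.1.2 hz _ le_rfl⟩
  have hq : LkP E'' G A1 B1 n' p1 := by
    refine ⟨?_, ?_, ?_⟩
    · intro a ha
      have ha1 := hA1 a ha
      refine ⟨hP0 a ha1, ⟨a, ha, rfl⟩, ?_, ?_⟩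
      · intro i hi
        exact ⟨hPE a ha1 i (hi.trans_le (hn'le a)), hn'W a ha i hi⟩
      · intro i hi
        rcases hi.lt_or_eq with h | h
        · exact Or.inl ⟨hn'W a ha i h, fun hw =>
            ((hP1 a ha1).2.2.2 i (hi.trans (hn'le a))).2 (hWm hw)⟩
        · by_cases hz : a ∈ Z1
          · right; exact ⟨a, hz, by simp only [x', h, hn'Z a hz]⟩
          · exact Or.inl ⟨hnc a ha1 ha.1.2 hz i (hi.trans (hn'le a)), fun hw =>
              ((hP1 a ha1).2.2.2 i (hi.trans (hn'le a))).2 (hWm hw)⟩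
    · intro a ha a' ha' i hi j hj h
      exact hP2 a (hA1 a ha) a' (hA1 a' ha') i (hi.trans (hn'le a)) j (hj.trans (hn'le a')) h
    · rintro _ ⟨a, ha, rfl⟩; exact ⟨a, ha, rfl⟩
  -- second linkage
  obtain ⟨Sm, em, hLma, hLmb, hLmc⟩ := hQc m
  let Xm : Set V := (X ∩ W 0) \ W m
  have hXm : Xm ⊆ X \ W m := fun a ha => ⟨ha.1.1, ha.2⟩
  let A0 : Set V := {a | a ∈ Xm ∧ em a ∈ W 0}
  have hA0E : ∀ a ∈ A0, a ∉ EE := fun a ha h => hEEW a h ha.1.1.2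
  have hA0S : ∀ a ∈ A0, Sm a ⊆ W 0 \ W m := by
    intro a ha x hx
    obtain ⟨k1, k2, k3⟩ := hLma a (hXm ha.1)
    refine ⟨?_, (k1 hx).2⟩
    by_contra hx0
    exact (k2.stay (hout 0) (k1.trans sdiff_subset) hx0 (k2.2.2.2 x hx).2) ha.2
  let S2 : V → Set V := fun a => if a ∈ EE then {a} else Sm a
  let e2 : V → V := fun a => if a ∈ EE then a else em a
  have hS2E : ∀ a ∈ EE, S2 a = {a} := fun a ha => if_pos ha
  have hS2N : ∀ a, a ∉ EE → S2 a = Sm a := fun a ha => if_neg ha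
  have he2E : ∀ a ∈ EE, e2 a = a := fun a ha => if_pos ha
  have he2N : ∀ a, a ∉ EE → e2 a = em a := fun a ha => if_neg ha
  have hL2 : LkS E'' G (A0 ∪ EE) (e2 '' (A0 ∪ EE)) S2 e2 := by
    refine Lk.mk' S2 e2 ?_ ?_
    · intro a ha
      by_cases haE : a ∈ EE
      · rw [hS2E a haE, he2E a haE]
        exact ⟨singleton_subset_iff.mpr (Or.inr haE), Seg.single a⟩
      · rw [hS2N a haE, he2N a haE]
        have ha0 := ha.resolve_right haE
        exact ⟨(hA0S a ha0).trans subset_union_left,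
          (hLma a (hXm ha0.1)).2.1.restrict_rel ((hA0S a ha0).trans sdiff_subset)⟩
    · intro a ha a' ha' x hx hx'
      by_cases haE : a ∈ EE
      · rw [hS2E a haE] at hx
        rw [mem_singleton_iff] at hx
        by_cases haE' : a' ∈ EE
        · rw [hS2E a' haE'] at hx'
          rw [← hx, ← mem_singleton_iff.mp hx']
        · rw [hS2N a' haE'] at hx'
          have := hA0S a' (ha'.resolve_right haE') hx'
          rw [hx] at this
          exact absurd this.1 (hEEW a haE)
      · rw [hS2N a haE] at hx
        have hxW := hA0S a (ha.resolve_right haE) hx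
        by_cases haE' : a' ∈ EE
        · rw [hS2E a' haE', mem_singleton_iff] at hx'
          rw [hx'] at hxW
          exact absurd hxW.1 (hEEW a' haE')
        · rw [hS2N a' haE'] at hx'
          exact hLmb a (hXm (ha.resolve_right haE).1) a' (hXm (ha'.resolve_right haE').1) x hx hx'
  set B2 := e2 '' (A0 ∪ EE) with hB2
  have hB2T : B2 ⊆ (T ∩ W 0) ∪ EE := by
    rintro _ ⟨a, ha, rfl⟩
    by_cases haE : a ∈ EE
    · rw [he2E a haE]; exact Or.inr haE
    · rw [he2N a haE]
      have ha0 := ha.resolve_right haE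
      exact Or.inl ⟨(hLma a (hXm ha0.1)).2.2, ha0.2⟩
  have hEB2 : EE ⊆ B2 := fun x hx => ⟨x, Or.inr hx, he2E x hx⟩
  obtain ⟨n2, p2, hp2, hp2S⟩ := hL2.toP
  have hn2 : ∀ b ∈ EE, n2 b = 0 := by
    intro b hb
    have h1 := (hp2S b (Or.inr hb)).2 0 (Nat.zero_le _)
    have h2 := (hp2S b (Or.inr hb)).2 (n2 b) le_rfl
    rw [hS2E b hb, mem_singleton_iff] at h1 h2
    exact (hp2.2.1 b (Or.inr hb) b (Or.inr hb) _ le_rfl 0 (Nat.zero_le _) (h2.trans h1.symm)).2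
  obtain ⟨A'', B'', N, eN, hLN, hN1, hN2, hN3, hN4, hN5⟩ := pym_core hq hp2
  have hB'' : B'' ⊆ (T ∩ W 0) ∪ EE := hN4.trans (union_subset hB1 hB2T)
  have hNE : ∀ a ∈ A'', ∀ x ∈ N a, x ∈ EE → x = eN a := fun a ha x hx hxE =>
    (hLN.1 a ha).2.1.eq_last hx (hEEno x hxE)
  have hNK : ∀ a ∈ A'', N a ⊆ K := fun a ha => (hLN.1 a ha).1.trans hGK
  have hNseg : ∀ a ∈ A'', Seg E (N a) a (eN a) := fun a ha =>
    (hLN.1 a ha).2.1.mono_rel (fun _ _ h => h.1)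
  have hNW : ∀ a ∈ A'', ∀ x ∈ N a, x ∉ W 0 → x ∈ EE := by
    intro a ha x hx hx0
    rcases (hLN.1 a ha).1 hx with h | h
    · exact absurd h.1 hx0
    · exact h
  -- Claim 1
  have claim1 : ∀ x ∈ EE, x ∉ A'' := by
    intro x0 hx0 hx0A
    have hsrc : ∀ x, ∃ z, x ∈ EE → z ∈ Z1 ∧ x' z = x := by
      intro x
      by_cases hx : x ∈ EE
      · obtain ⟨z, hz⟩ := hx; exact ⟨z, fun _ => hz⟩
      · exact ⟨x, fun h => absurd h hx⟩
    choose src hsrc using hsrc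
    let tl : V → Set V := fun z => p1 z '' Icc (s z) (n1 z)
    let S3 : V → Set V := fun a => if a ∈ W 0 then
      (if eN a ∈ EE then N a ∪ tl (src (eN a)) else N a) else S a
    let e3 : V → V := fun a => if a ∈ W 0 then
      (if eN a ∈ EE then p1 (src (eN a)) (n1 (src (eN a))) else eN a) else p1 a (n1 a)
    have hA'' : ∀ a ∈ X \ W m1, a ∈ W 0 → a ∈ A'' := fun a ha ha0 => hN1 ⟨⟨ha.1, ha0⟩, ha.2⟩
    have hcl : ∀ a ∈ X \ W m1, ∀ x ∈ S3 a, (x ∈ W 0 ∧ a ∈ W 0 ∧ x ∈ N a) ∨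
        (a ∈ W 0 ∧ eN a ∈ EE ∧ x ∈ S (src (eN a))∧ x ∉ W 0) ∨ (x ∉ W 0 ∧ a ∉ W 0 ∧ x ∈ S a) := by
      intro a ha x hx
      by_cases ha0 : a ∈ W 0
      · by_cases hEa : eN a ∈ EE
        · have hx : x ∈ N a ∪ tl (src (eN a)) := by
            simpa only [S3, if_pos ha0, if_pos hEa] using hx
          obtain ⟨hz1, hz2⟩ := hsrc _ hEa
          obtain ⟨g1, g2, g3⟩ := hs _ hz1
          rcases hx with hx | ⟨j, hj, rfl⟩
          · by_cases hxW : x ∈ W 0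
            · exact Or.inl ⟨hxW, ha0, hx⟩
            · have hxE := hNW a (hA'' a ha ha0) x hx hxW
              have := hNE a (hA'' a ha ha0) x hx hxE
              refine Or.inr (Or.inl ⟨ha0, hEa, ?_, hxW⟩)
              rw [this]
              exact ⟨s (src (eN a)), ⟨Nat.zero_le _, g1⟩, hz2⟩
          · refine Or.inr (Or.inl ⟨ha0, hEa, ⟨j, ⟨Nat.zero_le _, hj.2⟩, rfl⟩, ?_⟩)
            exact path_stay (hout 0) (hPK _ hz1.1) (hPE _ hz1.1) (s (src (eN a))) j hj.1 hj.2 g2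
        · have hx : x ∈ N a := by simpa only [S3, if_pos ha0, if_neg hEa] using hx
          left
          refine ⟨?_, ha0, hx⟩
          by_contra hxW
          have hxE := hNW a (hA'' a ha ha0) x hx hxW
          have := hNE a (hA'' a ha ha0) x hx hxE
          exact hEa (this ▸ hxE)
      · have hx : x ∈ S a := by simpa only [S3, if_neg ha0] using hx
        refine Or.inr (Or.inr ⟨?_, ha0, hx⟩)
        obtain ⟨i, hi, rfl⟩ := hx
        exact hoo a ha ha0 i hi.2
    have hSdis : ∀ a ∈ X \ W m1, ∀ a' ∈ X \ W m1, ∀ x, x ∈ S a → x ∈ S a' → a = a' := by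
      rintro a ha a' ha' x ⟨i, hi, rfl⟩ ⟨j, hj, hij⟩
      exact (hP2 a ha a' ha' i hi.2 j hj.2 hij.symm).1
    have hcard : (EE \ {x0}).encard + 1 = c := by
      rw [encard_sdiff_singleton_add_one hx0, hEEc]
    obtain ⟨k, hk⟩ := ENat.ne_top_iff_exists.mp
      (ne_top_of_le_ne_top (encard_ne_top_iff.mpr hEEfin) (encard_le_encard sdiff_subset) :
        (EE \ {x0}).encard ≠ ⊤)
    have hkc : k < c := by
      rw [← hk] at hcard
      have : k + 1 = c := by exact_mod_cast hcard
      omega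
    refine hm1 k hkc ⟨S3, e3, ?_, ?_, ?_⟩
    · intro a ha
      have main : S3 a ⊆ K ∧ Seg E (S3 a) a (e3 a) ∧ e3 a ∈ T := by
        by_cases ha0 : a ∈ W 0
        · have haA := hA'' a ha ha0
          by_cases hEa : eN a ∈ EE
          · have h3 : S3 a = N a ∪ tl (src (eN a)) := by simp only [S3, if_pos ha0, if_pos hEa]
            have h4 : e3 a = p1 (src (eN a)) (n1 (src (eN a))) := by
              simp only [e3, if_pos ha0, if_pos hEa]
            rw [h3, h4]
            obtain ⟨hz1, hz2⟩ := hsrc _ hEa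
            obtain ⟨g1, g2, g3⟩ := hs _ hz1
            refine ⟨union_subset (hNK a haA) ?_, ?_, hPT _ hz1.1⟩
            · rintro _ ⟨j, hj, rfl⟩; exact hPK _ hz1.1 j hj.2
            · have h5 := Seg.ofPath (E := E) (p1 (src (eN a))) (s (src (eN a)))
                (n1 (src (eN a))) g1 (fun j _ hj => hPE _ hz1.1 j hj)
              have h6 : p1 (src (eN a)) (s (src (eN a))) = eN a := hz2
              rw [h6] at h5
              exact (hNseg a haA).trans h5
          · have h3 : S3 a = N a := by simp only [S3, if_pos ha0, if_neg hEa]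
            have h4 : e3 a = eN a := by simp only [e3, if_pos ha0, if_neg hEa]
            rw [h3, h4]
            refine ⟨hNK a haA, hNseg a haA, ?_⟩
            rcases hB'' (hLN.1 a haA).2.2 with h | h
            · exact h.1
            · exact absurd h hEa
        · have h3 : S3 a = S a := by simp only [S3, if_neg ha0]
          have h4 : e3 a = p1 a (n1 a) := by simp only [e3, if_neg ha0]
          rw [h3, h4]
          refine ⟨?_, ?_, hPT a ha⟩
          · rintro _ ⟨i, hi, rfl⟩; exact hPK a ha i hi.2
          · have := Seg.ofPath (E := E) (p1 a) 0 (n1 a) (Nat.zero_le _)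
              (fun j _ hj => hPE a ha j hj)
            rwa [hP0 a ha] at this
      exact ⟨fun x hx => ⟨main.1 hx, main.2.1.stay (hout m1) main.1 ha.2
        (main.2.1.2.2.2 x hx).1⟩, main.2⟩
    · intro a ha a' ha' x hx hx'
      rcases hcl a ha x hx with ⟨h1, h2, h3⟩ | ⟨h1, h2, h3, h4⟩ | ⟨h1, h2, h3⟩ <;>
        rcases hcl a' ha' x hx' with ⟨h1', h2', h3'⟩ | ⟨h1', h2', h3', h4'⟩ | ⟨h1', h2', h3'⟩
      · exact hLN.2.1 a (hA'' a ha h2) a' (hA'' a' ha' h2') x h3 h3'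
      · exact absurd h1 h4'
      · exact absurd h1 h1'
      · exact absurd h1' h4
      · have g1 := hsrc _ h2
        have g2 := hsrc _ h2'
        have := hSdis _ g1.1.1 _ g2.1.1 x h3 h3'
        refine hLN.inj (hA'' a ha h1) (hA'' a' ha' h1') ?_
        rw [← g1.2, ← g2.2, this]
      · have g1 := hsrc _ h2
        have := hSdis _ g1.1.1 _ ha' x h3 h3'
        exact absurd (this ▸ g1.1.2.1) h2'
      · exact absurd h1' h1
      · have g1 := hsrc _ h2'
        have := hSdis _ ha _ g1.1.1 x h3 h3'
        exact absurd (this.symm ▸ g1.1.2.1) h2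
      · exact hSdis a ha a' ha' x h3 h3'
    · rw [hk]
      have hxx : eN x0 = x0 := (hNE x0 hx0A x0 (hLN.1 x0 hx0A).2.1.1 hx0).symm
      have hEa : ∀ a, (a ∈ X \ W m1 ∧ a ∈ W 0 ∧ e3 a ∉ W 0) → eN a ∈ EE := by
        rintro a ⟨ha, ha0, he⟩
        by_contra hE
        have h4 : e3 a = eN a := by simp only [e3, if_pos ha0, if_neg hE]
        rw [h4] at he
        rcases hB'' (hLN.1 a (hA'' a ha ha0)).2.2 with h | h
        · exact he h.2
        · exact hE h
      refine encard_le_encard_of_injOn (f := eN) ?_ ?_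
      · intro a ha
        refine ⟨hEa a ha, ?_⟩
        intro h
        rw [mem_singleton_iff] at h
        have : a = x0 := hLN.inj (hA'' a ha.1 ha.2.1) hx0A (h.trans hxx.symm)
        exact hEEW x0 hx0 (this ▸ ha.2.1)
      · intro a ha a' ha' h
        exact hLN.inj (hA'' a ha.1 ha.2.1) (hA'' a' ha'.1 ha'.2.1) h
  -- Claim 2
  have hA1Xm : A1 ⊆ Xm := fun a ha => ⟨ha.1, fun h => ha.2 (hWm h)⟩
  have hA''Xm : A'' ⊆ Xm := by
    intro a ha
    rcases hN2 ha with h | h | h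
    · exact hA1Xm h
    · exact h.1
    · exact absurd ha (claim1 a h)
  have hZ' : (Xm \ A0).encard ≤ c := by
    refine le_trans (encard_le_encard ?_) hLmc
    rintro a ⟨h1, h2⟩
    exact ⟨hXm h1, h1.1.2, fun h => h2 ⟨h1, h⟩⟩
  have hNH : NH E'' G (A0 ∪ EE) B2 := by
    refine (hN.union_finite hEEfin hEEfin).mono (fun _ _ h => h.1) hGK
      (union_subset_union_left _ (fun a ha => ha.1.1.1)) ?_
    exact hB2T.trans (union_subset_union_left _ inter_subset_left)
  have hpt := pointer ⟨S2, e2, hL2⟩ ⟨N, eN, hLN⟩ hN3 hNH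
  have hsub1 : EE ⊆ (A0 ∪ EE) \ A'' := fun x hx => ⟨Or.inr hx, claim1 x hx⟩
  have hsub2 : A'' \ (A0 ∪ EE) ⊆ Xm \ A0 := fun x hx => ⟨hA''Xm hx.1, fun h => hx.2 (Or.inl h)⟩
  have hZfin : (Xm \ A0).Finite := by
    rw [← encard_lt_top_iff]; exact lt_of_le_of_lt hZ' (ENat.natCast_lt_top c)
  have heq1 : A'' \ (A0 ∪ EE) = Xm \ A0 := by
    refine Finite.eq_of_subset_of_encard_le (hZfin.subset hsub2) hsub2 ?_
    calc (Xm \ A0).encard ≤ c := hZ'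
      _ = EE.encard := hEEc.symm
      _ ≤ _ := encard_le_encard hsub1
      _ ≤ _ := hpt
  have heq2 : EE = (A0 ∪ EE) \ A'' := by
    have hle : ((A0 ∪ EE) \ A'').encard ≤ EE.encard :=
      hpt.trans ((encard_le_encard hsub2).trans (hZ'.trans hEEc.symm.le))
    exact Finite.eq_of_subset_of_encard_le hEEfin hsub1 hle
  have hXmA : Xm ⊆ A'' := by
    intro a ha
    by_cases h0 : a ∈ A0
    · by_contra h
      have : a ∈ EE := by rw [heq2]; exact ⟨Or.inl h0, h⟩
      exact hA0E a h0 this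
    · have : a ∈ Xm \ A0 := ⟨ha, h0⟩
      rw [← heq1] at this
      exact this.1
  -- Claim 3
  have claim3 : ∀ z ∈ Z1, z ∈ A'' ∧ eN z = x' z ∧ N z = p1 z '' Icc 0 (s z) := by
    intro z hz
    have hxE : x' z ∈ EE := ⟨z, hz, rfl⟩
    obtain ⟨a, ha, hae⟩ := hLN.2.2 _ (hN3 (hEB2 hxE))
    rcases hN5 a ha (x' z) (Or.inr hxE) (hn2 _ hxE) hae with h | ⟨haA1, t, ht, h1, h2⟩
    · exact absurd (h ▸ ha) (claim1 _ hxE)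
    · obtain ⟨rfl, rfl⟩ := hP2 a (hA1 a haA1) z hz.1 t (ht.trans (hn'le a)) (s z) (hs z hz).1 h1
      exact ⟨ha, hae, h2⟩
  refine LkI.iff.mpr ⟨N, eN, ?_, ?_⟩
  · rintro a ⟨haX, haY⟩
    have haA := hXmA haX
    have hEa : eN a ∉ EE := by
      rintro ⟨z, hz, hz'⟩
      obtain ⟨c1, c2, c3⟩ := claim3 z hz
      have := hLN.inj haA c1 (hz'.symm.trans c2.symm)
      exact haY (this ▸ hZY hz)
    refine ⟨?_, hNseg a haA, ?_⟩
    · intro x hx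
      have hx0 : x ∈ W 0 := by
        by_contra hxW
        have hxE := hNW a haA x hx hxW
        exact hEa (hNE a haA x hx hxE ▸ hxE)
      refine ⟨⟨hx0, ?_⟩, ?_⟩
      · exact (hNseg a haA).stay (hout m) (hNK a haA) haX.2 ((hNseg a haA).2.2.2 x hx).1
      · rintro ⟨a', ha', j, hj, rfl⟩
        rcases ha' with ha' | ha'
        · exact hoo a' (hX0 ha') ha'.2 j hj.2 hx0
        · obtain ⟨c1, c2, c3⟩ := claim3 a' ha'
          have hjs : j ≤ s a' := by
            by_contra hlt
            exact path_stay (hout 0) (hPK a' ha'.1) (hPE a' ha'.1) (s a') j (by omega) hj.2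
              (hs a' ha').2.1 hx0
          have : a = a' := hLN.2.1 a haA a' c1 _ hx (by rw [c3]; exact ⟨j, ⟨hj.1, hjs⟩, rfl⟩)
          exact haY (this ▸ hZY ha')
    · rcases hB'' (hLN.1 a haA).2.2 with h | h
      · exact h.1
      · exact absurd h hEa
  · intro a ha a' ha' x hx hx'
    exact hLN.2.1 a (hXmA ha.1) a' (hXmA ha'.1) x hx hx'

theorem Seg.sub_of_closed {E : V → V → Prop} {K k S : Set V} {a b : V}
    (hcl : ∀ v ∈ K, ∀ w ∈ K, v ∈ k → E v w → w ∈ k) (h : Seg E S a b) (hS : S ⊆ K)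
    (ha : a ∈ k) : S ⊆ k := by
  intro x hx
  have := h.2.2.2 x hx |>.1
  clear hx
  induction this with
  | refl => exact ha
  | tail _ h1 ih => exact hcl _ (hS h1.2.1) _ (hS h1.2.2) ih h1.1

theorem LkI.split {E : V → V → Prop} {G T A k : Set V}
    (hcl : ∀ v ∈ G, ∀ w ∈ G, v ∈ k → E v w → w ∈ k) (h : LkI E G T A) :
    LkI E (G ∩ k) T (A ∩ k) := by
  rw [LkI.iff] at h ⊢
  obtain ⟨S, e, h1, h2⟩ := h
  refine ⟨S, e, fun a ha => ⟨subset_inter (h1 a ha.1).1 ?_, (h1 a ha.1).2⟩,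
    fun a ha a' ha' => h2 a ha.1 a' ha'.1⟩
  exact (h1 a ha.1).2.1.sub_of_closed hcl (h1 a ha.1).1 ha.2

theorem LkI.glue {E : V → V → Prop} {K G T A : Set V} {κ : V → Set V}
    (hκ : ∀ v ∈ K, v ∈ κ v) (hκe : ∀ v ∈ K, ∀ w ∈ κ v, κ w = κ v) (hA : A ⊆ K)
    (h : ∀ v ∈ K, LkI E (G ∩ κ v) T (A ∩ κ v)) : LkI E G T A := by
  have h' : ∀ k, (∃ v ∈ K, κ v = k) → ∃ (S : V → Set V) (e : V → V),
    (∀ a ∈ A ∩ k, S a ⊆ G ∩ k ∧ Seg E (S a) a (e a) ∧ e a ∈ T) ∧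
    (∀ a ∈ A ∩ k, ∀ a' ∈ A ∩ k, ∀ x, x ∈ S a → x ∈ S a' → a = a') := by
    rintro k ⟨v, hv, rfl⟩
    exact LkI.iff.1 (h v hv)
  haveI : Nonempty (V → V) := ⟨id⟩
  choose! S e h1 h2 using h'
  rw [LkI.iff]
  have hS : ∀ a ∈ A, S (κ a) a ⊆ G ∩ κ a ∧ Seg E (S (κ a) a) a (e (κ a) a) ∧ e (κ a) a ∈ T :=
    fun a ha => h1 (κ a) ⟨a, hA ha, rfl⟩ a ⟨ha, hκ a (hA ha)⟩
  refine ⟨fun a => S (κ a) a, fun a => e (κ a) a, ?_, ?_⟩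
  · intro a ha
    exact ⟨(hS a ha).1.trans inter_subset_left, (hS a ha).2⟩
  · intro a ha a' ha' x hx hx'
    have e1 := hκe a (hA ha) x ((hS a ha).1 hx).2
    have e2 := hκe a' (hA ha') x ((hS a' ha').1 hx').2
    have e3 : κ a' = κ a := e2.symm.trans e1
    simp only [e3] at hx'
    exact h2 (κ a) ⟨a, hA ha, rfl⟩ a ⟨ha, hκ a (hA ha)⟩ a' ⟨ha', e3 ▸ hκ a' (hA ha')⟩ x hx hx'

theorem level_step {E : V → V → Prop} {K X T : Set V} {W : ℕ → Set V} {κ : V → Set V}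
    (hanti : Antitone W) (hWK : W 0 ⊆ K) (hXK : X ⊆ K)
    (hout : ∀ m, ∀ v ∈ K, ∀ w ∈ K, v ∉ W m → E v w → w ∉ W m)
    (hκ : ∀ v ∈ K, v ∈ κ v ∧ κ v ⊆ K) (hκe : ∀ v ∈ K, ∀ w ∈ κ v, κ w = κ v)
    (hκE : ∀ v ∈ K, ∀ w ∈ K, E v w → κ w = κ v)
    (hcross : ∀ v ∈ K, ∃ U : Set V, U.Finite ∧ ∀ S a b, S ⊆ κ v → Seg E S a b → a ∈ W 0 → b ∈ T →
      b ∉ W 0 → (S ∩ U).Nonempty)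
    (hN : NH E K X T) (hatt : ∀ m, LkI E (K \ W m) T (X \ W m)) :
    ∃ (A : Set V) (S : V → Set V) (e : V → V), X \ W 0 ⊆ A ∧ A ⊆ X ∧
      (∀ a ∈ A, S a ⊆ K ∧ Seg E (S a) a (e a) ∧ e a ∈ T) ∧
      (∀ a ∈ A, ∀ a' ∈ A, ∀ x, x ∈ S a → x ∈ S a' → a = a') ∧
      (∀ a ∈ A, ∀ x ∈ S a, x ∈ X → x ∈ A) ∧
      ∀ m, LkI E ((W 0 \ W m) \ {x | ∃ a ∈ A, x ∈ S a}) T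
        (((X ∩ W 0) \ W m) \ {x | ∃ a ∈ A, x ∈ S a}) := by
  have hcl : ∀ v ∈ K, ∀ x ∈ K, ∀ y ∈ K, x ∈ κ v → E x y → y ∈ κ v := by
    intro v hv x hx y hy hxv hE
    rw [← hκe v hv x hxv, ← hκE x hx y hy hE]
    exact (hκ y hy).1
  have main : ∀ k, (∃ v ∈ K, κ v = k) → ∃ (A : Set V) (S : V → Set V) (e : V → V),
      (X ∩ k) \ (W 0 ∩ k) ⊆ A ∧ A ⊆ X ∩ k ∧
      (∀ a ∈ A, S a ⊆ k ∧ Seg E (S a) a (e a) ∧ e a ∈ T) ∧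
      (∀ a ∈ A, ∀ a' ∈ A, ∀ x, x ∈ S a → x ∈ S a' → a = a') ∧
      (∀ a ∈ A, ∀ x ∈ S a, x ∈ X ∩ k → x ∈ A) ∧
      ∀ m, LkI E (((W 0 ∩ k) \ (W m ∩ k)) \ {x | ∃ a ∈ A, x ∈ S a}) T
        ((((X ∩ k) ∩ (W 0 ∩ k)) \ (W m ∩ k)) \ {x | ∃ a ∈ A, x ∈ S a}) := by
    rintro k ⟨v, hv, rfl⟩
    obtain ⟨U, hU, hUc⟩ := hcross v hv
    refine limit_step (K := κ v) (X := X ∩ κ v) (T := T) (U := U) (W := fun m => W m ∩ κ v)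
      (fun i j hij => inter_subset_inter_left _ (hanti hij)) inter_subset_right ?_ hU ?_ ?_ ?_
    · intro m x hx y hy hxm hE hym
      exact hout m x ((hκ v hv).2 hx) y ((hκ v hv).2 hy) (fun h => hxm ⟨h, hx⟩) hE hym.1
    · intro S a b hS hseg ha hb hb0
      exact hUc S a b hS hseg ha.1 hb (fun h => hb0 ⟨h, hS hseg.2.1⟩)
    · exact hN.mono (fun _ _ => id) (hκ v hv).2 inter_subset_left subset_rfl
    · intro m
      refine (LkI.split (k := κ v) ?_ (hatt m)).mono ?_ subset_rfl ?_
      · intro x hx y hy; exact hcl v hv x hx.1 y hy.1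
      · rintro x ⟨h1, h2⟩; exact ⟨h2, fun h => h1.2 h.1⟩
      · rintro x ⟨h1, h2⟩; exact ⟨⟨h1.1, fun h => h2 ⟨h, h1.2⟩⟩, h1.2⟩
  haveI : Nonempty (V → V) := ⟨id⟩
  choose! A S e h1 h2 h3 h4 h5 h6 using main
  have hmem : ∀ v ∈ K, ∀ a ∈ A (κ v), κ a = κ v ∧ a ∈ X ∧ a ∈ K := by
    intro v hv a ha
    have := h2 (κ v) ⟨v, hv, rfl⟩ ha
    exact ⟨hκe v hv a this.2, this.1, hXK this.1⟩
  have hSk : ∀ a ∈ K, a ∈ A (κ a) → S (κ a) a ⊆ κ a := fun a ha h =>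
    (h3 (κ a) ⟨a, ha, rfl⟩ a h).1
  have hYk : ∀ v ∈ K, ∀ x ∈ κ v, (∃ a ∈ {a | a ∈ K ∧ a ∈ A (κ a)}, x ∈ S (κ a) a) →
      ∃ a ∈ A (κ v), x ∈ S (κ v) a := by
    rintro v hv x hx ⟨a, ha, hxa⟩
    have e1 := hκe v hv x hx
    have e2 := hκe a ha.1 x (hSk a ha.1 ha.2 hxa)
    have e3 : κ a = κ v := e2.symm.trans e1
    exact ⟨a, e3 ▸ ha.2, e3 ▸ hxa⟩
  refine ⟨{a | a ∈ K ∧ a ∈ A (κ a)}, fun a => S (κ a) a, fun a => e (κ a) a, ?_, ?_, ?_, ?_, ?_, ?_⟩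
  · rintro a ⟨ha, ha0⟩
    have hK := hXK ha
    exact ⟨hK, h1 (κ a) ⟨a, hK, rfl⟩ ⟨⟨ha, (hκ a hK).1⟩, fun h => ha0 h.1⟩⟩
  · rintro a ⟨ha, ha0⟩
    exact (hmem a ha a ha0).2.1
  · rintro a ⟨ha, ha0⟩
    have := h3 (κ a) ⟨a, ha, rfl⟩ a ha0
    exact ⟨this.1.trans (hκ a ha).2, this.2⟩
  · rintro a ⟨ha, ha0⟩ a' ⟨ha', ha0'⟩ x hx hx'
    have e1 := hκe a ha x (hSk a ha ha0 hx)
    have e2 := hκe a' ha' x (hSk a' ha' ha0' hx')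
    have e3 : κ a' = κ a := e2.symm.trans e1
    simp only [e3] at hx' ha0'
    exact h4 (κ a) ⟨a, ha, rfl⟩ a ha0 a' ha0' x hx hx'
  · rintro a ⟨ha, ha0⟩ x hx hxX
    have e1 := hκe a ha x (hSk a ha ha0 hx)
    refine ⟨hXK hxX, ?_⟩
    rw [e1]
    exact h5 (κ a) ⟨a, ha, rfl⟩ a ha0 x hx ⟨hxX, hSk a ha ha0 hx⟩
  · intro m
    refine LkI.glue (K := K) (fun v hv => (hκ v hv).1) hκe (fun x hx => hXK hx.1.1.1) ?_
    intro v hv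
    refine (h6 (κ v) ⟨v, hv, rfl⟩ m).mono ?_ subset_rfl ?_
    · rintro x ⟨⟨⟨hx0, hxk⟩, hxm⟩, hxY⟩
      exact ⟨⟨⟨hx0, fun h => hxm ⟨h, hxk⟩⟩, fun h => hxY (hYk v hv x hxk h)⟩, hxk⟩
    · rintro x ⟨⟨⟨⟨hxX, hx0⟩, hxm⟩, hxY⟩, hxk⟩
      refine ⟨⟨⟨⟨hxX, hxk⟩, hx0, hxk⟩, fun h => hxm h.1⟩, ?_⟩
      rintro ⟨a, ha, hxa⟩
      obtain ⟨e1, e2, e3⟩ := hmem v hv a ha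
      exact hxY ⟨a, ⟨e3, by rwa [e1]⟩, by simpa [e1] using hxa⟩

theorem limit_link {E : V → V → Prop} {C X T : Set V} {W : ℕ → Set V} {κ : ℕ → V → Set V}
    (hanti : Antitone W) (hW0 : W 0 = C) (hWe : ∀ v, ∃ n, v ∉ W n)
    (hout : ∀ m, ∀ v ∈ C, ∀ w ∈ C, v ∉ W m → E v w → w ∉ W m)
    (hκ : ∀ n, ∀ v ∈ W n, v ∈ κ n v ∧ κ n v ⊆ W n) (hκe : ∀ n, ∀ v ∈ W n, ∀ w ∈ κ n v, κ n w = κ n v)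
    (hκE : ∀ n, ∀ v ∈ W n, ∀ w ∈ W n, E v w → κ n w = κ n v)
    (hcross : ∀ n, ∀ v ∈ W n, ∃ U : Set V, U.Finite ∧ ∀ S a b, S ⊆ κ n v → Seg E S a b →
      a ∈ W (n+1) → b ∈ T → b ∉ W (n+1) → (S ∩ U).Nonempty)
    (hN : NH E C X T) (hXC : X ⊆ C) (hatt : ∀ m, LkI E (C \ W m) T (X \ W m)) :
    LkI E C T X := by
  classical
  have hWC : ∀ n, W n ⊆ C := fun n => hW0 ▸ hanti (Nat.zero_le n)
  let P : ℕ → (Set V × (V → Set V) × (V → V)) → Prop := fun n σ =>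
    X \ W n ⊆ σ.1 ∧ σ.1 ⊆ X ∧
      (∀ a ∈ σ.1, σ.2.1 a ⊆ C ∧ Seg E (σ.2.1 a) a (σ.2.2 a) ∧ σ.2.2 a ∈ T) ∧
      (∀ a ∈ σ.1, ∀ a' ∈ σ.1, ∀ x, x ∈ σ.2.1 a → x ∈ σ.2.1 a' → a = a') ∧
      (∀ a ∈ σ.1, ∀ x ∈ σ.2.1 a, x ∈ X → x ∈ σ.1) ∧
      ∀ m, LkI E ((W n \ W m) \ {x | ∃ a ∈ σ.1, x ∈ σ.2.1 a}) T
        (((X ∩ W n) \ W m) \ {x | ∃ a ∈ σ.1, x ∈ σ.2.1 a})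
  have base : P 0 (∅, fun _ => ∅, id) := by
    refine ⟨?_, by simp, by simp, by simp, by simp, ?_⟩
    · rw [hW0]; rintro x ⟨h1, h2⟩; exact absurd (hXC h1) h2
    · intro m
      refine (hatt m).mono ?_ subset_rfl ?_
      · rw [hW0]; rintro x hx; exact ⟨hx, by simp⟩
      · rintro x hx; exact ⟨hx.1.1.1, hx.1.2⟩
  have step : ∀ n σ, P n σ → ∃ σ', P (n+1) σ' ∧ σ.1 ⊆ σ'.1 ∧
      ∀ a ∈ σ.1, σ'.2.1 a = σ.2.1 a ∧ σ'.2.2 a = σ.2.2 a := by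
    rintro n ⟨A, S, e⟩ ⟨g1, g2, g3, g4, g5, g6⟩
    simp only at g1 g2 g3 g4 g5 g6
    set Y : Set V := {x | ∃ a ∈ A, x ∈ S a} with hY
    obtain ⟨A', S', e', f1, f2, f3, f4, f5, f6⟩ := level_step (E := E) (K := W n \ Y)
      (X := (X ∩ W n) \ Y) (T := T) (W := fun m => W (n+1+m) \ Y) (κ := fun v => κ n v \ Y)
      (fun i j hij => sdiff_subset_sdiff_left (hanti (by omega)))
      (sdiff_subset_sdiff_left (hanti (by omega))) (fun x hx => ⟨hx.1.2, hx.2⟩)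
      (fun m v hv w hw h1 h2 h3 => hout _ v (hWC n hv.1) w (hWC n hw.1) (fun h => h1 ⟨h, hv.2⟩) h2 h3.1)
      (fun v hv => ⟨⟨(hκ n v hv.1).1, hv.2⟩, sdiff_subset_sdiff_left (hκ n v hv.1).2⟩)
      (fun v hv w hw => by rw [hκe n v hv.1 w hw.1])
      (fun v hv w hw h => by rw [hκE n v hv.1 w hw.1 h])
      (by
        intro v hv
        obtain ⟨U, hU, hc⟩ := hcross n v hv.1
        exact ⟨U, hU, fun S a b h1 h2 h3 h4 h5 => hc S a b (h1.trans sdiff_subset) h2 h3.1 h4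
          (fun h => h5 ⟨h, (h1 h2.2.1).2⟩)⟩)
      (hN.mono (fun _ _ => id) (sdiff_subset.trans (hWC n)) (fun x hx => hx.1.1) subset_rfl)
      (by
        intro m
        refine (g6 (n+1+m)).mono ?_ subset_rfl ?_
        · rintro x ⟨⟨h1, h2⟩, h3⟩; exact ⟨⟨h1, h3⟩, fun h => h2 h.1⟩
        · rintro x ⟨⟨⟨h1, h2⟩, h3⟩, h4⟩; exact ⟨⟨⟨h1, h2⟩, fun h => h4 ⟨h, h3⟩⟩, h3⟩)
    have hAA' : ∀ a ∈ A', a ∉ A := fun a ha h => (f2 ha).2 ⟨a, h, (g3 a h).2.1.1⟩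
    have hSY : ∀ a ∈ A', ∀ x ∈ S' a, x ∉ Y := fun a ha x hx => ((f3 a ha).1 hx).2
    have hYY : ∀ x, (∃ a ∈ A ∪ A', x ∈ (if a ∈ A then S a else S' a)) ↔
        (x ∈ Y ∨ ∃ a ∈ A', x ∈ S' a) := by
      intro x
      constructor
      · rintro ⟨a, h1, h2⟩
        by_cases h : a ∈ A
        · rw [if_pos h] at h2; exact Or.inl ⟨a, h, h2⟩
        · rw [if_neg h] at h2; exact Or.inr ⟨a, h1.resolve_left h, h2⟩
      · rintro (⟨a, h1, h2⟩ | ⟨a, h1, h2⟩)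
        · exact ⟨a, Or.inl h1, by rwa [if_pos h1]⟩
        · exact ⟨a, Or.inr h1, by rwa [if_neg (hAA' a h1)]⟩
    refine ⟨(A ∪ A', fun a => if a ∈ A then S a else S' a, fun a => if a ∈ A then e a else e' a),
      ⟨?_, ?_, ?_, ?_, ?_, ?_⟩, subset_union_left, ?_⟩
    · rintro a ⟨h1, h2⟩
      by_cases h3 : a ∈ W n
      · by_cases h4 : a ∈ Y
        · obtain ⟨a', h5, h6⟩ := h4
          exact Or.inl (g5 a' h5 a h6 h1)
        · exact Or.inr (f1 ⟨⟨⟨h1, h3⟩, h4⟩, fun h => h2 h.1⟩)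
      · exact Or.inl (g1 ⟨h1, h3⟩)
    · exact union_subset g2 (fun x hx => (f2 hx).1.1)
    · intro a ha
      by_cases h : a ∈ A
      · simp only [if_pos h]; exact g3 a h
      · simp only [if_neg h]
        have := f3 a (ha.resolve_left h)
        exact ⟨this.1.trans (sdiff_subset.trans (hWC n)), this.2⟩
    · intro a ha a' ha' x hx hx'
      by_cases h : a ∈ A <;> by_cases h' : a' ∈ A
      · simp only [if_pos h, if_pos h'] at hx hx'; exact g4 a h a' h' x hx hx'
      · simp only [if_pos h, if_neg h'] at hx hx'
        exact absurd ⟨a, h, hx⟩ (hSY a' (ha'.resolve_left h') x hx')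
      · simp only [if_neg h, if_pos h'] at hx hx'
        exact absurd ⟨a', h', hx'⟩ (hSY a (ha.resolve_left h) x hx)
      · simp only [if_neg h, if_neg h'] at hx hx'
        exact f4 a (ha.resolve_left h) a' (ha'.resolve_left h') x hx hx'
    · intro a ha x hx hxX
      by_cases h : a ∈ A
      · simp only [if_pos h] at hx; exact Or.inl (g5 a h x hx hxX)
      · simp only [if_neg h] at hx
        have ha' := ha.resolve_left h
        have := (f3 a ha').1 hx
        exact Or.inr (f5 a ha' x hx ⟨⟨hxX, this.1⟩, this.2⟩)
    · intro m
      by_cases hm : n + 1 ≤ m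
      · obtain ⟨m', rfl⟩ := Nat.exists_eq_add_of_le hm
        refine (f6 m').mono ?_ subset_rfl ?_
        · rintro x ⟨⟨h1, h2⟩, h3⟩
          refine ⟨⟨h1.1, fun h => h2 ⟨h, h1.2⟩⟩, ?_⟩
          intro h
          rcases (hYY x).1 h with h | h
          · exact h1.2 h
          · exact h3 h
        · rintro x ⟨⟨⟨h0, h1⟩, h2⟩, h3⟩
          have hxY : x ∉ Y := fun h => h3 ((hYY x).2 (Or.inl h))
          exact ⟨⟨⟨⟨⟨h0, hanti (by omega) h1⟩, hxY⟩, ⟨h1, hxY⟩⟩, fun h => h2 h.1⟩,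
            fun h => h3 ((hYY x).2 (Or.inr h))⟩
      · rw [LkI.iff]
        refine ⟨fun _ => ∅, id, ?_, ?_⟩
        · rintro a ⟨⟨⟨_, h1⟩, h2⟩, _⟩
          exact absurd (hanti (by omega) h1) h2
        · rintro a ⟨⟨⟨_, h1⟩, h2⟩, _⟩
          exact absurd (hanti (by omega) h1) h2
    · intro a ha
      simp only at ha
      simp [if_pos ha]
  choose! nx hnx using step
  let σ : ℕ → (Set V × (V → Set V) × (V → V)) := fun n => Nat.rec (∅, fun _ => ∅, id) (fun n s => nx n s) n
  have hσ : ∀ n, P n (σ n) := by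
    intro n
    induction n with
    | zero => exact base
    | succ n ih => exact (hnx n _ ih).1
  have hσs : ∀ n, (σ n).1 ⊆ (σ (n+1)).1 ∧ ∀ a ∈ (σ n).1, (σ (n+1)).2.1 a = (σ n).2.1 a ∧
      (σ (n+1)).2.2 a = (σ n).2.2 a := fun n => (hnx n _ (hσ n)).2
  have hmono : ∀ n m, n ≤ m → (σ n).1 ⊆ (σ m).1 ∧ ∀ a ∈ (σ n).1, (σ m).2.1 a = (σ n).2.1 a ∧
      (σ m).2.2 a = (σ n).2.2 a := by
    intro n m hnm
    induction m, hnm using Nat.le_induction with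
    | base => exact ⟨subset_rfl, fun a _ => ⟨rfl, rfl⟩⟩
    | succ m hm ih =>
      refine ⟨ih.1.trans (hσs m).1, fun a ha => ?_⟩
      have h1 := (hσs m).2 a (ih.1 ha)
      have h2 := ih.2 a ha
      exact ⟨h1.1.trans h2.1, h1.2.trans h2.2⟩
  choose N hNn using hWe
  have hA : ∀ a ∈ X, a ∈ (σ (N a)).1 := fun a ha => (hσ (N a)).1 ⟨ha, hNn a⟩
  rw [LkI.iff]
  refine ⟨fun a => (σ (N a)).2.1 a, fun a => (σ (N a)).2.2 a, fun a ha => (hσ (N a)).2.2.1 a (hA a ha), ?_⟩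
  intro a ha a' ha' x hx hx'
  have m1 := hmono (N a) (max (N a) (N a')) (le_max_left _ _)
  have m2 := hmono (N a') (max (N a) (N a')) (le_max_right _ _)
  refine (hσ (max (N a) (N a'))).2.2.2.1 a (m1.1 (hA a ha)) a' (m2.1 (hA a' ha')) x ?_ ?_
  · rw [(m1.2 a (hA a ha)).1]; exact hx
  · rw [(m2.2 a' (hA a' ha')).1]; exact hx'

theorem limit_thm {E : V → V → Prop} {C X T : Set V} {W : ℕ → Set V} {κ : ℕ → V → Set V}
    (hanti : Antitone W) (hW0 : W 0 = C) (hWe : ∀ v, ∃ n, v ∉ W n)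
    (hout : ∀ m, ∀ v ∈ C, ∀ w ∈ C, v ∉ W m → E v w → w ∉ W m)
    (hκ : ∀ n, ∀ v ∈ W n, v ∈ κ n v ∧ κ n v ⊆ W n) (hκe : ∀ n, ∀ v ∈ W n, ∀ w ∈ κ n v, κ n w = κ n v)
    (hκE : ∀ n, ∀ v ∈ W n, ∀ w ∈ W n, E v w → κ n w = κ n v)
    (hcross : ∀ n, ∀ v ∈ W n, ∃ U : Set V, U.Finite ∧ ∀ S a b, S ⊆ κ n v → Seg E S a b →
      a ∈ W (n+1) → b ∈ T → b ∉ W (n+1) → (S ∩ U).Nonempty)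
    (hN : NH E C X T) (hB : ∀ n, HasBase E (C \ W n) X T) :
    HasBase E C X T := by
  have hres : ∀ n G A, G ⊆ C → LkI E G T A → LkI E (G \ W n) T (A \ W n) := by
    intro n G A hG h
    refine (LkI.split (k := {x | x ∉ W n}) ?_ h).mono ?_ subset_rfl ?_
    · intro v hv w hw; exact hout n v (hG hv) w (hG hw)
    · exact fun x hx => hx
    · exact fun x hx => hx
  have hR : ∀ n, C \ W n ⊆ C \ W (n+1) := fun n => sdiff_subset_sdiff_right (hanti (Nat.le_succ n))
  have hR' : ∀ n m, n ≤ m → C \ W n ⊆ C \ W m := fun n m h => sdiff_subset_sdiff_right (hanti h)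
  have step : ∀ n J, MaxS E (C \ W n) X T J → ∃ J', MaxS E (C \ W (n+1)) X T J' ∧ J ⊆ J' := by
    intro n J hJ
    obtain ⟨A, h1, h2⟩ := (hB (n+1)).ext (hN.mono (fun _ _ => id) sdiff_subset subset_rfl subset_rfl)
      hJ.1 (hJ.2.1.mono (hR n) subset_rfl subset_rfl)
    exact ⟨A, h2, h1⟩
  choose! nx hnx using step
  obtain ⟨J0, hJ0⟩ := hB 0
  let J : ℕ → Set V := fun n => Nat.rec J0 (fun n s => nx n s) n
  have hJ : ∀ n, MaxS E (C \ W n) X T (J n) := by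
    intro n
    induction n with
    | zero => exact hJ0
    | succ n ih => exact (hnx n _ ih).1
  have hJm : Monotone J := monotone_nat_of_le_succ (fun n => (hnx n _ (hJ n)).2)
  have hJC : ∀ n, J n ⊆ C \ W n := fun n => (hJ n).2.1.subset
  have hJr : ∀ n m, J m \ W n ⊆ J n := by
    intro n m
    rcases le_total m n with h | h
    · exact sdiff_subset.trans (hJm h)
    · have h1 := hres n _ _ sdiff_subset (hJ m).2.1
      rw [← (hJ n).2.2 (J m \ W n) (fun x hx => ⟨hJm h hx, (hJC n hx).2⟩)
        (sdiff_subset.trans (hJ m).1) (h1.mono (sdiff_subset_sdiff_left sdiff_subset) subset_rfl subset_rfl)]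
  set X' : Set V := ⋃ n, J n with hX'
  have hX'n : ∀ n, X' \ W n = J n := by
    intro n
    apply subset_antisymm
    · rintro x ⟨h1, h2⟩
      obtain ⟨m, hm⟩ := mem_iUnion.1 h1
      exact hJr n m ⟨hm, h2⟩
    · intro x hx; exact ⟨mem_iUnion.2 ⟨n, hx⟩, (hJC n hx).2⟩
  have hX'X : X' ⊆ X := iUnion_subset fun n => (hJ n).1
  refine ⟨X', hX'X, ?_, ?_⟩
  · refine limit_link hanti hW0 hWe hout hκ hκe hκE hcross
      (hN.mono (fun _ _ => id) subset_rfl hX'X subset_rfl)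
      (iUnion_subset fun n => (hJC n).trans sdiff_subset) ?_
    intro m
    rw [hX'n]; exact (hJ m).2.1
  · intro A' h1 h2 h3
    refine subset_antisymm ?_ h1
    intro x hx
    obtain ⟨n, hn⟩ := hWe x
    have h4 := hres n _ _ subset_rfl h3
    have h5 := (hJ n).2.2 (A' \ W n) (fun y hy => ⟨h1 (mem_iUnion.2 ⟨n, hy⟩), (hJC n hy).2⟩)
      (sdiff_subset.trans h2) h4
    have : x ∈ J n := h5 ▸ ⟨hx, hn⟩
    exact mem_iUnion.2 ⟨n, this⟩

def sy (D : V → V → Prop) (x y : V) : Prop := D x y ∨ D y x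

theorem sy_symm {D : V → V → Prop} {x y : V} (h : sy D x y) : sy D y x := Or.symm h

theorem rs_sy_symm {D : V → V → Prop} {C : Set V} {x y : V}
    (h : ReflTransGen (rs (sy D) C) x y) : ReflTransGen (rs (sy D) C) y x :=
  rs_mono_rel (fun _ _ h => sy_symm h) (rs_flip h)

def live (D : V → V → Prop) (B0 C : Set V) : Set V :=
  {v | v ∈ C ∧ ∃ b ∈ B0, ReflTransGen (rs D C) v b}

def comp (D : V → V → Prop) (C : Set V) (v : V) : Set V :=
  {w | w ∈ C ∧ ReflTransGen (rs (sy D) C) v w}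

theorem comp_sub {D : V → V → Prop} {C : Set V} {v : V} : comp D C v ⊆ C := fun _ h => h.1

theorem mem_comp {D : V → V → Prop} {C : Set V} {v : V} (h : v ∈ C) : v ∈ comp D C v := ⟨h, .refl⟩

theorem comp_eq {D : V → V → Prop} {C : Set V} {v w : V} (h : w ∈ comp D C v) :
    comp D C w = comp D C v := by
  ext x
  exact ⟨fun hx => ⟨hx.1, h.2.trans hx.2⟩, fun hx => ⟨hx.1, (rs_sy_symm h.2).trans hx.2⟩⟩

theorem comp_adj {D : V → V → Prop} {C : Set V} {v w : V} (hv : v ∈ C) (hw : w ∈ C)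
    (h : sy D v w) : comp D C w = comp D C v :=
  comp_eq ⟨hw, .single ⟨h, hv, hw⟩⟩

theorem live_sub {D : V → V → Prop} {B0 C : Set V} : live D B0 C ⊆ C := fun _ h => h.1

theorem Seg.sub_live {D : V → V → Prop} {B0 C S : Set V} {a b : V} (h : Seg D S a b)
    (hS : S ⊆ C) (hb : b ∈ B0) : S ⊆ live D B0 C :=
  fun x hx => ⟨hS hx, b, hb, rs_mono hS (h.2.2.2 x hx).2⟩

def Good (D : V → V → Prop) (B0 C : Set V) : Prop := ∀ X, HasBase D C X B0

theorem Good.union {D : V → V → Prop} {B0 A B : Set V} (hAB : A ⊆ B)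
    (h : ∀ v ∈ live D B0 B, Good D B0 (comp D (live D B0 B) v ∩ A)) : Good D B0 A := by
  intro X
  set L := live D B0 B with hL
  have h' : ∀ k, (∃ v ∈ L, comp D L v = k) → ∃ J, MaxS D (k ∩ A) X B0 J := by
    rintro k ⟨v, hv, rfl⟩
    exact h v hv X
  choose! J hJ using h'
  have hJ' : ∀ v ∈ L, MaxS D (comp D L v ∩ A) X B0 (J (comp D L v)) := fun v hv => hJ _ ⟨v, hv, rfl⟩
  let J1 : Set V := {x | x ∈ L ∧ x ∈ J (comp D L x)}
  have hJk : ∀ v ∈ L, J1 ∩ comp D L v = J (comp D L v) := by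
    intro v hv
    ext x
    constructor
    · rintro ⟨⟨_, h1⟩, h2⟩
      rwa [comp_eq h2] at h1
    · intro hx
      have := (hJ' v hv).2.1.subset hx
      exact ⟨⟨this.1.1, by rwa [comp_eq this.1]⟩, this.1⟩
  refine ⟨J1, ?_, ?_, ?_⟩
  · rintro x ⟨h1, h2⟩; exact (hJ' x h1).1 h2
  · refine LkI.glue (K := L) (κ := comp D L) (fun v hv => mem_comp hv)
      (fun v _ w hw => comp_eq hw) (fun x hx => hx.1) ?_
    intro v hv
    rw [hJk v hv, inter_comm]
    exact (hJ' v hv).2.1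
  · intro A' h1 h2 h3
    have h4 : LkI D (A ∩ L) B0 A' := by
      rw [LkI.iff] at h3 ⊢
      obtain ⟨S, e, g1, g2⟩ := h3
      refine ⟨S, e, fun a ha => ⟨subset_inter (g1 a ha).1 ?_, (g1 a ha).2⟩, g2⟩
      exact (g1 a ha).2.1.sub_live ((g1 a ha).1.trans hAB) (g1 a ha).2.2
    refine subset_antisymm ?_ h1
    intro x hx
    have hxL := (h4.subset hx).2
    have h5 : LkI D (A ∩ L ∩ comp D L x) B0 (A' ∩ comp D L x) := by
      refine LkI.split ?_ h4
      intro v hv w hw hvx hE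
      have := comp_adj hv.2 hw.2 (Or.inl hE)
      rw [← comp_eq hvx, ← this]
      exact mem_comp hw.2
    have h6 := (hJ' x hxL).2.2 (A' ∩ comp D L x) (by rw [← hJk x hxL]; exact inter_subset_inter_left _ h1)
      (inter_subset_left.trans h2) (h5.mono (fun y hy => ⟨hy.2, hy.1.1⟩) subset_rfl subset_rfl)
    have : x ∈ J (comp D L x) := h6 ▸ ⟨hx, mem_comp hxL⟩
    exact ⟨hxL, this⟩

theorem Good.del_one {D : V → V → Prop} {B0 C : Set V} {u : V} (hN : NH D univ univ B0)
    (h : Good D B0 (C \ {u})) : Good D B0 C := by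
  classical
  intro X
  obtain ⟨J, hJ⟩ := h X
  have hNX : ∀ G, NH D G X B0 := fun G => hN.mono (fun _ _ => id) (subset_univ _) (subset_univ _) subset_rfl
  by_cases hm : MaxS D C X B0 J
  · exact ⟨J, hm⟩
  have hex : ∃ x ∈ X, x ∉ J ∧ LkI D C B0 (insert x J) := by
    by_contra hcon
    push Not at hcon
    refine hm ⟨hJ.1, hJ.2.1.mono sdiff_subset subset_rfl subset_rfl, ?_⟩
    intro A' h1 h2 h3
    refine subset_antisymm ?_ h1
    intro x hx
    by_contra hxJ
    exact hcon x (h2 hx) hxJ (h3.mono subset_rfl subset_rfl (insert_subset hx h1))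
  obtain ⟨x, hxX, hxJ, hxL⟩ := hex
  refine ⟨insert x J, insert_subset hxX hJ.1, hxL, ?_⟩
  intro A' h1 h2 h3
  refine subset_antisymm ?_ h1
  intro y hy
  by_contra hyJ
  have hyx : y ≠ x := fun h => hyJ (by simp [h])
  have hyJ' : y ∉ J := fun h => hyJ (by simp [h])
  have hL : LkI D C B0 (insert y (insert x J)) := h3.mono subset_rfl subset_rfl (insert_subset hy h1)
  rw [LkI.iff] at hL
  obtain ⟨S, e, g1, g2⟩ := hL
  set I := insert y (insert x J) with hI
  obtain ⟨z, hz⟩ : ∃ z, ∀ a ∈ I, a ≠ z → u ∉ S a := by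
    by_cases hu : ∃ z ∈ I, u ∈ S z
    · obtain ⟨z, hz, hu⟩ := hu
      exact ⟨z, fun a ha hne hua => hne (g2 a ha z hz u hua hu)⟩
    · exact ⟨x, fun a ha _ hua => hu ⟨a, ha, hua⟩⟩
  have hK : LkI D (C \ {u}) B0 (I \ {z}) := by
    rw [LkI.iff]
    refine ⟨S, e, fun a ha => ⟨?_, (g1 a ha.1).2⟩, fun a ha a' ha' => g2 a ha.1 a' ha'.1⟩
    intro w hw
    refine ⟨(g1 a ha.1).1 hw, ?_⟩
    rintro rfl
    exact hz a ha.1 ha.2 hw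
  have hKX : I \ {z} ⊆ X := sdiff_subset.trans (insert_subset (h2 hy) (insert_subset hxX hJ.1))
  have hexc := hJ.exchange (hNX _) hKX hK
  by_cases hzJ : z ∈ J
  · have e1 : J \ (I \ {z}) ⊆ {z} := by
      rintro w ⟨hw, hw2⟩
      by_contra hne
      exact hw2 ⟨by simp [hI, hw], hne⟩
    have e2 : ({x, y} : Set V) ⊆ (I \ {z}) \ J := by
      rintro w (rfl | rfl)
      · exact ⟨⟨by simp [hI], fun h => hxJ (by rw [h]; exact hzJ)⟩, hxJ⟩
      · exact ⟨⟨by simp [hI], fun h => hyJ' (by rw [h]; exact hzJ)⟩, hyJ'⟩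
    have e3 := (encard_le_encard e2).trans (hexc.trans (encard_le_encard e1))
    rw [encard_pair hyx.symm, encard_singleton] at e3
    exact absurd e3 (by norm_num)
  · have e1 : J \ (I \ {z}) = ∅ := by
      rw [eq_empty_iff_forall_notMem]
      rintro w ⟨hw, hw2⟩
      exact hw2 ⟨by simp [hI, hw], fun h => hzJ (by rw [← h]; exact hw)⟩
    rw [e1, encard_empty] at hexc
    have hemp : (I \ {z}) \ J = ∅ := by rwa [← encard_eq_zero, ← nonpos_iff_eq_zero]
    have hx1 : x = z := by
      by_contra hne
      exact (eq_empty_iff_forall_notMem.1 hemp) x ⟨⟨by simp [hI], hne⟩, hxJ⟩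
    have hy1 : y = z := by
      by_contra hne
      exact (eq_empty_iff_forall_notMem.1 hemp) y ⟨⟨by simp [hI], hne⟩, hyJ'⟩
    exact hyx (hy1.trans hx1.symm)

theorem Good.del_finite {D : V → V → Prop} {B0 C U : Set V} (hN : NH D univ univ B0)
    (hU : U.Finite) (h : Good D B0 (C \ U)) : Good D B0 C := by
  induction U, hU using Set.Finite.induction_on with
  | empty => simpa using h
  | @insert a s _ _ ih =>
    apply ih
    apply Good.del_one (u := a) hN
    have : (C \ s) \ {a} = C \ insert a s := by
      ext x; simp only [mem_sdiff, mem_insert_iff, mem_singleton_iff]; tauto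
    rwa [this]

def gi (n : ℕ → ℕ) : ℕ → ℕ × ℕ
  | 0 => (0, 0)
  | j+1 => if (gi n j).2 < n (gi n j).1 then ((gi n j).1, (gi n j).2 + 1) else ((gi n j).1 + 1, 0)

theorem gi_lt {n : ℕ → ℕ} {j : ℕ} (h : (gi n j).2 < n (gi n j).1) :
    gi n (j+1) = ((gi n j).1, (gi n j).2 + 1) := by
  rw [gi, if_pos h]

theorem gi_ge {n : ℕ → ℕ} {j : ℕ} (h : ¬ (gi n j).2 < n (gi n j).1) :
    gi n (j+1) = ((gi n j).1 + 1, 0) := by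
  rw [gi, if_neg h]

theorem gi_le (n : ℕ → ℕ) (j : ℕ) : (gi n j).2 ≤ n (gi n j).1 ∧ (gi n j).1 ≤ j := by
  induction j with
  | zero => simp [gi]
  | succ j ih =>
    by_cases h : (gi n j).2 < n (gi n j).1
    · rw [gi_lt h]; exact ⟨h, by simp; omega⟩
    · rw [gi_ge h]; exact ⟨Nat.zero_le _, by simp; omega⟩

theorem gi_surj (n : ℕ → ℕ) (k : ℕ) : ∀ i ≤ n k, ∃ j, gi n j = (k, i) := by
  have aux : ∀ k, (∃ j, gi n j = (k, 0)) → ∀ i ≤ n k, ∃ j, gi n j = (k, i) := by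
    intro k h0 i
    induction i with
    | zero => exact fun _ => h0
    | succ i ih =>
      intro hi
      obtain ⟨j, hj⟩ := ih (by omega)
      refine ⟨j+1, ?_⟩
      rw [gi_lt (by rw [hj]; simp; omega), hj]
  induction k with
  | zero => exact aux 0 ⟨0, rfl⟩
  | succ k ih =>
    apply aux
    obtain ⟨j, hj⟩ := ih (n k) le_rfl
    refine ⟨j+1, ?_⟩
    rw [gi_ge (by rw [hj]; simp), hj]

theorem gi_mono (n : ℕ → ℕ) (j d : ℕ) : (gi n j).1 < (gi n (j+d+1)).1 ∨
    ((gi n j).1 = (gi n (j+d+1)).1 ∧ (gi n j).2 < (gi n (j+d+1)).2) := by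
  have one : ∀ j, (gi n j).1 < (gi n (j+1)).1 ∨
    ((gi n j).1 = (gi n (j+1)).1 ∧ (gi n j).2 < (gi n (j+1)).2) := by
    intro j
    by_cases h : (gi n j).2 < n (gi n j).1
    · rw [gi_lt h]; right; simp
    · rw [gi_ge h]; left; simp
  induction d with
  | zero => exact one j
  | succ d ih => have := one (j+d+1); rw [show j + (d+1) + 1 = j+d+1+1 by ring]; omega

theorem gi_inj (n : ℕ → ℕ) : Function.Injective (gi n) := by
  intro a b hab
  by_contra hne
  rcases Nat.lt_or_gt_of_ne hne with h | h
  · obtain ⟨d, rfl⟩ := Nat.exists_eq_add_of_lt h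
    have := gi_mono n a d; rw [← hab] at this; omega
  · obtain ⟨d, rfl⟩ := Nat.exists_eq_add_of_lt h
    have := gi_mono n b d; rw [hab] at this; omega

theorem gi_pred {n : ℕ → ℕ} {j k i : ℕ} (h : gi n (j+1) = (k, i+1)) : gi n j = (k, i) := by
  by_cases h' : (gi n j).2 < n (gi n j).1
  · rw [gi_lt h'] at h
    simp only [Prod.mk.injEq] at h
    exact Prod.ext h.1 (by simpa using h.2)
  · rw [gi_ge h'] at h; simp at h

def dirD (D : V → V → Prop) (d : Bool) (x y : V) : Prop := if d then D x y else D y x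

/-- forest data -/
structure Fo (D : V → V → Prop) (B0 L : Set V) (nxt : V → V) (h : V → ℕ) : Prop where
  zero : ∀ v ∈ L, h v = 0 → v ∈ B0
  mem : ∀ v ∈ L, nxt v ∈ L
  succ : ∀ v ∈ L, h v ≠ 0 → D v (nxt v) ∧ h v = h (nxt v) + 1

theorem Fo.iter {D : V → V → Prop} {B0 L : Set V} {nxt : V → V} {h : V → ℕ}
    (F : Fo D B0 L nxt h) {v : V} (hv : v ∈ L) (i : ℕ) (hi : i ≤ h v) :
    nxt^[i] v ∈ L ∧ h (nxt^[i] v) + i = h v := by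
  induction i with
  | zero => exact ⟨hv, rfl⟩
  | succ i ih =>
    obtain ⟨h1, h2⟩ := ih (by omega)
    rw [Function.iterate_succ_apply']
    have := F.succ _ h1 (by omega)
    exact ⟨F.mem _ h1, by omega⟩

def rt (nxt : V → V) (h : V → ℕ) (v : V) : V := nxt^[h v] v

theorem Fo.rt_iter {D : V → V → Prop} {B0 L : Set V} {nxt : V → V} {h : V → ℕ}
    (F : Fo D B0 L nxt h) {v : V} (hv : v ∈ L) (i : ℕ) (hi : i ≤ h v) :
    rt nxt h (nxt^[i] v) = rt nxt h v := by
  have := F.iter hv i hi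
  unfold rt
  rw [← Function.iterate_add_apply, this.2]

theorem Fo.rt_mem {D : V → V → Prop} {B0 L : Set V} {nxt : V → V} {h : V → ℕ}
    (F : Fo D B0 L nxt h) {v : V} (hv : v ∈ L) : rt nxt h v ∈ L ∧ rt nxt h v ∈ B0 := by
  have := F.iter hv (h v) le_rfl
  exact ⟨this.1, F.zero _ this.1 (by unfold rt; omega)⟩

theorem Fo.path {D : V → V → Prop} {B0 L : Set V} {nxt : V → V} {h : V → ℕ}
    (F : Fo D B0 L nxt h) {v : V} (hv : v ∈ L) :
    ∃ p : DiPath D, p.first = v ∧ p.last ∈ B0 ∧ ∀ w ∈ p.vertSet, ∃ i ≤ h v, w = nxt^[i] v := by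
  refine ⟨⟨(List.range (h v + 1)).map (fun i => nxt^[i] v), by simp, ?_, ?_⟩, ?_, ?_, ?_⟩
  · rw [List.nodup_map_iff_inj_on List.nodup_range]
    intro x hx y hy hxy
    simp only [List.mem_range] at hx hy
    have h1 := F.iter hv x (by omega)
    have h2 := F.iter hv y (by omega)
    rw [hxy] at h1
    omega
  · show List.IsChain _ _
    rw [List.isChain_iff_getElem]
    intro i hi
    simp only [List.length_map, List.length_range] at hi
    simp only [List.getElem_map, List.getElem_range]
    rw [Function.iterate_succ_apply']
    have := F.iter hv i (by omega)
    exact (F.succ _ this.1 (by omega)).1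
  · simp [DiPath.first]
  · have := (F.rt_mem hv).2
    simp only [DiPath.last, List.getLast_map, List.getLast_range]
    exact this
  · intro w hw
    simp only [DiPath.vertSet, mem_ofPred_eq, List.mem_map, List.mem_range] at hw
    obtain ⟨i, hi, rfl⟩ := hw
    exact ⟨i, by omega, rfl⟩

theorem Fo.meet {D : V → V → Prop} {B0 L : Set V} {nxt : V → V} {h : V → ℕ}
    (F : Fo D B0 L nxt h) {x y : V} (hx : x ∈ L) (hy : y ∈ L) (hr : rt nxt h x = rt nxt h y) :
    ∃ a b, a ≤ h x ∧ b ≤ h y ∧ nxt^[a] x = nxt^[b] y ∧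
      (∀ i ≤ a, ∀ j < b, nxt^[i] x ≠ nxt^[j] y) := by
  classical
  have hex : ∃ a, a ≤ h x ∧ ∃ b ≤ h y, nxt^[a] x = nxt^[b] y := ⟨h x, le_rfl, h y, le_rfl, hr⟩
  obtain ⟨ha, b, hb, hab⟩ := Nat.find_spec hex
  refine ⟨Nat.find hex, b, ha, hb, hab, ?_⟩
  intro i hi j hj heq
  rcases Nat.lt_or_ge i (Nat.find hex) with h1 | h1
  · exact Nat.find_min hex h1 ⟨by omega, j, by omega, heq⟩
  · have hi' : i = Nat.find hex := le_antisymm hi h1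
    rw [hi', hab] at heq
    have e1 := F.iter hy b hb
    have e2 := F.iter hy j (by omega)
    rw [heq] at e1
    omega

theorem trees_AC {D : V → V → Prop} {B0 L : Set V} {nxt : V → V} {h : V → ℕ}
    (F : Fo D B0 L nxt h) (x y : ℕ → V) (d : ℕ → Bool) (hx : ∀ t, x t ∈ L) (hy : ∀ t, y t ∈ L)
    (hxy : ∀ t, rt nxt h (x t) = rt nxt h (y t)) (h0 : x 0 = y 0)
    (hinj : ∀ t t', rt nxt h (x t) = rt nxt h (x t') → t = t')
    (hd : ∀ t, dirD D (d t) (y t) (x (t+1)))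
    (hT : ∀ N, ∃ t ≥ N, d t = true) (hF : ∀ N, ∃ t ≥ N, d t = false) : ContainsAltComb D B0 := by
  classical
  have hm := fun t => F.meet (hx t) (hy t) (hxy t)
  choose a b ha hb hab hne using hm
  have hab0 : a 0 = 0 := by
    by_contra hc
    have e1 := F.iter (hx 0) (a 0) (ha 0)
    have e2 := F.iter (hy 0) (b 0) (hb 0)
    rw [← hab 0] at e2
    have e3 : h (x 0) = h (y 0) := by rw [h0]
    have := hne 0 0 (by omega) 0 (by omega)
    exact this (by simpa using h0)
  let n : ℕ → ℕ := fun t => a t + b t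
  let p : ℕ → ℕ → V := fun t i => if i ≤ a t then nxt^[i] (x t) else nxt^[a t + b t - i] (y t)
  let g := gi n
  have hp0 : ∀ t, p t 0 = x t := fun t => by simp [p]
  have hpF : ∀ t i, i ≤ a t → p t i = nxt^[i] (x t) := fun t i hi => by simp [p, hi]
  have hpB : ∀ t i, a t ≤ i → i ≤ n t → p t i = nxt^[n t - i] (y t) := by
    intro t i hi _
    rcases hi.eq_or_lt with rfl | h1
    · rw [hpF t _ le_rfl, hab t]; simp [n]
    · simp [p, not_le.2 h1, n]
  have hpn : ∀ t, p t (n t) = y t := fun t => by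
    rw [hpB t (n t) (by simp [n]) le_rfl]; simp
  have hpL : ∀ t i, i ≤ n t → p t i ∈ L ∧ rt nxt h (p t i) = rt nxt h (x t) ∧
      h (p t (a t)) ≤ h (p t i) := by
    intro t i hi
    have e1 := F.iter (hx t) (a t) (ha t)
    have e2 := F.iter (hy t) (b t) (hb t)
    rw [hpF t (a t) le_rfl]
    rcases le_total i (a t) with h1 | h1
    · rw [hpF t i h1]
      have := F.iter (hx t) i (h1.trans (ha t))
      exact ⟨this.1, F.rt_iter (hx t) i (h1.trans (ha t)), by omega⟩
    · rw [hpB t i h1 hi]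
      have h2 : n t - i ≤ b t := by simp only [n] at hi ⊢; omega
      have := F.iter (hy t) (n t - i) (h2.trans (hb t))
      refine ⟨this.1, (F.rt_iter (hy t) _ (h2.trans (hb t))).trans (hxy t).symm, ?_⟩
      rw [← hab t] at e2; omega
  have hpinj : ∀ t i j, i ≤ n t → j ≤ n t → p t i = p t j → i = j := by
    have key : ∀ t i j, i ≤ n t → j ≤ n t → i < j → p t i ≠ p t j := by
      intro t i j hi hj hij heq
      have hj' : j ≤ a t + b t := hj
      rcases le_or_gt j (a t) with h1 | h1
      · rw [hpF t i (by omega), hpF t j h1] at heq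
        have e1 := F.iter (hx t) i (by have := ha t; omega)
        have e2 := F.iter (hx t) j (h1.trans (ha t))
        rw [heq] at e1; omega
      · rcases le_or_gt i (a t) with h2 | h2
        · rw [hpF t i h2, hpB t j h1.le hj] at heq
          exact hne t i h2 (n t - j) (by simp only [n]; omega) heq
        · rw [hpB t i h2.le hi, hpB t j h1.le hj] at heq
          have e1 := F.iter (hy t) (n t - i) (by have := hb t; simp only [n]; omega)
          have e2 := F.iter (hy t) (n t - j) (by have := hb t; simp only [n]; omega)
          rw [heq] at e1; omega
    intro t i j hi hj heq
    by_contra hc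
    rcases Nat.lt_or_gt_of_ne hc with h1 | h1
    · exact key t i j hi hj h1 heq
    · exact key t j i hj hi h1 heq.symm
  have hgle : ∀ j, (g j).2 ≤ n (g j).1 := fun j => (gi_le n j).1
  let f : ℕ → V := fun j => p (g j).1 (g j).2
  let o : ℕ → Bool := fun j => if (g j).2 < a (g j).1 then true else
    if (g j).2 < n (g j).1 then false else d (g j).1
  have hf0 : f 0 = p 0 (a 0) := by simp [f, g, gi, hab0]
  have hfL : ∀ j, f j ∈ L := fun j => (hpL _ _ (hgle j)).1
  have hpk : ∀ k, o k = true → o (k+1) = false → (g (k+1)).2 = a (g (k+1)).1 := by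
    intro k h1 h2
    have h3 : ¬ (g (k+1)).2 < a (g (k+1)).1 := by
      intro h; simp [o, h] at h2
    by_contra hc
    have h4 : a (g (k+1)).1 < (g (k+1)).2 := by omega
    obtain ⟨i, hi⟩ : ∃ i, (g (k+1)).2 = i + 1 := ⟨(g (k+1)).2 - 1, by omega⟩
    have h5 : g k = ((g (k+1)).1, i) := gi_pred (n := n) (Prod.ext rfl hi)
    have h6 := hgle (k+1)
    have h7 : ¬ i < a (g (k+1)).1 := by omega
    have h8 : i < n (g (k+1)).1 := by omega
    simp [o, h5, h7, h8] at h1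
  have hne' : Nonempty (DiPath D) := ⟨(F.path (hx 0)).choose⟩
  choose! pa hpa1 hpa2 hpa3 using fun v (hv : v ∈ L) => F.path hv
  let Q : Set ℕ := insert 0 {j | ∃ k, o k = true ∧ o (k+1) = false ∧ j = k+1}
  have hQ : ∀ j ∈ Q, f j = p (g j).1 (a (g j).1) := by
    rintro j (rfl | ⟨k, h1, h2, rfl⟩)
    · simp only [f, g, gi]; rw [hab0]
    · simp only [f]; rw [hpk k h1 h2]
  have hvp : ∀ j, ∀ v ∈ (pa (f j)).vertSet, rt nxt h v = rt nxt h (x (g j).1) := by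
    intro j v hv
    obtain ⟨i, hi, rfl⟩ := hpa3 (f j) (hfL j) v hv
    rw [F.rt_iter (hfL j) i hi]
    exact (hpL _ _ (hgle j)).2.1
  have hsurj : ∀ t, ∃ j ≥ t, g j = (t, n t) := by
    intro t
    obtain ⟨j, hj⟩ := gi_surj n t (n t) le_rfl
    refine ⟨j, ?_, hj⟩
    have := (gi_le n j).2
    rw [hj] at this
    exact this
  have hoT : ∀ N, ∃ k ≥ N, o k = true := by
    intro N
    obtain ⟨t, ht, hdt⟩ := hT N
    obtain ⟨j, hj, hg⟩ := hsurj t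
    refine ⟨j, by omega, ?_⟩
    simp [o, hg, n, hdt]
  have hoF : ∀ N, ∃ k ≥ N, o k = false := by
    intro N
    obtain ⟨t, ht, hdt⟩ := hF N
    obtain ⟨j, hj, hg⟩ := hsurj t
    refine ⟨j, by omega, ?_⟩
    simp [o, hg, n, hdt]
  refine ⟨f, o, (fun j => pa (f j)) '' Q, ?_, ?_, ?_, ⟨?_, ?_⟩, ?_, ?_⟩
  · intro j j' hjj
    have e1 := hpL _ _ (hgle j)
    have e2 := hpL _ _ (hgle j')
    have e0 : p (g j).1 (g j).2 = p (g j').1 (g j').2 := hjj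
    have e3 : (g j).1 = (g j').1 := hinj _ _ (by rw [← e1.2.1, ← e2.2.1, e0])
    have e4 : (g j).2 = (g j').2 := by
      refine hpinj (g j).1 _ _ (hgle j) (by rw [e3]; exact hgle j') ?_
      rw [e0, e3]
    exact gi_inj n (Prod.ext e3 e4)
  · intro j
    by_cases h1 : (g j).2 < a (g j).1
    · have hg : g (j+1) = ((g j).1, (g j).2 + 1) := gi_lt (n := n) (by show _ < _; simp only [n]; exact Nat.lt_add_right _ h1)
      have ho : o j = true := by simp [o, h1]
      rw [ho, if_pos rfl]
      simp only [f, hg]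
      rw [hpF _ _ h1.le, hpF _ _ h1, Function.iterate_succ_apply']
      have := F.iter (hx (g j).1) (g j).2 (h1.le.trans (ha _))
      exact (F.succ _ this.1 (by have := ha (g j).1; omega)).1
    · by_cases h2 : (g j).2 < n (g j).1
      · have hg : g (j+1) = ((g j).1, (g j).2 + 1) := gi_lt (n := n) h2
        have ho : o j = false := by simp [o, h1, h2]
        rw [ho, if_neg (by simp)]
        simp only [f, hg]
        rw [hpB _ _ (by omega) h2.le, hpB _ _ (by omega) h2]
        have e : n (g j).1 - (g j).2 = (n (g j).1 - ((g j).2 + 1)) + 1 := by omega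
        rw [e, Function.iterate_succ_apply']
        have hbb := hb (g j).1
        have h3 : n (g j).1 - ((g j).2 + 1) < b (g j).1 := by simp only [n] at h2 ⊢; omega
        have := F.iter (hy (g j).1) (n (g j).1 - ((g j).2 + 1)) (by omega)
        exact (F.succ _ this.1 (by omega)).1
      · have hg : g (j+1) = ((g j).1 + 1, 0) := gi_ge (n := n) h2
        have ho : o j = d (g j).1 := by simp [o, h1, h2]
        have h3 : (g j).2 = n (g j).1 := le_antisymm (hgle j) (by omega)
        rw [ho]
        simp only [f, hg, hp0, h3, hpn]
        exact hd (g j).1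
  · intro N
    obtain ⟨k1, hk1, hk1'⟩ := hoT N
    obtain ⟨k2, hk2, hk2'⟩ := hoF k1
    obtain ⟨e, rfl⟩ := Nat.exists_eq_add_of_le hk2
    clear hk2
    induction e with
    | zero => simp at hk2'; rw [hk1'] at hk2'; cases hk2'
    | succ e ih =>
      by_cases hc : o (k1+e) = true
      · exact ⟨k1+e, by omega, hc, hk2'⟩
      · exact ih (by simpa using hc)
  · rintro _ ⟨j, hj, rfl⟩
    exact hpa2 (f j) (hfL j)
  · rintro _ ⟨j, hj, rfl⟩ _ ⟨j', hj', rfl⟩ hnn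
    rw [Set.disjoint_left]
    intro v hv hv'
    apply hnn
    have e1 := hinj _ _ ((hvp j v hv).symm.trans (hvp j' v hv'))
    show pa (f j) = pa (f j')
    rw [hQ j hj, hQ j' hj', e1]
  · ext v
    simp only [Ini, mem_ofPred_eq, mem_image, mem_insert_iff]
    constructor
    · rintro ⟨_, ⟨j, hj, rfl⟩, rfl⟩
      rw [hpa1 (f j) (hfL j)]
      rcases hj with rfl | ⟨k, h1, h2, rfl⟩
      · exact Or.inl rfl
      · exact Or.inr ⟨k, h1, h2, rfl⟩
    · rintro (rfl | ⟨k, h1, h2, rfl⟩)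
      · exact ⟨_, ⟨0, Or.inl rfl, rfl⟩, hpa1 _ (hfL 0)⟩
      · exact ⟨_, ⟨k+1, Or.inr ⟨k, h1, h2, rfl⟩, rfl⟩, hpa1 _ (hfL _)⟩
  · rintro _ ⟨j, hj, rfl⟩ v hv ⟨j', rfl⟩
    show f j' = (pa (f j)).first
    rw [hpa1 _ (hfL j)]
    have e1 := hvp j _ hv
    have e2 := hpL _ _ (hgle j')
    have e3 : (g j').1 = (g j).1 := hinj _ _ (e2.2.1.symm.trans e1)
    obtain ⟨i, hi, hfi⟩ := hpa3 (f j) (hfL j) _ hv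
    have e4 := F.iter (hfL j) i hi
    rw [← hfi] at e4
    have e5 : h (f j) ≤ h (f j') := by
      rw [hQ j hj, ← e3]; exact e2.2.2
    have : i = 0 := by omega
    rw [hfi, this]; rfl

theorem exists_forest {D : V → V → Prop} {B0 : Set V} {L : ℕ → Set V}
    (hdisj : ∀ i j x, x ∈ L i → x ∈ L j → i = j)
    (hlive : ∀ i, ∀ v ∈ L i, ∃ b ∈ B0, ReflTransGen (rs D (L i)) v b) :
    ∃ nxt h, Fo D B0 (⋃ i, L i) nxt h ∧ ∀ i, ∀ v ∈ L i, nxt v ∈ L i := by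
  let P : ℕ → ℕ → V → Prop := fun i n => Nat.rec (fun v => v ∈ B0)
    (fun _ q v => ∃ w, rs D (L i) v w ∧ q w) n
  have hP : ∀ i, ∀ v ∈ L i, ∃ n, P i n v := by
    intro i v hv
    obtain ⟨b, hb, hr⟩ := hlive i v hv
    induction hr using ReflTransGen.head_induction_on with
    | refl => exact ⟨0, hb⟩
    | head h1 _ ih =>
      obtain ⟨n, hn⟩ := ih h1.2.2
      exact ⟨n+1, _, h1, hn⟩
  have hM : ∀ i v, ∃ n, v ∈ L i → P i n v ∧ ∀ m, P i m v → n ≤ m := by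
    intro i v
    classical
    by_cases hv : v ∈ L i
    · have h1 : sInf {n | P i n v} ∈ {n | P i n v} := Nat.sInf_mem (hP i v hv)
      exact ⟨sInf {n | P i n v}, fun _ => ⟨h1, fun m hm => Nat.sInf_le hm⟩⟩
    · exact ⟨0, fun h => absurd h hv⟩
  choose μ hμ using hM
  have key : ∀ v, ∃ (w : V) (n : ℕ), (∀ i, v ∈ L i → w ∈ L i) ∧
      ∀ i, v ∈ L i → n = μ i v ∧ (n = 0 → v ∈ B0) ∧
        (n ≠ 0 → D v w ∧ (w ∈ L i → n = μ i w + 1)) := by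
    intro v
    by_cases hv : ∃ i, v ∈ L i
    · obtain ⟨i, hi⟩ := hv
      obtain ⟨hsp, hmin⟩ := hμ i v hi
      rcases hn : μ i v with _ | n
      · rw [hn] at hsp
        refine ⟨v, 0, fun _ h => h, ?_⟩
        intro j hj
        have := hdisj i j v hi hj; subst this
        exact ⟨hn.symm, fun _ => hsp, fun h => absurd rfl h⟩
      · rw [hn] at hsp
        obtain ⟨w, hw, hPw⟩ := hsp
        refine ⟨w, n+1, ?_, ?_⟩
        · intro j hj
          have := hdisj i j v hi hj; subst this
          exact hw.2.2
        · intro j hj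
          have := hdisj i j v hi hj; subst this
          refine ⟨hn.symm, fun h => absurd h (by omega), fun _ => ⟨hw.1, fun hw' => ?_⟩⟩
          have h1 : μ i w ≤ n := (hμ i w hw').2 n hPw
          have h2 : μ i v ≤ μ i w + 1 := hmin _ ⟨w, hw, (hμ i w hw').1⟩
          omega
    · refine ⟨v, 0, fun _ h => h, fun i hi => absurd ⟨i, hi⟩ hv⟩
  choose nxt h h1 h2 using key
  refine ⟨nxt, h, ⟨?_, ?_, ?_⟩, fun i v hv => h1 v i hv⟩
  · intro v hv h0
    obtain ⟨i, hi⟩ := mem_iUnion.1 hv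
    exact (h2 v i hi).2.1 h0
  · intro v hv
    obtain ⟨i, hi⟩ := mem_iUnion.1 hv
    exact mem_iUnion.2 ⟨i, h1 v i hi⟩
  · intro v hv h0
    obtain ⟨i, hi⟩ := mem_iUnion.1 hv
    obtain ⟨e1, e2⟩ := (h2 v i hi).2.2 h0
    have hw := h1 v i hi
    exact ⟨e1, by rw [e2 hw, (h2 (nxt v) i hw).1]⟩

def conn (D : V → V → Prop) (C : Set V) : Prop :=
  ∀ x ∈ C, ∀ y ∈ C, ReflTransGen (rs (sy D) C) x y

def slive (D : V → V → Prop) (B0 C : Set V) : Prop := ∀ x ∈ C, ∃ b ∈ B0, ReflTransGen (rs D C) x b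

theorem dirD_sy {D : V → V → Prop} {d : Bool} {x y : V} (h : dirD D d x y) : sy D x y := by
  cases d
  · exact Or.inr (by simpa [dirD] using h)
  · exact Or.inl (by simpa [dirD] using h)

theorem sy_dirD {D : V → V → Prop} {x y : V} (h : sy D x y) : ∃ d, dirD D d x y := by
  rcases h with h | h
  · exact ⟨true, by simpa [dirD] using h⟩
  · exact ⟨false, by simpa [dirD] using h⟩

theorem layers_AC {D : V → V → Prop} {B0 : Set V} (L : ℕ → Set V) (c l : ℕ → V) (δ : ℕ → Bool)
    (hdisj : ∀ i j x, x ∈ L i → x ∈ L j → i = j)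
    (hlive : ∀ i, slive D B0 (L i)) (hconn : ∀ i, conn D (L i))
    (hc : ∀ i, c i ∈ L i) (hl : ∀ i, l i ∈ L i) (hd : ∀ i, dirD D (δ i) (l i) (c (i+1)))
    (hT : ∀ N, ∃ t ≥ N, δ t = true) (hF : ∀ N, ∃ t ≥ N, δ t = false) : ContainsAltComb D B0 := by
  classical
  obtain ⟨nxt, h, F, hn⟩ := exists_forest hdisj hlive
  have hit : ∀ i, ∀ v ∈ L i, ∀ k, nxt^[k] v ∈ L i := by
    intro i v hv k
    induction k with
    | zero => exact hv
    | succ k ih => rw [Function.iterate_succ_apply']; exact hn i _ ih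
  have hrt : ∀ i, ∀ v ∈ L i, rt nxt h v ∈ L i := fun i v hv => hit i v hv _
  let TA : ℕ → V → V → Prop := fun i r r' => ∃ u ∈ L i, ∃ v ∈ L i, rt nxt h u = r ∧ rt nxt h v = r' ∧ sy D u v
  have hpath : ∀ i, ReflTransGen (rs (TA i) (L i)) (rt nxt h (c i)) (rt nxt h (l i)) := by
    intro i
    have := hconn i (c i) (hc i) (l i) (hl i)
    generalize l i = z at this
    induction this with
    | refl => exact .refl
    | tail _ h1 ih =>
      exact ih.tail ⟨⟨_, h1.2.1, _, h1.2.2, rfl, rfl, h1.1⟩, hrt i _ h1.2.1, hrt i _ h1.2.2⟩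
  choose n p hp0 hpn hpE hpL hpi using fun i => exists_path (hrt i _ (hc i)) (hpath i)
  have hg := gi_le n
  let r : ℕ → V := fun t => p (gi n t).1 (gi n t).2
  have hrL : ∀ t, r t ∈ L (gi n t).1 := fun t => hpL _ _ (hg t).1
  have hrinj : ∀ t t', r t = r t' → t = t' := by
    intro t t' he
    have e1 : (gi n t).1 = (gi n t').1 := hdisj _ _ (r t) (hrL t) (he ▸ hrL t')
    have e2 : (gi n t).2 = (gi n t').2 := by
      refine hpi (gi n t).1 _ (hg t).1 _ (by rw [e1]; exact (hg t').1) ?_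
      have : r t = r t' := he
      simp only [r] at this
      rw [this, e1]
    exact gi_inj n (Prod.ext e1 e2)
  have step : ∀ t, ∃ (y x : V) (d : Bool), y ∈ (⋃ i, L i) ∧ x ∈ (⋃ i, L i) ∧ rt nxt h y = r t ∧
      rt nxt h x = r (t+1) ∧ dirD D d y x ∧ ((gi n t).2 = n (gi n t).1 → d = δ (gi n t).1) := by
    intro t
    by_cases hlt : (gi n t).2 < n (gi n t).1
    · obtain ⟨u, hu, v, hv, h1, h2, h3⟩ := hpE (gi n t).1 (gi n t).2 hlt
      obtain ⟨d, hd'⟩ := sy_dirD h3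
      refine ⟨u, v, d, mem_iUnion.2 ⟨_, hu⟩, mem_iUnion.2 ⟨_, hv⟩, h1, ?_, hd', fun h => absurd h (by omega)⟩
      simp only [r, gi_lt hlt]; exact h2
    · have he : (gi n t).2 = n (gi n t).1 := le_antisymm (hg t).1 (by omega)
      refine ⟨l (gi n t).1, c ((gi n t).1 + 1), δ (gi n t).1, mem_iUnion.2 ⟨_, hl _⟩,
        mem_iUnion.2 ⟨_, hc _⟩, ?_, ?_, hd _, fun _ => rfl⟩
      · simp only [r, he, hpn]
      · simp only [r, gi_ge hlt, hp0]
  choose y x d hyL hxL hyr hxr hdd hdl using step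
  have hend : ∀ N, ∃ t, t ≥ N ∧ gi n t = (N, n N) := by
    intro N
    obtain ⟨j, hj⟩ := gi_surj n N (n N) le_rfl
    have := (hg j).2
    rw [hj] at this
    exact ⟨j, this, hj⟩
  have hx' : ∀ t, rt nxt h ((fun t => Nat.casesOn t (y 0) x : ℕ → V) t) = r t := by
    intro t
    cases t with
    | zero => exact hyr 0
    | succ t => exact hxr t
  refine trees_AC F (fun t => Nat.casesOn t (y 0) x) y d ?_ hyL ?_ rfl ?_ hdd ?_ ?_
  · intro t
    cases t with
    | zero => exact hyL 0
    | succ t => exact hxL t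
  · intro t; rw [hx' t, hyr]
  · intro t t' he
    rw [hx' t, hx' t'] at he
    exact hrinj t t' he
  · intro N
    obtain ⟨k, hk, hδ⟩ := hT N
    obtain ⟨t, ht, hgt⟩ := hend k
    refine ⟨t, by omega, ?_⟩
    rw [hdl t (by rw [hgt]), hgt]; exact hδ
  · intro N
    obtain ⟨k, hk, hδ⟩ := hF N
    obtain ⟨t, ht, hgt⟩ := hend k
    refine ⟨t, by omega, ?_⟩
    rw [hdl t (by rw [hgt]), hgt]; exact hδ

theorem exists_cross {R : V → V → Prop} {x y : V} (h : ReflTransGen R x y) {K : Set V}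
    (hx : x ∈ K) (hy : y ∉ K) : ∃ u w, R u w ∧ u ∈ K ∧ w ∉ K := by
  induction h with
  | refl => exact absurd hx hy
  | @tail b c _ h1 ih =>
    by_cases hb : b ∈ K
    · exact ⟨b, c, h1, hb, hy⟩
    · exact ih hb

theorem exists_Seg {E : V → V → Prop} {C : Set V} {a b : V} (ha : a ∈ C)
    (h : ReflTransGen (rs E C) a b) : ∃ S ⊆ C, Seg E S a b := by
  obtain ⟨n, p, h0, hn, hE, hC, _⟩ := exists_path ha h
  refine ⟨p '' Icc 0 n, ?_, ?_⟩
  · rintro _ ⟨i, hi, rfl⟩; exact hC i hi.2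
  · have := Seg.ofPath (E := E) p 0 n (Nat.zero_le _) (fun j _ hj => hE j hj)
    rwa [h0, hn] at this

theorem Seg.conn {D : V → V → Prop} {S : Set V} {a b : V} (h : Seg (sy D) S a b) : conn D S :=
  fun x hx y hy => (rs_sy_symm (h.2.2.2 x hx).1).trans (h.2.2.2 y hy).1

theorem Seg.conn' {D : V → V → Prop} {S : Set V} {a b : V} (h : Seg D S a b) : _root_.conn D S :=
  Seg.conn (h.mono_rel (fun _ _ h => Or.inl h))

theorem Seg.slive {D : V → V → Prop} {B0 S : Set V} {a b : V} (h : Seg D S a b) (hb : b ∈ B0) :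
    _root_.slive D B0 S := fun x hx => ⟨b, hb, (h.2.2.2 x hx).2⟩

theorem slive.union {D : V → V → Prop} {B0 : Set V} {ι : Type*} {I : Set ι} {S : ι → Set V}
    (h : ∀ i ∈ I, slive D B0 (S i)) : slive D B0 (⋃ i ∈ I, S i) := by
  intro x hx
  simp only [mem_iUnion] at hx
  obtain ⟨i, hi, hx⟩ := hx
  obtain ⟨b, hb, hr⟩ := h i hi x hx
  exact ⟨b, hb, rs_mono (subset_biUnion_of_mem hi) hr⟩

theorem slive.union2 {D : V → V → Prop} {B0 A B : Set V} (hA : slive D B0 A) (hB : slive D B0 B) :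
    slive D B0 (A ∪ B) := by
  rintro x (hx | hx)
  · obtain ⟨b, hb, hr⟩ := hA x hx; exact ⟨b, hb, rs_mono subset_union_left hr⟩
  · obtain ⟨b, hb, hr⟩ := hB x hx; exact ⟨b, hb, rs_mono subset_union_right hr⟩

/-- connectedness through a connected core -/
theorem conn.core {D : V → V → Prop} {F M : Set V} (hF : conn D F) (hFM : F ⊆ M)
    (h : ∀ x ∈ M, ∃ y ∈ F, ReflTransGen (rs (sy D) M) x y) : conn D M := by
  intro x hx y hy
  obtain ⟨x', hx', h1⟩ := h x hx
  obtain ⟨y', hy', h2⟩ := h y hy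
  exact (h1.trans (rs_mono hFM (hF x' hx' y' hy'))).trans (rs_sy_symm h2)

theorem conn.star {D : V → V → Prop} {F : Set V} {ι : Type*} {I : Set ι} {S : ι → Set V}
    (hF : conn D F) (h : ∀ i ∈ I, conn D (S i) ∧ (S i ∩ F).Nonempty) :
    conn D (F ∪ ⋃ i ∈ I, S i) := by
  refine conn.core hF subset_union_left ?_
  rintro x (hx | hx)
  · exact ⟨x, hx, .refl⟩
  · simp only [mem_iUnion] at hx
    obtain ⟨i, hi, hx⟩ := hx
    obtain ⟨h1, y, hy1, hy2⟩ := h i hi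
    exact ⟨y, hy2, rs_mono ((subset_biUnion_of_mem (u := S) hi).trans subset_union_right) (h1 x hx y hy1)⟩

theorem conn.union2 {D : V → V → Prop} {A B : Set V} (hA : conn D A) (hB : conn D B) {a b : V}
    (ha : a ∈ A) (hb : b ∈ B) (h : sy D a b ∨ a = b) : conn D (A ∪ B) := by
  refine conn.core hA subset_union_left ?_
  rintro x (hx | hx)
  · exact ⟨x, hx, .refl⟩
  · refine ⟨a, ha, (rs_mono subset_union_right (hB x hx b hb)).trans ?_⟩
    rcases h with h | rfl
    · exact .single ⟨sy_symm h, Or.inr hb, Or.inl ha⟩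
    · exact .refl

theorem fin_conn {D : V → V → Prop} {C A : Set V} (hC : conn D C) (hA : A.Finite) (hAC : A ⊆ C) :
    ∃ F ⊆ C, F.Finite ∧ A ⊆ F ∧ conn D F := by
  induction A, hA using Set.Finite.induction_on with
  | empty => exact ⟨∅, by simp, by simp, by simp, fun x hx => absurd hx (by simp)⟩
  | @insert a s _ _ ih =>
    obtain ⟨F, h1, h2, h3, h4⟩ := ih ((subset_insert _ _).trans hAC)
    have ha : a ∈ C := hAC (mem_insert _ _)
    rcases F.eq_empty_or_nonempty with rfl | ⟨f, hf⟩
    · refine ⟨{a}, by simpa using ha, by simp, insert_subset (by simp) (h3.trans (by simp)), ?_⟩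
      rintro x rfl y rfl; exact .refl
    · obtain ⟨S, hS, hseg⟩ := exists_Seg ha (hC a ha f (h1 hf))
      refine ⟨F ∪ S, union_subset h1 hS, h2.union hseg.2.2.1,
        insert_subset (Or.inr hseg.1) (h3.trans subset_union_left), ?_⟩
      exact h4.union2 hseg.conn hf hseg.2.1 (Or.inr rfl)

theorem fin_cl {D : V → V → Prop} {B0 C A : Set V} (hC : conn D C) (hl : slive D B0 C)
    (hA : A.Finite) (hAC : A ⊆ C) :
    ∃ M ⊆ C, M.Finite ∧ A ⊆ M ∧ conn D M ∧ slive D B0 M := by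
  obtain ⟨F, h1, h2, h3, h4⟩ := fin_conn hC hA hAC
  have : ∀ x ∈ F, ∃ S ⊆ C, ∃ b ∈ B0, Seg D S x b := by
    intro x hx
    obtain ⟨b, hb, hr⟩ := hl x (h1 hx)
    obtain ⟨S, hS, hseg⟩ := exists_Seg (h1 hx) hr
    exact ⟨S, hS, b, hb, hseg⟩
  have hne : Nonempty (V → V) := ⟨id⟩
  choose! S hS b hb hseg using this
  have hFS : F ⊆ ⋃ x ∈ F, S x := fun x hx => mem_biUnion hx (hseg x hx).1
  refine ⟨⋃ x ∈ F, S x, iUnion₂_subset hS, h2.biUnion fun x hx => (hseg x hx).2.2.1,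
    h3.trans hFS, ?_, slive.union fun x hx => (hseg x hx).slive (hb x hx)⟩
  have := h4.star (I := F) (S := S) (fun x hx => ⟨(hseg x hx).conn', x, (hseg x hx).1, hx⟩)
  rwa [union_eq_self_of_subset_left hFS] at this

theorem comp_conn {D : V → V → Prop} {C : Set V} {v : V} : conn D (comp D C v) := by
  have key : ∀ x, ReflTransGen (rs (sy D) C) v x → v ∈ C → ReflTransGen (rs (sy D) (comp D C v)) v x := by
    intro x hx hv
    induction hx with
    | refl => exact .refl
    | tail h0 h1 ih => exact ih.tail ⟨h1.1, ⟨h1.2.1, h0⟩, ⟨h1.2.2, h0.tail h1⟩⟩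
  intro x hx y hy
  have hv : v ∈ C := rs_mem (rs_sy_symm hx.2) hx.1
  exact (rs_sy_symm (key x hx.2 hv)).trans (key y hy.2 hv)

theorem comp_slive {D : V → V → Prop} {B0 C : Set V} {v : V} :
    slive D B0 (comp D (live D B0 C) v) := by
  intro x hx
  obtain ⟨b, hb, hr⟩ := hx.1.2
  refine ⟨b, hb, ?_⟩
  induction hr using ReflTransGen.head_induction_on with
  | refl => exact .refl
  | head h1 h2 ih =>
    have hw := (⟨h1.2.2, b, hb, h2⟩ : _ ∈ live D B0 C)
    have hw2 : _ ∈ comp D (live D B0 C) v := ⟨hw, hx.2.tail ⟨Or.inl h1.1, hx.1, hw⟩⟩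
    exact (ih hw2).head ⟨h1.1, hx, hw2⟩

def lay (D : V → V → Prop) (B0 K U : Set V) : Set V := K \ live D B0 (K \ U)

theorem lay_sup {D : V → V → Prop} {B0 K U : Set V} (hU : U ⊆ K) : U ⊆ lay D B0 K U :=
  fun x hx => ⟨hU hx, fun h => h.1.2 hx⟩

theorem lay_reach {D : V → V → Prop} {B0 K U : Set V} (hK : slive D B0 K) :
    ∀ z ∈ lay D B0 K U, ∃ u ∈ U, ReflTransGen (rs D (lay D B0 K U)) z u := by
  intro z hz
  obtain ⟨b, hb, hr⟩ := hK z hz.1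
  induction hr using ReflTransGen.head_induction_on with
  | refl =>
    by_cases hU : b ∈ U
    · exact ⟨b, hU, .refl⟩
    · exact absurd ⟨⟨hz.1, hU⟩, b, hb, .refl⟩ hz.2
  | @head a c h1 h2 ih =>
    by_cases hU : a ∈ U
    · exact ⟨a, hU, .refl⟩
    · have hc : c ∈ lay D B0 K U := by
        refine ⟨h1.2.2, fun hc => hz.2 ⟨⟨hz.1, hU⟩, ?_⟩⟩
        obtain ⟨b', hb', hr'⟩ := hc.2
        exact ⟨b', hb', hr'.head ⟨h1.1, ⟨hz.1, hU⟩, hc.1⟩⟩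
      obtain ⟨u, hu, hr'⟩ := ih hc
      exact ⟨u, hu, hr'.head ⟨h1.1, hz, hc⟩⟩

theorem lay_conn {D : V → V → Prop} {B0 K U : Set V} (hK : slive D B0 K) (hUK : U ⊆ K)
    (hU : conn D U) : conn D (lay D B0 K U) := by
  refine conn.core hU (lay_sup hUK) ?_
  intro x hx
  obtain ⟨u, hu, hr⟩ := lay_reach (U := U) hK x hx
  exact ⟨u, hu, rs_mono_rel (fun _ _ h => Or.inl h) hr⟩

theorem lay_slive {D : V → V → Prop} {B0 K U : Set V} (hK : slive D B0 K) (hUK : U ⊆ K)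
    (hU : slive D B0 U) : slive D B0 (lay D B0 K U) := by
  intro x hx
  obtain ⟨u, hu, hr⟩ := lay_reach (U := U) hK x hx
  obtain ⟨b, hb, hr'⟩ := hU u hu
  exact ⟨b, hb, hr.trans (rs_mono (lay_sup hUK) hr')⟩

def Step (D : V → V → Prop) (B0 : Set V) (d : Bool) (s s' : Set V × V) : Prop :=
  ∃ L ⊆ s.1, conn D L ∧ slive D B0 L ∧ s.2 ∈ L ∧ s'.1 ⊆ s.1 \ L ∧ s'.2 ∈ s'.1 ∧
    ∃ l ∈ L, dirD D d l s'.2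

theorem Step.comp {D : V → V → Prop} {B0 : Set V} {d d' : Bool} {s s' s'' : Set V × V}
    (h : Step D B0 d s s') (h' : Step D B0 d' s' s'') : Step D B0 d' s s'' := by
  obtain ⟨L, h1, h2, h3, h4, h5, h6, l, h7, h8⟩ := h
  obtain ⟨L', g1, g2, g3, g4, g5, g6, l', g7, g8⟩ := h'
  refine ⟨L ∪ L', union_subset h1 (g1.trans (h5.trans sdiff_subset)),
    h2.union2 g2 h7 g4 (Or.inl (dirD_sy h8)), h3.union2 g3, Or.inl h4, ?_, g6, l', Or.inr g7, g8⟩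
  intro x hx
  have := g5 hx
  have h9 := h5 this.1
  exact ⟨h9.1, fun h => h.elim h9.2 this.2⟩

theorem alt_AC {D : V → V → Prop} {B0 : Set V} (𝒮 : Set (Set V × V)) (hne : 𝒮.Nonempty)
    (h : ∀ s ∈ 𝒮, ∀ d, ∃ s' ∈ 𝒮, Step D B0 d s s') : ContainsAltComb D B0 := by
  obtain ⟨s0, hs0⟩ := hne
  have hne : Nonempty (Set V × V) := ⟨s0⟩
  choose! nx hnx hst using h
  let δ : ℕ → Bool := fun n => decide (n % 2 = 0)
  let s : ℕ → Set V × V := fun n => Nat.rec s0 (fun n t => nx t (δ n)) n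
  have hs : ∀ n, s n ∈ 𝒮 := by
    intro n
    induction n with
    | zero => exact hs0
    | succ n ih => exact hnx _ ih _
  have hstep : ∀ n, Step D B0 (δ n) (s n) (s (n+1)) := fun n => hst _ (hs n) _
  choose L h1 h2 h3 h4 h5 h6 l h7 h8 using hstep
  have hanti : Antitone (fun n => (s n).1) := antitone_nat_of_succ_le fun n => (h5 n).trans sdiff_subset
  have hlt : ∀ i j x, i < j → x ∈ L i → x ∉ L j := by
    intro i j x hij hx hx'
    have := hanti (show i + 1 ≤ j from hij) (h1 j hx')
    exact (h5 i this).2 hx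
  refine layers_AC L (fun n => (s n).2) l δ ?_ h3 h2 h4 h7 h8 ?_ ?_
  · intro i j x hi hj
    by_contra hc
    rcases Nat.lt_or_gt_of_ne hc with h | h
    · exact hlt i j x h hi hj
    · exact hlt j i x h hj hi
  · intro N; exact ⟨2 * N, by omega, by simp [δ]⟩
  · intro N; exact ⟨2 * N + 1, by omega, by simp [δ]⟩

theorem step_lay {D : V → V → Prop} {B0 K U : Set V} {c x u w : V} {d : Bool} (hK : slive D B0 K)
    (hUK : U ⊆ K) (hU : conn D U) (hUl : slive D B0 U) (hc : c ∈ U)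
    (hu : u ∈ comp D (live D B0 (K \ U)) x) (hw : w ∈ K) (hw' : w ∉ comp D (live D B0 (K \ U)) x)
    (h : dirD D d w u) : Step D B0 d (K, c) (comp D (live D B0 (K \ U)) x, u) := by
  refine ⟨lay D B0 K U, sdiff_subset, lay_conn hK hUK hU, lay_slive hK hUK hUl, lay_sup hUK hc, ?_,
    hu, w, ⟨hw, ?_⟩, h⟩
  · intro y hy
    exact ⟨hy.1.1.1, fun hz => hz.2 hy.1⟩
  · intro hl
    exact hw' ⟨hl, hu.2.tail ⟨sy_symm (dirD_sy h), hu.1, hl⟩⟩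

theorem conn_sub_comp {D : V → V → Prop} {C S : Set V} {v x : V} (hS : conn D S) (hSC : S ⊆ C)
    (hx : x ∈ S) (hxv : x ∈ comp D C v) : S ⊆ comp D C v :=
  fun y hy => ⟨hSC hy, hxv.2.trans (rs_mono hSC (hS x hx y hy))⟩

theorem slive_sub_live {D : V → V → Prop} {B0 C S : Set V} (hS : slive D B0 S) (hSC : S ⊆ C) :
    S ⊆ live D B0 C := by
  intro x hx
  obtain ⟨b, hb, hr⟩ := hS x hx
  exact ⟨hSC hx, b, hb, rs_mono hSC hr⟩

theorem hotel_core {D : V → V → Prop} {B0 : Set V} (π : ℕ → Set V) (s t : ℕ → V)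
    (hseg : ∀ k, Seg D (π k) (s k) (t k)) (ht : ∀ k, t k ∈ B0)
    (h1 : ∀ k, k % 2 = 0 → t k ∈ π (k+1)) (h2 : ∀ k, k % 2 = 1 → s k ∈ π (k+1))
    (hdis : ∀ j k x, j % 2 = k % 2 → x ∈ π j → x ∈ π k → j = k) : ContainsAltComb D B0 := by
  classical
  have hpc : ∀ k, conn D (π k) := fun k => (hseg k).conn'
  have hpl : ∀ k, slive D B0 (π k) := fun k => (hseg k).slive (ht k)
  have hshare : ∀ k, ∃ x, x ∈ π k ∧ x ∈ π (k+1) := by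
    intro k
    rcases Nat.mod_two_eq_zero_or_one k with h | h
    · exact ⟨t k, (hseg k).2.1, h1 k h⟩
    · exact ⟨s k, (hseg k).1, h2 k h⟩
  have hfinmeet : ∀ M : Set V, M.Finite → {k | (π k ∩ M).Nonempty}.Finite := by
    intro M hM
    have : {k | (π k ∩ M).Nonempty} ⊆ ⋃ x ∈ M, ⋃ e ∈ ({0, 1} : Set ℕ), {k | k % 2 = e ∧ x ∈ π k} := by
      rintro k ⟨x, hx, hxM⟩
      simp only [mem_iUnion]
      refine ⟨x, hxM, k % 2, ?_, rfl, hx⟩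
      rcases Nat.mod_two_eq_zero_or_one k with h | h <;> simp [h]
    refine Set.Finite.subset (hM.biUnion fun x _ => Set.Finite.biUnion (by simp) fun e _ => ?_) this
    apply Set.Subsingleton.finite
    rintro j ⟨hj, hj'⟩ k ⟨hk, hk'⟩
    exact hdis j k x (hj.trans hk.symm) hj' hk'
  have htail : ∀ (C : Set V) (x : V) (N : ℕ), x ∈ π N → (∀ k ≥ N, π k ⊆ live D B0 C) → 
      ∀ k ≥ N, π k ⊆ comp D (live D B0 C) x := by
    intro C x N hx hk k hkN
    induction k, hkN using Nat.le_induction with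
    | base => exact conn_sub_comp (hpc N) (hk N le_rfl) hx (mem_comp (hk N le_rfl hx))
    | succ k hkN ih =>
      obtain ⟨y, hy, hy'⟩ := hshare k
      exact conn_sub_comp (hpc _) (hk _ (by omega)) hy' (ih hy)
  let 𝒮 : Set (Set V × V) := {p | conn D p.1 ∧ slive D B0 p.1 ∧ p.2 ∈ p.1 ∧ ∃ N, ∀ k ≥ N, π k ⊆ p.1}
  refine alt_AC 𝒮 ⟨(comp D (live D B0 univ) (s 0), s 0), comp_conn, comp_slive, mem_comp ?_, 0, ?_⟩ ?_
  · exact slive_sub_live (hpl 0) (subset_univ _) (hseg 0).1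
  · exact htail univ _ 0 (hseg 0).1 (fun k _ => slive_sub_live (hpl k) (subset_univ _))
  rintro ⟨C, c⟩ ⟨hCc, hCl, hcC, k0, hk0⟩ d
  simp only at hCc hCl hcC hk0
  obtain ⟨e, he⟩ : ∃ e : ℕ, e = if d then 1 else 0 := ⟨_, rfl⟩
  obtain ⟨M, hMC, hMf, hAM, hMc, hMl⟩ := fin_cl (A := insert c (π k0)) hCc hCl
    ((hseg k0).2.2.1.insert c) (insert_subset hcC (hk0 k0 le_rfl))
  let J : Set ℕ := {k | k0 ≤ k ∧ k % 2 = e ∧ (π k ∩ M).Nonempty}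
  have hJ : J.Finite := (hfinmeet M hMf).subset fun k hk => hk.2.2
  obtain ⟨L, hL⟩ : ∃ L, L = M ∪ ⋃ k ∈ J, π k := ⟨_, rfl⟩
  have hLc : conn D L := hL ▸ hMc.star fun k hk => ⟨hpc k, hk.2.2⟩
  have hLl : slive D B0 L := hL ▸ hMl.union2 (slive.union fun k _ => hpl k)
  have hLf : L.Finite := hL ▸ hMf.union (hJ.biUnion fun k _ => (hseg k).2.2.1)
  have hLC : L ⊆ C := hL ▸ union_subset hMC (iUnion₂_subset fun k hk => hk0 k hk.1)
  have hML : M ⊆ L := hL ▸ subset_union_left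
  obtain ⟨N, hN⟩ := (hfinmeet L hLf).bddAbove
  have hN' : ∀ k ≥ max k0 (N+1), π k ⊆ live D B0 (C \ L) := by
    intro k hk
    refine slive_sub_live (hpl k) fun x hx => ⟨hk0 k ((le_max_left _ _).trans hk) hx, fun hxL => ?_⟩
    have := hN (show k ∈ {k | (π k ∩ L).Nonempty} from ⟨x, hx, hxL⟩)
    omega
  obtain ⟨x, hx⟩ : ∃ x, x ∈ π (max k0 (N+1)) := ⟨_, (hseg _).1⟩
  have hC' := htail (C \ L) x _ hx hN'
  set C' := comp D (live D B0 (C \ L)) x with hC'd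
  have hC'L : ∀ y ∈ C', y ∉ L := fun y hy => hy.1.1.2
  let P : Set ℕ := {n | ∀ k ≥ n, π k ⊆ C'}
  have hP : sInf P ∈ P := Nat.sInf_mem ⟨_, hC'⟩
  have hgt : k0 < sInf P := by
    by_contra hc
    exact hC'L _ (hP k0 (by omega) (hseg k0).1) (hML (hAM (mem_insert_of_mem _ (hseg k0).1)))
  obtain ⟨k, hk⟩ : ∃ k, sInf P = k + 1 := ⟨sInf P - 1, by omega⟩
  have hk1 : π (k+1) ⊆ C' := hP (k+1) (by omega)
  have hkn : ¬ π k ⊆ C' := by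
    intro hc
    have : k ∈ P := by
      intro j hj
      rcases hj.eq_or_lt with rfl | hj
      · exact hc
      · exact hP j (by omega)
    have := Nat.sInf_le this
    omega
  have hkC : π k ⊆ C := hk0 k (by omega)
  obtain ⟨z, hz, hz'⟩ := hshare k
  have hke : k % 2 ≠ e := by
    intro hke
    have hM : ¬ (π k ∩ M).Nonempty := by
      intro hm
      refine hC'L z (hk1 hz') ?_
      rw [hL]
      exact Or.inr (mem_biUnion (show k ∈ J from ⟨by omega, hke, hm⟩) hz)
    have hd : π k ⊆ C \ L := by
      refine fun y hy => ⟨hkC hy, fun hyL => ?_⟩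
      rw [hL] at hyL
      rcases hyL with hyL | hyL
      · exact hM ⟨y, hy, hyL⟩
      · simp only [mem_iUnion] at hyL
        obtain ⟨j, hj, hyj⟩ := hyL
        have := hdis j k y (hj.2.1.trans hke.symm) hyj hy
        exact hM (this ▸ hj.2.2)
    exact hkn (conn_sub_comp (hpc k) (slive_sub_live (hpl k) hd) hz (hk1 hz'))
  have hcL : c ∈ L := hML (hAM (mem_insert _ _))
  obtain ⟨y, hy, hyC'⟩ := not_subset.1 hkn
  have main : ∃ u w, u ∈ C' ∧ w ∈ C ∧ w ∉ C' ∧ dirD D d w u := by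
    cases d with
    | false =>
      simp only [Bool.false_eq_true, if_false] at he
      have hs : s k ∈ C' := hk1 (h2 k (by omega))
      obtain ⟨u, w, huw, hu, hw⟩ := exists_cross ((hseg k).2.2.2 y hy).1 hs hyC'
      exact ⟨u, w, hu, hkC huw.2.2, hw, by simpa [dirD] using huw.1⟩
    | true =>
      simp only [if_true] at he
      have hs : t k ∈ C' := hk1 (h1 k (by omega))
      obtain ⟨u, w, huw, hu, hw⟩ := exists_cross (K := C'ᶜ) ((hseg k).2.2.2 y hy).2 hyC' (by simpa using hs)
      exact ⟨w, u, by simpa using hw, hkC huw.2.1, hu, by simpa [dirD] using huw.1⟩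
  obtain ⟨u, w, hu, hw, hw', hd⟩ := main
  exact ⟨(C', u), ⟨comp_conn, comp_slive, hu, _, hC'⟩,
    step_lay hCl hLC hLc hLl hcL hu hw hw' hd⟩

theorem hotel {D : V → V → Prop} {B0 : Set V} (hAC : ¬ ContainsAltComb D B0) : NH D univ univ B0 := by
  rintro ⟨a, b, Q, R, h, hQ, hR⟩
  apply hAC
  refine hotel_core (fun k => if k % 2 = 0 then Q (k/2) else R (k/2))
    (fun k => if k % 2 = 0 then a (k/2) else a (k/2+1)) (fun k => b (k/2)) ?_ (fun k => (h _).2.1) ?_ ?_ ?_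
  · intro k
    by_cases hk : k % 2 = 0
    · simpa [hk] using (h (k/2)).2.2.2.2.1
    · simpa [hk] using (h (k/2)).2.2.2.2.2
  · intro k hk
    have e1 : (k+1) % 2 = 1 := by omega
    have e2 : (k+1)/2 = k/2 := by omega
    simpa [e1, e2] using (h (k/2)).2.2.2.2.2.2.1
  · intro k hk
    have e1 : (k+1) % 2 = 0 := by omega
    have e2 : (k+1)/2 = k/2+1 := by omega
    simpa [e1, e2, hk] using (h (k/2+1)).2.2.2.2.1.1
  · intro j k x hjk hj hk
    by_cases hk0 : k % 2 = 0
    · have hj0 : j % 2 = 0 := by omega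
      simp only [hk0, hj0, if_true] at hj hk
      have := hQ _ _ x hj hk
      omega
    · have hj0 : ¬ j % 2 = 0 := by omega
      simp only [hk0, hj0, if_false] at hj hk
      have := hR _ _ x hj hk
      omega

theorem dirD_not {D : V → V → Prop} {d : Bool} {x y : V} : dirD D (!d) x y ↔ dirD D d y x := by
  cases d <;> simp [dirD]

theorem layers_AC2 {D : V → V → Prop} {B0 : Set V} (d : Bool) (Z : ℕ → Set V)
    (hdisj : ∀ i j x, x ∈ Z i → x ∈ Z j → i = j) (hl : ∀ i, slive D B0 (Z i))
    (hc : ∀ i, conn D (Z i)) (he : ∀ i j, i < j → ∃ x ∈ Z i, ∃ y ∈ Z j, dirD D d x y) :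
    ContainsAltComb D B0 := by
  let σ : ℕ → ℕ := fun i => if i = 0 then 0 else if i % 2 = 1 then i + 1 else i - 1
  let δ : ℕ → Bool := fun i => if i % 2 = 0 then d else !d
  have hσ : ∀ i j, σ i = σ j → i = j := by
    intro i j h
    simp only [σ] at h
    split_ifs at h <;> omega
  have hedge : ∀ i, ∃ x ∈ Z (σ i), ∃ y ∈ Z (σ (i+1)), dirD D (δ i) x y := by
    intro i
    by_cases hi : i % 2 = 0
    · have : δ i = d := by simp [δ, hi]
      rw [this]
      have hlt : σ i < σ (i+1) := by
        have e2 : σ (i+1) = i + 2 := by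
          have : (i+1) % 2 = 1 := by omega
          simp [σ, this]
        have e1 : σ i ≤ i := by
          by_cases h0 : i = 0
          · simp [σ, h0]
          · simp [σ, h0, hi]
        omega
      exact he _ _ hlt
    · have : δ i = !d := by simp [δ, hi]
      rw [this]
      obtain ⟨x, hx, y, hy, h⟩ := he (σ (i+1)) (σ i) (by simp only [σ]; split_ifs <;> omega)
      exact ⟨y, hy, x, hx, dirD_not.2 h⟩
  choose l hl1 c' hc' hd using hedge
  have hδ : ∀ e : Bool, ∀ N, ∃ t ≥ N, δ t = e := by
    intro e N
    by_cases h : e = d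
    · exact ⟨2 * N, by omega, by simp [δ, h]⟩
    · refine ⟨2 * N + 1, by omega, ?_⟩
      have : (2 * N + 1) % 2 = 1 := by omega
      cases e <;> cases d <;> simp_all [δ]
  refine layers_AC (fun i => Z (σ i)) (fun i => Nat.casesOn i (l 0) c') l δ
    (fun i j x hi hj => hσ _ _ (hdisj _ _ x hi hj)) (fun i => hl _) (fun i => hc _) ?_ hl1 hd
    (hδ true) (hδ false)
  intro i
  cases i with
  | zero => exact hl1 0
  | succ i => exact hc' i

def USpec (D : V → V → Prop) (B0 : Set V) (H : List (Set V)) (K U : Set V) : Prop :=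
  U ⊆ K ∧ U.Finite ∧ conn D U ∧ slive D B0 U ∧ ∀ N ∈ H, (N ∩ K).Nonempty → (N ∩ U).Nonempty

noncomputable def Uf (D : V → V → Prop) (B0 : Set V) (H : List (Set V)) (K : Set V) : Set V :=
  Classical.epsilon (USpec D B0 H K)

theorem Uf_spec {D : V → V → Prop} {B0 : Set V} (H : List (Set V)) {K : Set V} (hc : conn D K)
    (hl : slive D B0 K) : USpec D B0 H K (Uf D B0 H K) := by
  classical
  apply Classical.epsilon_spec (p := USpec D B0 H K)
  have : ∃ A ⊆ K, A.Finite ∧ ∀ N ∈ H, (N ∩ K).Nonempty → (N ∩ A).Nonempty := by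
    induction H with
    | nil => exact ⟨∅, by simp, by simp, by simp⟩
    | cons N H ih =>
      obtain ⟨A, h1, h2, h3⟩ := ih
      by_cases hN : (N ∩ K).Nonempty
      · obtain ⟨x, hx, hxK⟩ := hN
        refine ⟨insert x A, insert_subset hxK h1, h2.insert x, ?_⟩
        intro M hM hMK
        rcases List.mem_cons.1 hM with rfl | hM
        · exact ⟨x, hx, mem_insert _ _⟩
        · obtain ⟨y, hy, hy'⟩ := h3 M hM hMK
          exact ⟨y, hy, Or.inr hy'⟩
      · refine ⟨A, h1, h2, ?_⟩
        intro M hM hMK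
        rcases List.mem_cons.1 hM with rfl | hM
        · exact absurd hMK hN
        · exact h3 M hM hMK
  obtain ⟨A, h1, h2, h3⟩ := this
  obtain ⟨M, g1, g2, g3, g4, g5⟩ := fin_cl hc hl h2 h1
  refine ⟨M, g1, g2, g4, g5, fun N hN hNK => ?_⟩
  obtain ⟨y, hy, hy'⟩ := h3 N hN hNK
  exact ⟨y, hy, g3 hy'⟩

noncomputable def tst (D : V → V → Prop) (B0 : Set V) (d : Bool) (C : Set V) (c : V) :
    ℕ → V → List (Set V) × Set V
  | 0, _ => ([{c}], C)
  | n+1, v => 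
    ({w | ∃ z ∈ lay D B0 (tst D B0 d C c n v).2 (Uf D B0 (tst D B0 d C c n v).1 (tst D B0 d C c n v).2),
        dirD D d z w} :: (tst D B0 d C c n v).1,
     {w | w ∈ comp D (live D B0 ((tst D B0 d C c n v).2 \
        Uf D B0 (tst D B0 d C c n v).1 (tst D B0 d C c n v).2)) v ∧
        ¬ Good D B0 (comp D (live D B0 ((tst D B0 d C c n v).2 \
        Uf D B0 (tst D B0 d C c n v).1 (tst D B0 d C c n v).2)) v)})

def Bst (D : V → V → Prop) (B0 : Set V) : Set (Set V × V) :=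
  {s | conn D s.1 ∧ slive D B0 s.1 ∧ s.2 ∈ s.1 ∧ ¬ Good D B0 s.1}

theorem Good.empty {D : V → V → Prop} {B0 : Set V} : Good D B0 ∅ := by
  intro X
  refine ⟨∅, empty_subset _, ?_, ?_⟩
  · rw [LkI.iff]
    exact ⟨fun _ => ∅, id, by simp⟩
  · intro A' _ _ h
    exact subset_empty_iff.1 h.subset

/-- All facts about the tree decomposition. -/
structure TreeF (D : V → V → Prop) (B0 : Set V) (d : Bool) (C : Set V) (W : ℕ → Set V)
    (K U : ℕ → V → Set V) : Prop where
  W0 : W 0 = C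
  K0 : ∀ v, K 0 v = C
  W_iff : ∀ n v, v ∈ W n ↔ v ∈ K n v
  anti : ∀ n v, K (n+1) v ⊆ K n v
  Keq : ∀ n v, ∀ w ∈ K n v, v ∈ W n → K n w = K n v ∧ U n w = U n v
  Kc : ∀ n v, v ∈ W n → conn D (K n v)
  Kl : ∀ n v, v ∈ W n → slive D B0 (K n v)
  Kbad : ∀ n v, v ∈ W n → ¬ Good D B0 (K n v)
  Ksucc : ∀ n v, v ∈ W (n+1) → K (n+1) v = comp D (live D B0 (K n v \ U n v)) v
  Wsucc : ∀ n v, v ∈ W n → v ∈ live D B0 (K n v \ U n v) →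
    ¬ Good D B0 (comp D (live D B0 (K n v \ U n v)) v) → v ∈ W (n+1)
  UK : ∀ n v, v ∈ W n → U n v ⊆ K n v
  Uf : ∀ n v, v ∈ W n → (U n v).Finite
  Uc : ∀ n v, v ∈ W n → conn D (U n v)
  Ul : ∀ n v, v ∈ W n → slive D B0 (U n v)
  Une : ∀ n v, v ∈ W n → (U n v).Nonempty
  noedge : ∀ n v, v ∈ W (n+1) → ∀ z ∈ K n v, z ∉ K (n+1) v → ∀ u ∈ K (n+1) v, ¬ dirD D (!d) z u
  hit : ∀ m n v, v ∈ W n → m < n → (∃ x ∈ K n v, ∃ z ∈ lay D B0 (K m v) (U m v), dirD D d z x) →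
    ∃ x ∈ U n v, ∃ z ∈ lay D B0 (K m v) (U m v), dirD D d z x

theorem exists_tree {D : V → V → Prop} {B0 : Set V} {d : Bool} {C : Set V} {c : V}
    (hC : (C, c) ∈ Bst D B0) (hno : ∀ s' ∈ Bst D B0, ¬ Step D B0 (!d) (C, c) s') :
    ∃ W K U, TreeF D B0 d C W K U := by
  obtain ⟨hCc, hCl, hcC, hCb⟩ := hC
  simp only at hCc hCl hcC hCb
  let S := tst D B0 d C c
  let K : ℕ → V → Set V := fun n v => (S n v).2
  let U : ℕ → V → Set V := fun n v => Uf D B0 (S n v).1 (S n v).2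
  let G : ℕ → V → Set V := fun n v => comp D (live D B0 (K n v \ U n v)) v
  have hK0 : ∀ v, K 0 v = C := fun v => rfl
  have hKs : ∀ n v w, w ∈ K (n+1) v ↔ w ∈ G n v ∧ ¬ Good D B0 (G n v) := fun n v w => Iff.rfl
  have hHs : ∀ n v, (S (n+1) v).1 = {w | ∃ z ∈ lay D B0 (K n v) (U n v), dirD D d z w} :: (S n v).1 :=
    fun n v => rfl
  have hGK : ∀ n v, G n v ⊆ K n v := fun n v w hw => hw.1.1.1
  have hanti : ∀ n v, K (n+1) v ⊆ K n v := fun n v w hw => hGK n v ((hKs n v w).1 hw).1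
  have hmem : ∀ n v w, w ∈ K (n+1) v → v ∈ K (n+1) v := by
    intro n v w hw
    rw [hKs] at hw ⊢
    exact ⟨mem_comp (rs_mem (rs_sy_symm hw.1.2) hw.1.1), hw.2⟩
  have hKeq1 : ∀ n v, v ∈ K (n+1) v → K (n+1) v = G n v := by
    intro n v hv
    ext w
    rw [hKs]
    exact ⟨fun h => h.1, fun h => ⟨h, ((hKs n v v).1 hv).2⟩⟩
  have hSeq : ∀ n v w, w ∈ K n v → S n w = S n v := by
    intro n
    induction n with
    | zero => intro v w _; rfl
    | succ n ih =>
      intro v w hw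
      have h1 := ih v w (hanti n v hw)
      have h2 := comp_eq ((hKs n v w).1 hw).1
      show tst D B0 d C c (n+1) w = tst D B0 d C c (n+1) v
      simp only [tst]
      rw [show tst D B0 d C c n w = tst D B0 d C c n v from h1]
      simp only [G, K, U, S] at h2
      rw [h2]
  have hcl : ∀ n v, v ∈ K n v → conn D (K n v) ∧ slive D B0 (K n v) ∧ ¬ Good D B0 (K n v) := by
    intro n v hv
    cases n with
    | zero => exact ⟨hCc, hCl, hCb⟩
    | succ n =>
      rw [hKeq1 n v hv]
      exact ⟨comp_conn, comp_slive, ((hKs n v v).1 hv).2⟩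
  have hUs : ∀ n v, v ∈ K n v → USpec D B0 (S n v).1 (K n v) (U n v) :=
    fun n v hv => Uf_spec _ (hcl n v hv).1 (hcl n v hv).2.1
  have hKne : ∀ n v, v ∈ K (n+1) v → v ∈ K n v := fun n v hv => hanti n v hv
  -- invariant
  have hinv : ∀ n v, v ∈ K n v → ∃ N ∈ (S n v).1, (N ∩ K n v).Nonempty ∧
      ∀ k ∈ N ∩ K n v, ∀ s' ∈ Bst D B0, ¬ Step D B0 (!d) (K n v, k) s' := by
    intro n
    induction n with
    | zero =>
      intro v hv
      refine ⟨{c}, List.mem_singleton.2 rfl, ⟨c, rfl, hcC⟩, ?_⟩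
      rintro k ⟨rfl, _⟩
      exact hno
    | succ n ih =>
      intro v hv
      have hv0 := hKne n v hv
      obtain ⟨N, hN, hNK, hNo⟩ := ih v hv0
      have hu := hUs n v hv0
      obtain ⟨k, hkN, hkU⟩ := hu.2.2.2.2 N hN hNK
      have hk : k ∈ N ∩ K n v := ⟨hkN, hu.1 hkU⟩
      have hKe := hKeq1 n v hv
      have hb := hcl _ v hv
      refine ⟨{w | ∃ z ∈ lay D B0 (K n v) (U n v), dirD D d z w}, by rw [hHs]; simp, ?_, ?_⟩
      · have hkK : k ∉ K (n+1) v := by rw [hKe]; exact fun h => h.1.1.2 hkU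
        obtain ⟨u, w, huw, hu1, hw1⟩ := exists_cross ((hcl n v hv0).1 v hv0 k hk.2) hv hkK
        refine ⟨u, ?_, hu1⟩
        have hw2 : w ∈ lay D B0 (K n v) (U n v) := by
          refine ⟨huw.2.2, fun hl => hw1 ?_⟩
          rw [hKe] at hu1 ⊢
          exact ⟨hl, hu1.2.tail ⟨huw.1, hu1.1, hl⟩⟩
        refine ⟨w, hw2, ?_⟩
        obtain ⟨e, he⟩ := sy_dirD (sy_symm huw.1)
        by_cases hed : e = d
        · exact hed ▸ he
        · exfalso
          have hed' : e = !d := by cases e <;> cases d <;> simp_all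
          subst hed'
          have hu1' := hu1
          rw [hKe] at hu1 hw1
          refine hNo k hk (G n v, u) ⟨comp_conn, comp_slive, hu1, ?_⟩
            (step_lay (hcl n v hv0).2.1 hu.1 hu.2.2.1 hu.2.2.2.1 hkU hu1 huw.2.2 hw1 he)
          rw [hKe] at hb; exact hb.2.2
      · rintro k' ⟨⟨z, hz, hzk⟩, hk'⟩ s' hs' hst
        rw [hKe] at hk'
        have hz1 : z ∉ G n v := fun h => hz.2 h.1
        have h1 : Step D B0 d (K n v, k) (G n v, k') :=
          step_lay (hcl n v hv0).2.1 hu.1 hu.2.2.1 hu.2.2.2.1 hkU hk' hz.1 hz1 hzk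
        rw [hKe] at hst
        exact hNo k hk s' hs' (h1.comp hst)
  refine ⟨fun n => {v | v ∈ K n v}, K, U, ?_⟩
  constructor
  · ext v; exact Iff.rfl
  · exact hK0
  · intro n v; exact Iff.rfl
  · exact hanti
  · intro n v w hw _
    have := hSeq n v w hw
    simp only [K, U, this, and_self]
  · exact fun n v hv => (hcl n v hv).1
  · exact fun n v hv => (hcl n v hv).2.1
  · exact fun n v hv => (hcl n v hv).2.2
  · exact fun n v hv => hKeq1 n v hv
  · intro n v _ h1 h2
    exact (hKs n v v).2 ⟨mem_comp h1, h2⟩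
  · exact fun n v hv => (hUs n v hv).1
  · exact fun n v hv => (hUs n v hv).2.1
  · exact fun n v hv => (hUs n v hv).2.2.1
  · exact fun n v hv => (hUs n v hv).2.2.2.1
  · intro n v hv
    obtain ⟨N, hN, hNK, _⟩ := hinv n v hv
    exact ((hUs n v hv).2.2.2.2 N hN hNK).mono inter_subset_right
  · intro n v hv z hz hzK u hu hd
    have hv0 := hKne n v hv
    obtain ⟨N, hN, hNK, hNo⟩ := hinv n v hv0
    have hU := hUs n v hv0
    obtain ⟨k, hkN, hkU⟩ := hU.2.2.2.2 N hN hNK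
    have hb := hcl (n+1) v hv
    rw [hKeq1 n v hv] at hu hzK hb
    exact hNo k ⟨hkN, hU.1 hkU⟩ (G n v, u) ⟨hb.1, hb.2.1, hu, hb.2.2⟩
      (step_lay (hcl n v hv0).2.1 hU.1 hU.2.2.1 hU.2.2.2.1 hkU hu hz hzK hd)
  · intro m n v hv hmn ⟨x, hx, hxz⟩
    have hmemH : ∀ n, m < n → {w | ∃ z ∈ lay D B0 (K m v) (U m v), dirD D d z w} ∈ (S n v).1 := by
      intro n hn
      induction n, hn using Nat.le_induction with
      | base => rw [hHs]; simp
      | succ n hn ih => rw [hHs]; exact List.mem_cons_of_mem _ ih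
    obtain ⟨y, hy, hy'⟩ := (hUs n v hv).2.2.2.2 _ (hmemH n hmn) ⟨x, hxz, hx⟩
    exact ⟨y, hy', hy⟩

theorem TreeF.Wanti {D : V → V → Prop} {B0 : Set V} {d : Bool} {C : Set V} {W : ℕ → Set V}
    {K U : ℕ → V → Set V} (T : TreeF D B0 d C W K U) : Antitone W :=
  antitone_nat_of_succ_le fun n v hv => (T.W_iff n v).2 (T.anti n v ((T.W_iff _ v).1 hv))

theorem TreeF.Kanti {D : V → V → Prop} {B0 : Set V} {d : Bool} {C : Set V} {W : ℕ → Set V}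
    {K U : ℕ → V → Set V} (T : TreeF D B0 d C W K U) (v : V) : Antitone (fun n => K n v) :=
  antitone_nat_of_succ_le fun n => T.anti n v

theorem TreeF.KW {D : V → V → Prop} {B0 : Set V} {d : Bool} {C : Set V} {W : ℕ → Set V}
    {K U : ℕ → V → Set V} (T : TreeF D B0 d C W K U) {n : ℕ} {v : V} (hv : v ∈ W n) :
    K n v ⊆ W n := by
  intro w hw
  rw [T.W_iff, (T.Keq n v w hw hv).1]
  exact hw

/-- adjacency of vertices at the same level -/
theorem TreeF.Kadj {D : V → V → Prop} {B0 : Set V} {d : Bool} {C : Set V} {W : ℕ → Set V}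
    {K U : ℕ → V → Set V} (T : TreeF D B0 d C W K U) : ∀ {n : ℕ} {v w : V}, v ∈ W n → w ∈ W n → 
    sy D v w → K n w = K n v := by
  intro n
  induction n with
  | zero => intro v w _ _ _; rw [T.K0, T.K0]
  | succ n ih =>
    intro v w hv hw h
    have hv0 := T.Wanti (Nat.le_succ n) hv
    have hw0 := T.Wanti (Nat.le_succ n) hw
    have e := ih hv0 hw0 h
    have hwK : w ∈ K n v := e ▸ (T.W_iff n w).1 hw0
    have e2 := T.Keq n v w hwK hv0
    have h1 := (T.W_iff _ v).1 hv
    have h2 := (T.W_iff _ w).1 hw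
    rw [T.Ksucc n v hv] at h1 ⊢
    rw [T.Ksucc n w hw] at h2 ⊢
    rw [e2.1, e2.2] at h2 ⊢
    exact comp_adj h1.1 h2.1 h

/-- a vertex dropping out next to a surviving one -/
theorem TreeF.drop {D : V → V → Prop} {B0 : Set V} {d : Bool} {C : Set V} {W : ℕ → Set V}
    {K U : ℕ → V → Set V} (T : TreeF D B0 d C W K U) {n m : ℕ} {w x : V} (hnm : n ≤ m)
    (hx : x ∈ K n w) (hx' : x ∉ K m w) : ∃ k, n ≤ k ∧ k < m ∧ x ∈ K k w ∧ x ∉ K (k+1) w := by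
  induction m, hnm using Nat.le_induction with
  | base => exact absurd hx hx'
  | succ m hm ih =>
    by_cases h : x ∈ K m w
    · exact ⟨m, hm, by omega, h, hx'⟩
    · obtain ⟨k, h1, h2, h3⟩ := ih h
      exact ⟨k, h1, by omega, h3⟩

theorem TreeF.out {D : V → V → Prop} {B0 : Set V} {d : Bool} {C : Set V} {W : ℕ → Set V}
    {K U : ℕ → V → Set V} (T : TreeF D B0 d C W K U) {m : ℕ} {v w : V} (hv : v ∈ C)
    (hvm : v ∉ W m) (h : dirD D (!d) v w) : w ∉ W m := by
  intro hw
  obtain ⟨k, _, hk, h1, h2⟩ := T.drop (n := 0) (m := m) (w := w) (x := v) (Nat.zero_le _)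
    (by rw [T.K0]; exact hv) (fun h => hvm (T.KW hw h))
  have hwk : w ∈ W (k+1) := T.Wanti (show k + 1 ≤ m from hk) hw
  exact T.noedge k w hwk v h1 h2 w ((T.W_iff _ _).1 hwk) h

theorem TreeF.exhaust {D : V → V → Prop} {B0 : Set V} {d : Bool} {C : Set V} {W : ℕ → Set V}
    {K U : ℕ → V → Set V} (T : TreeF D B0 d C W K U) (hAC : ¬ ContainsAltComb D B0) (v : V) :
    ∃ n, v ∉ W n := by
  by_contra hc
  push Not at hc
  let Z : ℕ → Set V := fun n => lay D B0 (K n v) (U n v)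
  have hKs : ∀ n, K (n+1) v = comp D (live D B0 (K n v \ U n v)) v := fun n => T.Ksucc n v (hc _)
  have hvK : ∀ n, v ∈ K n v := fun n => (T.W_iff n v).1 (hc n)
  have hUZ : ∀ n, U n v ⊆ Z n := fun n => lay_sup (T.UK n v (hc n))
  have hZK : ∀ n, ∀ x ∈ Z n, x ∈ K n v ∧ x ∉ K (n+1) v := by
    intro n x hx
    refine ⟨hx.1, ?_⟩
    rw [hKs]
    exact fun h => hx.2 h.1
  have hpers : ∀ n, ∃ m > n, ∀ j > m, ∃ x ∈ Z m, ∃ y ∈ Z j, dirD D d x y := by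
    intro n0
    obtain ⟨n, hn⟩ : ∃ n, n = n0 + 1 := ⟨_, rfl⟩
    obtain ⟨z, hz⟩ := T.Une n v (hc n)
    have hzZ := hUZ n hz
    obtain ⟨u, w, huw, hu, hw⟩ := exists_cross (K := ⋂ j, K j v)
      (T.Kc n v (hc n) v (hvK n) z hzZ.1) (mem_iInter.2 hvK)
      (fun h => (hZK n z hzZ).2 (mem_iInter.1 h _))
    rw [mem_iInter] at hu hw
    push Not at hw
    obtain ⟨j, hj⟩ := hw
    have hnj : n ≤ j := by
      by_contra h
      exact hj (T.Kanti v (by omega : j ≤ n) huw.2.2)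
    obtain ⟨m, h1, h2, h3, h4⟩ := T.drop hnj huw.2.2 hj
    have hwZ : w ∈ Z m := by
      refine ⟨h3, fun hl => h4 ?_⟩
      have hum := hu (m+1)
      rw [hKs] at hum ⊢
      exact ⟨hl, hum.2.tail ⟨huw.1, hum.1, hl⟩⟩
    have hd : dirD D d w u := by
      obtain ⟨e, he⟩ := sy_dirD (sy_symm huw.1)
      by_cases hed : e = d
      · exact hed ▸ he
      · have hed' : e = !d := by cases e <;> cases d <;> simp_all
        subst hed'
        exact absurd he (T.noedge m v (hc _) w h3 h4 u (hu _))
    refine ⟨m, by omega, fun j hj => ?_⟩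
    obtain ⟨x, hx, z', hz', hdz⟩ := T.hit m j v (hc j) hj ⟨u, hu j, w, hwZ, hd⟩
    exact ⟨z', hz', x, hUZ j hx, hdz⟩
  obtain ⟨φ, hφ, hφp⟩ := Nat.exists_strictMono_subsequence
    (P := fun m => ∀ j > m, ∃ x ∈ Z m, ∃ y ∈ Z j, dirD D d x y) hpers
  apply hAC
  have hlt : ∀ i j x, i < j → x ∈ Z i → x ∉ Z j := fun i j x hij hx hx' =>
    (hZK i x hx).2 (T.Kanti v (show i + 1 ≤ j from hij) (hZK j x hx').1)
  refine layers_AC2 d (fun i => Z (φ i)) ?_ ?_ ?_ ?_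
  · intro i j x hi hj
    apply hφ.injective
    by_contra hne
    rcases Nat.lt_or_gt_of_ne hne with h | h
    · exact hlt _ _ x h hi hj
    · exact hlt _ _ x h hj hi
  · exact fun i => lay_slive (T.Kl _ v (hc _)) (T.UK _ v (hc _)) (T.Ul _ v (hc _))
  · exact fun i => lay_conn (T.Kl _ v (hc _)) (T.UK _ v (hc _)) (T.Uc _ v (hc _))
  · exact fun i j hij => hφp i _ (hφ hij)

theorem TreeF.good {D : V → V → Prop} {B0 : Set V} {d : Bool} {C : Set V} {W : ℕ → Set V}
    {K U : ℕ → V → Set V} (T : TreeF D B0 d C W K U) (hN : NH D univ univ B0) (i : ℕ) :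
    ∀ n, ∀ v ∈ W n, Good D B0 (K n v \ W (n+i)) := by
  induction i with
  | zero =>
    intro n v hv
    have : K n v \ W (n+0) = ∅ := sdiff_eq_empty.2 (T.KW hv)
    rw [this]; exact Good.empty
  | succ i ih =>
    intro n v hv
    refine Good.del_finite hN (T.Uf n v hv) (Good.union (B := K n v \ U n v)
      (fun x hx => ⟨hx.1.1, hx.2⟩) ?_)
    intro w hw
    have hwK : w ∈ K n v := hw.1.1
    have hwn : w ∈ W n := T.KW hv hwK
    have e := T.Keq n v w hwK hv
    by_cases hg : Good D B0 (comp D (live D B0 (K n v \ U n v)) w)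
    · have : comp D (live D B0 (K n v \ U n v)) w ∩ ((K n v \ W (n + (i+1))) \ U n v) =
          comp D (live D B0 (K n v \ U n v)) w := by
        refine inter_eq_left.2 fun y hy => ⟨⟨hy.1.1.1, fun hyW => ?_⟩, hy.1.1.2⟩
        have hy1 : y ∈ W (n+1) := T.Wanti (by omega) hyW
        have e' := T.Keq n v y hy.1.1.1 hv
        refine T.Kbad _ y hy1 ?_
        rw [T.Ksucc n y hy1, e'.1, e'.2, comp_eq hy]
        exact hg
      rw [this]; exact hg
    · have hw1 : w ∈ W (n+1) := by
        apply T.Wsucc n w hwn <;> rw [e.1, e.2] <;> assumption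
      have := ih (n+1) w hw1
      rw [T.Ksucc n w hw1, e.1, e.2] at this
      convert this using 1
      ext y
      constructor
      · intro hy
        refine ⟨hy.1, fun h => hy.2.1.2 ?_⟩
        rwa [show n + (i+1) = n + 1 + i by omega]
      · intro hy
        refine ⟨hy.1, ⟨hy.1.1.1.1, fun h => hy.2 ?_⟩, hy.1.1.1.2⟩
        rwa [show n + 1 + i = n + (i+1) by omega]

theorem TreeF.cross {D : V → V → Prop} {B0 : Set V} {d : Bool} {C : Set V} {W : ℕ → Set V}
    {K U : ℕ → V → Set V} (T : TreeF D B0 d C W K U) {n : ℕ} {v a b : V} (hv : v ∈ W n)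
    {S : Set V} (hS : S ⊆ K n v) (hc : conn D S) (ha : a ∈ S) (hb : b ∈ S) (haW : a ∈ W (n+1))
    (hbW : b ∉ W (n+1)) (hl : (∀ x ∈ S, x ∉ U n v) → S ⊆ live D B0 (K n v \ U n v)) :
    (S ∩ U n v).Nonempty := by
  by_contra hne
  have hl := hl fun x hx hxU => hne ⟨x, hx, hxU⟩
  apply hbW
  have e := T.Keq n v a (hS ha) hv
  have ha' := (T.W_iff _ a).1 haW
  apply T.KW haW
  rw [T.Ksucc n a haW, e.1, e.2] at ha' ⊢
  exact conn_sub_comp hc hl ha ha' hb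

theorem TreeF.final {D : V → V → Prop} {B0 : Set V} {d : Bool} {C : Set V} {W : ℕ → Set V}
    {K U : ℕ → V → Set V} (T : TreeF D B0 d C W K U) (hAC : ¬ ContainsAltComb D B0)
    (hN : NH D univ univ B0) (hne : C.Nonempty) : Good D B0 C := by
  intro X
  have hNX : ∀ G, NH D G X B0 := fun G => hN.mono (fun _ _ => id) (subset_univ _) (subset_univ _) subset_rfl
  obtain ⟨c, hc⟩ := hne
  have hgood : ∀ n, Good D B0 (C \ W n) := by
    intro n
    have := T.good hN n 0 c (by rw [T.W0]; exact hc)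
    rwa [T.K0, Nat.zero_add] at this
  have hκ : ∀ n, ∀ v ∈ W n, v ∈ K n v ∧ K n v ⊆ W n := fun n v hv => ⟨(T.W_iff n v).1 hv, T.KW hv⟩
  have hκe : ∀ n, ∀ v ∈ W n, ∀ w ∈ K n v, K n w = K n v := fun n v hv w hw => (T.Keq n v w hw hv).1
  cases d with
  | false =>
    refine limit_thm (W := W) (κ := K) T.Wanti T.W0 (T.exhaust hAC) ?_ hκ hκe ?_ ?_ (hNX _)
      (fun n => hgood n X)
    · intro m v hv w _ hvm h
      exact T.out hv hvm (by simpa [dirD] using h)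
    · intro n v hv w hw h
      exact T.Kadj hv hw (Or.inl h)
    · intro n v hv
      refine ⟨U n v, T.Uf n v hv, ?_⟩
      intro S a b hS hseg haW hb hbW
      exact T.cross hv hS hseg.conn' hseg.1 hseg.2.1 haW hbW fun h =>
        slive_sub_live (hseg.slive hb) fun x hx => ⟨hS hx, h x hx⟩
  | true =>
    have : HasBase (flip D) C B0 X := by
      refine limit_thm (W := W) (κ := K) T.Wanti T.W0 (T.exhaust hAC) ?_ hκ hκe ?_ ?_ (hNX _).flip
        (fun n => (hgood n X).dual (hNX _))
      · intro m v hv w _ hvm h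
        exact T.out hv hvm (by simpa [dirD, flip] using h)
      · intro n v hv w hw h
        exact T.Kadj hv hw (Or.inr h)
      · intro n v hv
        refine ⟨U n v, T.Uf n v hv, ?_⟩
        intro S a b hS hseg haW hb hbW
        have hseg' : Seg D S b a := hseg.flip
        refine T.cross hv hS hseg'.conn' hseg.1 hseg.2.1 haW hbW fun h => ?_
        have haK := (T.W_iff _ a).1 haW
        have e := T.Keq n v a (hS hseg.1) hv
        rw [T.Ksucc n a haW, e.1, e.2] at haK
        obtain ⟨b', hb', hr⟩ := haK.1.2
        intro x hx
        have hSU : S ⊆ K n v \ U n v := fun y hy => ⟨hS hy, h y hy⟩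
        exact ⟨hSU hx, b', hb', (rs_mono hSU (hseg'.2.2.2 x hx).2).trans hr⟩
    exact this.dual (hNX _).flip

theorem good_univ {D : V → V → Prop} {B0 : Set V} (hAC : ¬ ContainsAltComb D B0) :
    Good D B0 univ := by
  have hN := hotel hAC
  by_contra hbad
  have hne : (Bst D B0).Nonempty := by
    by_contra hno
    apply hbad
    refine Good.union (B := univ) subset_rfl fun v hv => ?_
    rw [inter_univ]
    by_contra hg
    exact hno ⟨(comp D (live D B0 univ) v, v), comp_conn, comp_slive, mem_comp hv, hg⟩
  apply hAC
  refine alt_AC (Bst D B0) hne ?_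
  rintro ⟨C, c⟩ hC d
  by_contra hno
  push Not at hno
  obtain ⟨W, K, U, T⟩ := exists_tree (d := !d) hC (by simpa using hno)
  exact hC.2.2.2 (T.final hAC hN ⟨c, hC.2.2.1⟩)

theorem DiPath.toSeg {D : V → V → Prop} (p : DiPath D) : Seg D p.vertSet p.first p.last := by
  obtain ⟨l, hne, hnd, hch⟩ := p
  have hch' : List.IsChain D l := hch
  rw [List.isChain_iff_getElem] at hch'
  have hlen : 0 < l.length := List.length_pos_iff.2 hne
  let q : ℕ → V := fun i => l.getD i (l.head hne)
  have hq : ∀ i (hi : i < l.length), q i = l[i] := fun i hi => by simp [q, hi]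
  have := Seg.ofPath (E := D) q 0 (l.length - 1) (Nat.zero_le _) (fun j _ hj => by
    rw [hq j (by omega), hq (j+1) (by omega)]
    exact hch' j (by omega))
  have e1 : q 0 = l.head hne := by rw [hq 0 hlen, List.head_eq_getElem]
  have e2 : q (l.length - 1) = l.getLast hne := by rw [hq _ (by omega), List.getLast_eq_getElem]
  have e3 : q '' Icc 0 (l.length - 1) = {v | v ∈ l} := by
    ext v
    constructor
    · rintro ⟨i, hi, rfl⟩
      have : i < l.length := by have := hi.2; omega
      rw [hq i this]
      exact List.getElem_mem _
    · intro hv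
      obtain ⟨i, hi, rfl⟩ := List.getElem_of_mem hv
      exact ⟨i, ⟨Nat.zero_le _, by omega⟩, hq i hi⟩
  rw [e1, e2, e3] at this
  exact this

theorem linkable_iff {D : V → V → Prop} {B0 I : Set V} : Linkable D B0 I ↔ LkI D univ B0 I := by
  classical
  constructor
  · rintro ⟨P, ⟨h1, h2⟩, rfl⟩
    rw [LkI.iff]
    have : ∀ v, ∃ (S : Set V) (e : V), v ∈ Ini P → ∃ p ∈ P, p.first = v ∧ S = p.vertSet ∧ e = p.last := by
      intro v
      by_cases hv : v ∈ Ini P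
      · obtain ⟨p, hp, hpv⟩ := hv
        exact ⟨p.vertSet, p.last, fun _ => ⟨p, hp, hpv, rfl, rfl⟩⟩
      · exact ⟨∅, v, fun h => absurd h hv⟩
    choose S e h using this
    refine ⟨S, e, ?_, ?_⟩
    · intro a ha
      obtain ⟨p, hp, hpv, hS, he⟩ := h a ha
      rw [hS, he]
      exact ⟨subset_univ _, hpv ▸ p.toSeg, h1 p hp⟩
    · intro a ha a' ha' x hx hx'
      obtain ⟨p, hp, hpv, hS, he⟩ := h a ha
      obtain ⟨p', hp', hpv', hS', he'⟩ := h a' ha'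
      rw [hS] at hx
      rw [hS'] at hx'
      have : p = p' := by
        by_contra hne
        exact Set.disjoint_left.1 (h2 p hp p' hp' hne) hx hx'
      rw [← hpv, ← hpv', this]
  · rintro ⟨B, hB, hL⟩
    obtain ⟨n, p, h1, h2, h3⟩ := hL.toP
    have hp : ∀ a : I, ∃ q : DiPath D, q.first = a ∧ q.last ∈ B0 ∧
        ∀ w ∈ q.vertSet, ∃ i ≤ n a, w = p a i := by
      rintro ⟨a, ha⟩
      obtain ⟨g0, g1, g2, _⟩ := h1 a ha
      refine ⟨⟨(List.range (n a + 1)).map (p a), by simp, ?_, ?_⟩, ?_, ?_, ?_⟩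
      · rw [List.nodup_map_iff_inj_on List.nodup_range]
        intro x hx y hy hxy
        simp only [List.mem_range] at hx hy
        exact (h2 a ha a ha x (by omega) y (by omega) hxy).2
      · show List.IsChain _ _
        rw [List.isChain_iff_getElem]
        intro i hi
        simp only [List.length_map, List.length_range] at hi
        simp only [List.getElem_map, List.getElem_range]
        exact g2 i (by omega)
      · simp [DiPath.first, g0]
      · simp only [DiPath.last, List.getLast_map, List.getLast_range]
        exact hB g1
      · intro w hw
        simp only [DiPath.vertSet, mem_ofPred_eq, List.mem_map, List.mem_range] at hw
        obtain ⟨i, hi, rfl⟩ := hw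
        exact ⟨i, Nat.lt_succ_iff.1 hi, rfl⟩
    choose q hq1 hq2 hq3 using hp
    refine ⟨range q, ⟨?_, ?_⟩, ?_⟩
    · rintro _ ⟨a, rfl⟩; exact hq2 a
    · rintro _ ⟨a, rfl⟩ _ ⟨a', rfl⟩ hne
      rw [Set.disjoint_left]
      intro x hx hx'
      obtain ⟨i, hi, e1⟩ := hq3 a x hx
      obtain ⟨j, hj, e2⟩ := hq3 a' x hx'
      have := (h2 a a.2 a' a'.2 i hi j hj (e1.symm.trans e2)).1
      exact hne (by rw [Subtype.ext this])
    · ext v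
      constructor
      · rintro ⟨_, ⟨a, rfl⟩, rfl⟩
        rw [hq1]; exact a.2
      · intro hv
        exact ⟨q ⟨v, hv⟩, ⟨_, rfl⟩, hq1 _⟩

/-- Any dimaze whose linkability system is not a matroid contains an alternating comb. -/
theorem not_matroid_containsAC (D : V → V → Prop) (B0 : Set V)
    (hD : IsDimaze D B0) (h : ¬ IsMatroidIndep (Linkable D B0)) :
    ContainsAltComb D B0 := by
  by_contra hAC
  have hN := hotel hAC
  have hG := good_univ hAC
  have hmono : ∀ I J : Set V, I ⊆ J → Linkable D B0 J → Linkable D B0 I := by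
    intro I J hIJ hJ
    rw [linkable_iff] at hJ ⊢
    exact hJ.mono subset_rfl subset_rfl hIJ
  refine h ⟨?_, hmono, ?_, ?_⟩
  · refine ⟨∅, ⟨by simp, by simp⟩, ?_⟩
    ext v
    simp [Ini]
  · intro I B hI hIm hB
    by_contra hno
    push Not at hno
    apply hIm
    have hIM : MaxS D univ (I ∪ B) B0 I := by
      refine ⟨subset_union_left, linkable_iff.1 hI, fun A' hA hA' hL => ?_⟩
      refine Subset.antisymm (fun x hx => ?_) hA
      by_contra hxI
      exact hno x ⟨(hA' hx).resolve_left hxI, hxI⟩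
        (hmono _ A' (insert_subset hx hA) (linkable_iff.2 hL))
    have hBM : MaxS D univ univ B0 B :=
      ⟨subset_univ _, linkable_iff.1 hB.1, fun A' hA _ hL => hB.2 A' (linkable_iff.2 hL) hA⟩
    have := i3_aux hN (subset_univ _) hIM hBM
    exact ⟨hI, fun J hJ hIJ => this.2.2 J hIJ (subset_univ _) (linkable_iff.1 hJ)⟩
  · intro I X hI hIX
    obtain ⟨A, hIA, hA⟩ := (hG X).ext
      (hN.mono (fun _ _ => id) subset_rfl (subset_univ _) subset_rfl) hIX (linkable_iff.1 hI)
    exact ⟨A, linkable_iff.2 hA.2.1, hIA, hA.1, fun K hK hKX hAK =>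
      hA.2.2 K hAK hKX (linkable_iff.1 hK)⟩
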